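/- arXiv:2211.05072 — 3 statements merged into one kernel-verified Lean document; each statement's English description precedes it below -/
import Mathlib

section
/- All Taylor coefficients of G at 0 are nonnegative real numbers: there exists a sequence a : ℕ → ℝ with a(n) ≥ 0 for all n such that for every complex number q with |q| < 1, the series Σ_{n=0}^∞ a(n) q^n converges to G(q) = ∏_{k=1}^∞ 1/(1 + (−1)^k q^{2k−1}). -/
open Real Filter Topology

namespace OddProduct

/-- The `m`-th term of the Lambert-type series for `log ∏ (1 + (-1)^(k+1) q^(2k+1))⁻¹`. -/
noncomputable def logTerm (q : ℂ) (m : ℕ) : ℂ := q ^ m / (m * (1 - (-1) ^ m * q ^ (2 * m)))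

/-- The generating function, as an exponential. -/
noncomputable def gen (q : ℂ) : ℂ := Complex.exp (∑' m, logTerm q m)

lemma summable_double {q : ℂ} (hq : ‖q‖ < 1) :
    Summable (fun x : ℕ × ℕ => ((-1 : ℂ) ^ x.1 * q ^ (2 * x.1 + 1)) ^ x.2 / (x.2 : ℂ)) := by
  have hs := (summable_geometric_of_lt_one (norm_nonneg q) hq)
  have hp := hs.mul_of_nonneg hs (fun _ => by positivity) (fun _ => by positivity)
  refine Summable.of_norm_bounded hp ?_
  rintro ⟨k, m⟩
  rcases Nat.eq_zero_or_pos m with rfl | hm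
  · simp
  · simp only [norm_div, norm_pow, norm_mul, norm_neg, norm_one, one_pow, one_mul,
      Complex.norm_natCast]
    rw [← pow_mul, ← pow_add]
    have h1 : (1 : ℝ) ≤ m := by exact_mod_cast hm
    calc ‖q‖ ^ ((2 * k + 1) * m) / (m : ℝ) ≤ ‖q‖ ^ ((2 * k + 1) * m) :=
          div_le_self (by positivity) h1
      _ ≤ ‖q‖ ^ (k + m) := pow_le_pow_of_le_one (norm_nonneg q) hq.le (by nlinarith)

lemma norm_factor_lt {q : ℂ} (hq : ‖q‖ < 1) (k : ℕ) : ‖(-1 : ℂ) ^ k * q ^ (2 * k + 1)‖ < 1 := by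
  simp only [norm_pow, norm_mul, norm_neg, norm_one, one_pow, one_mul]
  exact pow_lt_one₀ (norm_nonneg q) hq (by omega)

lemma hasSum_logTerm {q : ℂ} (hq : ‖q‖ < 1) (m : ℕ) :
    HasSum (fun k : ℕ => ((-1 : ℂ) ^ k * q ^ (2 * k + 1)) ^ m / (m : ℂ)) (logTerm q m) := by
  rcases Nat.eq_zero_or_pos m with rfl | hm
  · simp [logTerm, hasSum_zero]
  have h1 : ‖(-1 : ℂ) ^ m * q ^ (2 * m)‖ < 1 := by
    simp only [norm_pow, norm_mul, norm_neg, norm_one, one_pow, one_mul]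
    exact pow_lt_one₀ (norm_nonneg q) hq (by omega)
  have h2 := (hasSum_geometric_of_norm_lt_one h1).mul_left (q ^ m / (m : ℂ))
  have e1 : logTerm q m = q ^ m / (m : ℂ) * (1 - (-1) ^ m * q ^ (2 * m))⁻¹ := by
    rw [logTerm, div_mul_eq_div_div, div_eq_mul_inv]
  rw [e1]
  refine h2.congr_fun ?_
  intro k
  ring

lemma exists_hasSum_log {q : ℂ} (hq : ‖q‖ < 1) : ∃ S : ℂ, HasSum (logTerm q) S ∧
    HasSum (fun k : ℕ => -Complex.log (1 - (-1 : ℂ) ^ k * q ^ (2 * k + 1))) S := by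
  obtain ⟨S, hS⟩ := summable_double hq
  refine ⟨S, ?_, ?_⟩
  · have h := (Equiv.prodComm ℕ ℕ).hasSum_iff.mpr hS
    exact HasSum.prod_fiberwise h fun m => hasSum_logTerm hq m
  · refine HasSum.prod_fiberwise hS fun k => ?_
    have h := Complex.hasSum_taylorSeries_neg_log (norm_factor_lt hq k)
    simpa only using h

lemma hasProd_gen {q : ℂ} (hq : ‖q‖ < 1) :
    HasProd (fun k : ℕ => (1 + (-1 : ℂ) ^ (k + 1) * q ^ (2 * k + 1))⁻¹) (gen q) := by
  obtain ⟨S, h2, h1⟩ := exists_hasSum_log hq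
  have h3 := h1.cexp
  rw [gen, h2.tsum_eq]
  refine h3.congr_fun ?_
  intro k
  have hne : 1 - (-1 : ℂ) ^ k * q ^ (2 * k + 1) ≠ 0 := by
    intro h
    have := norm_factor_lt hq k
    rw [← sub_eq_zero.mp h] at this
    simp at this
  simp only [Function.comp, Complex.exp_neg, Complex.exp_log hne]
  congr 1
  ring

lemma summable_logTerm {q : ℂ} (hq : ‖q‖ < 1) : Summable (logTerm q) := by
  have := (Equiv.prodComm ℕ ℕ).summable_iff.mpr (summable_double hq)
  exact (this.hasSum.prod_fiberwise fun m => hasSum_logTerm hq m).summable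

lemma norm_one_sub_ge {q : ℂ} {r : ℝ} (hq : ‖q‖ ≤ r) (hr : r < 1) {m : ℕ} (hm : 0 < m) :
    1 - r ≤ ‖1 - (-1 : ℂ) ^ m * q ^ (2 * m)‖ := by
  have h1 : ‖(-1 : ℂ) ^ m * q ^ (2 * m)‖ ≤ r := by
    simp only [norm_pow, norm_mul, norm_neg, norm_one, one_pow, one_mul]
    calc ‖q‖ ^ (2 * m) ≤ ‖q‖ ^ 1 :=
          pow_le_pow_of_le_one (norm_nonneg q) (hq.trans hr.le) (by omega)
      _ ≤ r := by simpa using hq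
  have h2 := norm_sub_norm_le (1 : ℂ) ((-1 : ℂ) ^ m * q ^ (2 * m))
  simp only [norm_one] at h2
  linarith

lemma differentiableOn_gen : DifferentiableOn ℂ gen (Metric.ball 0 1) := by
  intro q hq
  rw [mem_ball_zero_iff] at hq
  obtain ⟨r, hqr, hr⟩ := exists_between hq
  have hr0 : 0 ≤ r := (norm_nonneg q).trans hqr.le
  have hd : DifferentiableOn ℂ (fun q => ∑' m, logTerm q m) (Metric.ball 0 r) := by
    refine Complex.differentiableOn_tsum_of_summable_norm
      (u := fun m : ℕ => r ^ m / (1 - r)) ?_ ?_ Metric.isOpen_ball ?_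
    · exact (summable_geometric_of_lt_one hr0 hr).div_const _
    · intro m z hz
      rw [mem_ball_zero_iff] at hz
      rcases Nat.eq_zero_or_pos m with rfl | hm
      · simp only [logTerm, Nat.cast_zero, zero_mul, div_zero]
        exact differentiableWithinAt_const 0
      have hne : (m : ℂ) * (1 - (-1 : ℂ) ^ m * z ^ (2 * m)) ≠ 0 := by
        refine mul_ne_zero (by exact_mod_cast hm.ne') fun h => ?_
        have := norm_one_sub_ge hz.le hr hm
        rw [h, norm_zero] at this
        linarith
      unfold logTerm
      fun_prop (disch := assumption)
    · intro m z hz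
      rw [mem_ball_zero_iff] at hz
      rcases Nat.eq_zero_or_pos m with rfl | hm
      · simp only [logTerm, Nat.cast_zero, zero_mul, div_zero, norm_zero]
        have := sub_pos.mpr hr
        positivity
      rw [logTerm, norm_div, norm_mul, norm_pow, Complex.norm_natCast]
      have h1 : (1 : ℝ) ≤ m := by exact_mod_cast hm
      have h2 := norm_one_sub_ge hz.le hr hm
      have h3 := sub_pos.mpr hr
      have h4 : 1 - r ≤ (m : ℝ) * ‖1 - (-1 : ℂ) ^ m * z ^ (2 * m)‖ := by nlinarith
      gcongr
  exact ((hd.differentiableAt (Metric.isOpen_ball.mem_nhds (by simpa using hqr))).cexp).differentiableWithinAt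

lemma gen_conj {q : ℂ} : gen (starRingEnd ℂ q) = starRingEnd ℂ (gen q) := by
  rw [gen, gen, ← Complex.exp_conj, Complex.conj_tsum]
  simp [logTerm]

/-- `gen` has a Taylor expansion with real coefficients on the unit disc. -/
lemma exists_real_coeff : ∃ a : ℕ → ℝ, ∀ q : ℂ, ‖q‖ < 1 →
    HasSum (fun n : ℕ => (a n : ℂ) * q ^ n) (gen q) := by
  set c : ℕ → ℂ := fun n => (n.factorial : ℂ)⁻¹ * iteratedDeriv n gen 0
  have hc : ∀ q : ℂ, ‖q‖ < 1 → HasSum (fun n : ℕ => c n * q ^ n) (gen q) := by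
    intro q hq
    have := Complex.hasSum_taylorSeries_on_ball (c := 0) (r := 1) (f := gen) (z := q)
      (by simpa using differentiableOn_gen) (by simpa using hq)
    refine this.congr_fun fun n => ?_
    simp only [c, sub_zero, smul_eq_mul]
    ring
  refine ⟨fun n => (c n).re, fun q hq => ?_⟩
  have h1 := hc q hq
  have h2 := hc (starRingEnd ℂ q) (by simpa using hq)
  rw [gen_conj] at h2
  have h3 := Complex.hasSum_conj'.mpr h2
  have h4 := (h1.add h3).mul_left (1 / 2 : ℂ)
  have e1 : gen q = 1 / 2 * (gen q + starRingEnd ℂ (starRingEnd ℂ (gen q))) := by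
    rw [Complex.conj_conj]
    ring
  rw [e1]
  refine h4.congr_fun fun n => ?_
  rw [Complex.re_eq_add_conj]
  simp only [map_mul, map_pow, Complex.conj_conj]
  ring

/-- The real part of `gen (e^{-t+iθ}) e^{-inθ}`. -/
noncomputable def integrand (t : ℝ) (n : ℕ) (θ : ℝ) : ℝ :=
  (gen (Complex.exp (-t + θ * Complex.I)) * Complex.exp (-(n * θ * Complex.I))).re

lemma norm_exp_lt_one {t : ℝ} (ht : 0 < t) (θ : ℝ) :
    ‖Complex.exp (-t + θ * Complex.I)‖ < 1 := by
  rw [Complex.norm_exp]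
  simpa using ht

lemma continuous_integrand {t : ℝ} (ht : 0 < t) (n : ℕ) : Continuous (integrand t n) := by
  have h : Continuous fun θ : ℝ => gen (Complex.exp (-t + θ * Complex.I)) :=
    differentiableOn_gen.continuousOn.comp_continuous (by fun_prop)
      fun θ => by simpa using norm_exp_lt_one ht θ
  unfold integrand
  fun_prop

lemma hasSum_integrand {a : ℕ → ℝ}
    (ha : ∀ q : ℂ, ‖q‖ < 1 → HasSum (fun n : ℕ => (a n : ℂ) * q ^ n) (gen q))
    {t : ℝ} (ht : 0 < t) (n : ℕ) (θ : ℝ) :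
    HasSum (fun m : ℕ => a m * exp (-t) ^ m * cos (((m : ℝ) - n) * θ)) (integrand t n θ) := by
  have h := (ha _ (norm_exp_lt_one ht θ)).mul_right (Complex.exp (-(n * θ * Complex.I)))
  have h2 := Complex.hasSum_re h
  refine h2.congr_fun fun m => ?_
  have : (a m : ℂ) * Complex.exp (-t + θ * Complex.I) ^ m * Complex.exp (-(n * θ * Complex.I))
      = ((a m * exp (-t) ^ m : ℝ) : ℂ) * Complex.exp ((((m : ℝ) - n) * θ : ℝ) * Complex.I) := by
    push_cast
    rw [← Complex.exp_nat_mul, ← Complex.exp_nat_mul, mul_assoc (a m : ℂ), mul_assoc (a m : ℂ),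
      ← Complex.exp_add, ← Complex.exp_add]
    congr 2
    ring
  rw [this, Complex.re_ofReal_mul, Complex.exp_ofReal_mul_I_re]

lemma integral_cos_int_mul (k : ℤ) :
    ∫ θ in (0 : ℝ)..π, cos ((k : ℝ) * θ) = if k = 0 then π else 0 := by
  split_ifs with h
  · simp [h]
  · have hk : (k : ℝ) ≠ 0 := by exact_mod_cast h
    rw [intervalIntegral.integral_comp_mul_left (fun x => cos x) hk, integral_cos]
    simp [Real.sin_int_mul_pi]

lemma integral_integrand {a : ℕ → ℝ}
    (ha : ∀ q : ℂ, ‖q‖ < 1 → HasSum (fun n : ℕ => (a n : ℂ) * q ^ n) (gen q))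
    {t : ℝ} (ht : 0 < t) (n : ℕ) :
    ∫ θ in (0 : ℝ)..π, integrand t n θ = π * (a n * exp (-t) ^ n) := by
  have hsum : Summable fun m : ℕ => ‖a m * exp (-t) ^ m‖ := by
    have h := (ha (exp (-t) : ℝ) (by
      rw [Complex.norm_real, norm_of_nonneg (exp_pos _).le]
      simpa using ht)).summable.norm
    refine h.congr fun m => ?_
    rw [norm_mul, norm_mul, Complex.norm_real, norm_pow, norm_pow, Complex.norm_real]
  have h1 : HasSum (fun m : ℕ => ∫ θ in (0 : ℝ)..π, a m * exp (-t) ^ m * cos (((m : ℝ) - n) * θ))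
      (∫ θ in (0 : ℝ)..π, integrand t n θ) := by
    refine intervalIntegral.hasSum_integral_of_dominated_convergence
      (fun m _ => ‖a m * exp (-t) ^ m‖) ?_ ?_ ?_ ?_ ?_
    · intro m
      exact (by fun_prop : Continuous fun θ : ℝ =>
        a m * exp (-t) ^ m * cos (((m : ℝ) - n) * θ)).aestronglyMeasurable
    · intro m
      refine Eventually.of_forall fun θ _ => ?_
      rw [norm_mul _ (cos _)]
      exact mul_le_of_le_one_right (norm_nonneg _) (abs_cos_le_one _)
    · exact Eventually.of_forall fun _ _ => hsum
    · exact intervalIntegrable_const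
    · exact Eventually.of_forall fun θ _ => hasSum_integrand ha ht n θ
  have h2 : ∀ m : ℕ, ∫ θ in (0 : ℝ)..π, a m * exp (-t) ^ m * cos (((m : ℝ) - n) * θ)
      = if m = n then π * (a n * exp (-t) ^ n) else 0 := by
    intro m
    rw [intervalIntegral.integral_const_mul]
    have := integral_cos_int_mul ((m : ℤ) - n)
    push_cast at this
    rw [this]
    by_cases hmn : m = n
    · simp [hmn, mul_comm]
    · have : (m : ℤ) - n ≠ 0 := by omega
      simp [hmn, this]
  simp_rw [h2] at h1
  exact h1.unique (hasSum_ite_eq n _)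

section EulerSeries

open Polynomial Asymptotics

variable {R S : Type*} [CommRing R] [CommRing S]

/-- The sign `(-1)^(j(j+1)/2)`. -/
def eulerSign (R : Type*) [CommRing R] (j : ℕ) : R := if j % 4 = 0 ∨ j % 4 = 3 then 1 else -1

/-- The common denominator `(p; p)_J` with `p = -x²`. -/
def eulerDen (x : R) : ℕ → R
  | 0 => 1
  | J + 1 => eulerDen x J * (1 - (-x ^ 2) ^ (J + 1))

/-- The numerator of the partial sum over `j ≤ J` of Euler's series. -/
def eulerNum (x : R) : ℕ → R
  | 0 => 1
  | J + 1 => eulerNum x J * (1 - (-x ^ 2) ^ (J + 1)) + eulerSign R (J + 1) * x ^ (J + 1) ^ 2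

lemma map_eulerSign (f : R →+* S) (j : ℕ) : f (eulerSign R j) = eulerSign S j := by
  unfold eulerSign
  split_ifs <;> simp

lemma map_eulerDen (f : R →+* S) (x : R) (J : ℕ) : f (eulerDen x J) = eulerDen (f x) J := by
  induction J with
  | zero => simp [eulerDen]
  | succ J ih => simp [eulerDen, ih]

lemma map_eulerNum (f : R →+* S) (x : R) (J : ℕ) : f (eulerNum x J) = eulerNum (f x) J := by
  induction J with
  | zero => simp [eulerNum]
  | succ J ih => simp [eulerNum, ih, map_eulerSign]

lemma eulerSign_succ (j : ℕ) : eulerSign R (j + 1) = eulerSign R j * (-1) ^ (j + 1) := by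
  obtain ⟨k, r, hr, rfl⟩ : ∃ k r, r < 4 ∧ j = 4 * k + r :=
    ⟨j / 4, j % 4, Nat.mod_lt _ (by norm_num), by omega⟩
  have h4 : ((-1 : R) ^ 4) = 1 := by norm_num
  interval_cases r <;>
    simp [eulerSign, Nat.add_mod, Nat.mul_mod_right, pow_add, pow_mul, h4]
  norm_num

lemma eulerNum_zero (J : ℕ) : eulerNum (0 : R) J = 1 := by
  induction J with
  | zero => simp [eulerNum]
  | succ J ih => simp [eulerNum, ih]

end EulerSeries

section Analytic

open Polynomial Asymptotics

variable {q : ℂ}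

/-- The coefficients of Euler's expansion of `(z; p)_∞` with `p = -q²`. -/
noncomputable def eulerCoeff (q : ℂ) (j : ℕ) : ℂ :=
  eulerSign ℂ j * q ^ (j * j - j) / eulerDen q j

lemma norm_eulerSign (j : ℕ) : ‖eulerSign ℂ j‖ = 1 := by
  unfold eulerSign
  split_ifs <;> simp

lemma norm_eulerDen_ge (hq : ‖q‖ ≤ 1 / 2) (j : ℕ) : (3 / 4 : ℝ) ^ j ≤ ‖eulerDen q j‖ := by
  induction j with
  | zero => simp [eulerDen]
  | succ j ih =>
    have h : (3 / 4 : ℝ) ≤ ‖1 - (-q ^ 2) ^ (j + 1)‖ := by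
      have h1 : ‖(-q ^ 2) ^ (j + 1)‖ ≤ 1 / 4 := by
        have h2 : ‖-q ^ 2‖ ≤ 1 / 4 := by
          rw [norm_neg, norm_pow]
          nlinarith [norm_nonneg q]
        rw [norm_pow]
        calc ‖-q ^ 2‖ ^ (j + 1) ≤ ‖-q ^ 2‖ ^ 1 :=
              pow_le_pow_of_le_one (norm_nonneg _) (by linarith) (by omega)
          _ ≤ 1 / 4 := by simpa using h2
      have := norm_sub_norm_le (1 : ℂ) ((-q ^ 2) ^ (j + 1))
      rw [norm_one] at this
      linarith
    rw [eulerDen, norm_mul, pow_succ]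
    gcongr

lemma eulerDen_ne_zero (hq : ‖q‖ ≤ 1 / 2) (j : ℕ) : eulerDen q j ≠ 0 := by
  intro h
  have := norm_eulerDen_ge hq j
  rw [h, norm_zero] at this
  have h2 : (0 : ℝ) < (3 / 4) ^ j := by positivity
  linarith

lemma norm_eulerCoeff_le (hq : ‖q‖ ≤ 1 / 2) (j : ℕ) :
    ‖eulerCoeff q j‖ ≤ (4 / 3) ^ j * ‖q‖ ^ (j * j - j) := by
  rw [eulerCoeff, norm_div, norm_mul, norm_eulerSign, one_mul, norm_pow]
  rw [div_le_iff₀ (norm_pos_iff.mpr (eulerDen_ne_zero hq j))]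
  have h := norm_eulerDen_ge hq j
  have h2 : (4 / 3 : ℝ) ^ j * (3 / 4) ^ j = 1 := by rw [← mul_pow]; norm_num
  calc ‖q‖ ^ (j * j - j) = ‖q‖ ^ (j * j - j) * ((4 / 3 : ℝ) ^ j * (3 / 4) ^ j) := by rw [h2, mul_one]
    _ = (4 / 3) ^ j * ‖q‖ ^ (j * j - j) * (3 / 4) ^ j := by ring
    _ ≤ _ := by gcongr

lemma norm_eulerCoeff_le' (hq : ‖q‖ ≤ 1 / 2) (j : ℕ) : ‖eulerCoeff q j‖ ≤ (4 / 3) ^ j :=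
  (norm_eulerCoeff_le hq j).trans (mul_le_of_le_one_right (by positivity)
    (pow_le_one₀ (norm_nonneg q) (by linarith)))

lemma eulerCoeff_succ (hq : ‖q‖ ≤ 1 / 2) (j : ℕ) :
    eulerCoeff q (j + 1) * (1 - (-q ^ 2) ^ (j + 1)) = -(-q ^ 2) ^ j * eulerCoeff q j := by
  have h1 := eulerDen_ne_zero hq j
  have h2 := eulerDen_ne_zero hq (j + 1)
  rw [eulerDen] at h2
  have h3 := right_ne_zero_of_mul h2
  rw [eulerCoeff, eulerCoeff, eulerDen, eulerSign_succ]
  have h4 : (j + 1) * (j + 1) - (j + 1) = (j * j - j) + 2 * j := by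
    have : j ≤ j * j := Nat.le_mul_self j
    zify [this, Nat.le_mul_self (j + 1)]
    ring
  rw [h4, pow_add q, pow_mul q 2 j, neg_pow (q ^ 2) j, pow_succ (-1 : ℂ)]
  field_simp

/-- Euler's series as a function of `z`. -/
noncomputable def eulerSeries (q z : ℂ) : ℂ := ∑' j, eulerCoeff q j * z ^ j

lemma norm_eulerTerm_le (hq : ‖q‖ ≤ 1 / 2) {z : ℂ} (hz : ‖z‖ ≤ 1 / 2) (j : ℕ) :
    ‖eulerCoeff q j * z ^ j‖ ≤ (2 / 3) ^ j := by
  rw [norm_mul, norm_pow]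
  calc ‖eulerCoeff q j‖ * ‖z‖ ^ j ≤ (4 / 3) ^ j * (1 / 2) ^ j := by
        gcongr
        exact norm_eulerCoeff_le' hq j
    _ = (2 / 3) ^ j := by rw [← mul_pow]; norm_num

lemma hasSum_eulerSeries (hq : ‖q‖ ≤ 1 / 2) {z : ℂ} (hz : ‖z‖ ≤ 1 / 2) :
    HasSum (fun j => eulerCoeff q j * z ^ j) (eulerSeries q z) :=
  (Summable.of_norm_bounded (summable_geometric_of_lt_one (by norm_num) (by norm_num))
    (norm_eulerTerm_le hq hz)).hasSum

lemma eulerCoeff_zero : eulerCoeff q 0 = 1 := by simp [eulerCoeff, eulerSign, eulerDen]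

lemma hasSum_eulerSeries_sub_one (hq : ‖q‖ ≤ 1 / 2) {z : ℂ} (hz : ‖z‖ ≤ 1 / 2) :
    HasSum (fun j => eulerCoeff q (j + 1) * z ^ (j + 1)) (eulerSeries q z - 1) := by
  have := (hasSum_nat_add_iff' (f := fun j => eulerCoeff q j * z ^ j) 1).mpr
    (hasSum_eulerSeries hq hz)
  simpa [eulerCoeff_zero] using this

lemma eulerSeries_functional (hq : ‖q‖ ≤ 1 / 2) {z : ℂ} (hz : ‖z‖ ≤ 1 / 2) :
    eulerSeries q z = (1 - z) * eulerSeries q (-q ^ 2 * z) := by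
  have hz' : ‖-q ^ 2 * z‖ ≤ 1 / 2 := by
    rw [norm_mul, norm_neg, norm_pow]
    have : ‖q‖ ^ 2 ≤ 1 := by nlinarith [norm_nonneg q]
    nlinarith [norm_nonneg z]
  have h1 := hasSum_eulerSeries_sub_one hq hz
  have h2 := hasSum_eulerSeries_sub_one hq hz'
  have h3 := (hasSum_eulerSeries hq hz').mul_left z
  have h4 := (h2.sub h3).unique (h1.congr_fun fun j => ?_)
  · linear_combination -h4
  · have := eulerCoeff_succ hq j
    rw [mul_pow, mul_pow]
    linear_combination (-z ^ (j + 1)) * this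

lemma eulerSeries_prod (hq : ‖q‖ ≤ 1 / 2) (n : ℕ) :
    eulerSeries q q = (∏ k ∈ Finset.range n, (1 - (-q ^ 2) ^ k * q)) *
      eulerSeries q ((-q ^ 2) ^ n * q) := by
  induction n with
  | zero => simp
  | succ n ih =>
    have h : ‖(-q ^ 2) ^ n * q‖ ≤ 1 / 2 := by
      rw [norm_mul, norm_pow, norm_neg, norm_pow, ← pow_mul]
      have : ‖q‖ ^ (2 * n) ≤ 1 := pow_le_one₀ (norm_nonneg q) (by linarith)
      nlinarith [norm_nonneg q]
    rw [ih, Finset.prod_range_succ, eulerSeries_functional hq h, mul_assoc]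
    congr 3
    ring

lemma norm_eulerSeries_sub_one_le (hq : ‖q‖ ≤ 1 / 2) {z : ℂ} (hz : ‖z‖ ≤ 1 / 2) :
    ‖eulerSeries q z - 1‖ ≤ 4 * ‖z‖ := by
  rw [← (hasSum_eulerSeries_sub_one hq hz).tsum_eq]
  have hg := (hasSum_geometric_of_lt_one (r := (2 / 3 : ℝ)) (by norm_num) (by norm_num)).mul_left
    (4 / 3 * ‖z‖)
  refine (tsum_of_norm_bounded hg fun j => ?_).trans (le_of_eq (by ring))
  rw [norm_mul, norm_pow, pow_succ]
  calc ‖eulerCoeff q (j + 1)‖ * (‖z‖ ^ j * ‖z‖) ≤ (4 / 3) ^ (j + 1) * ((1 / 2) ^ j * ‖z‖) := by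
        gcongr
        exact norm_eulerCoeff_le' hq _
    _ = 4 / 3 * ‖z‖ * ((4 / 3) * (1 / 2)) ^ j := by rw [mul_pow]; ring
    _ = _ := by norm_num

lemma eulerSeries_mul_gen (hq : ‖q‖ ≤ 1 / 2) : eulerSeries q q * gen q = 1 := by
  have hq1 : ‖q‖ < 1 := by linarith
  have h1 := ((hasProd_gen hq1).tendsto_prod_nat).const_mul (eulerSeries q q)
  have h0 : Tendsto (fun n : ℕ => (-q ^ 2) ^ n * q) atTop (𝓝 0) := by
    have : ‖-q ^ 2‖ < 1 := by
      rw [norm_neg, norm_pow]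
      nlinarith [norm_nonneg q]
    simpa using (tendsto_pow_atTop_nhds_zero_of_norm_lt_one this).mul_const q
  have h2 : Tendsto (fun n : ℕ => eulerSeries q ((-q ^ 2) ^ n * q)) atTop (𝓝 1) := by
    rw [tendsto_iff_norm_sub_tendsto_zero]
    refine squeeze_zero' (Eventually.of_forall fun _ => norm_nonneg _)
      (g := fun n : ℕ => 4 * ‖(-q ^ 2) ^ n * q‖) ?_ ?_
    · refine Eventually.of_forall fun n => norm_eulerSeries_sub_one_le hq ?_
      rw [norm_mul, norm_pow, norm_neg, norm_pow, ← pow_mul]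
      have : ‖q‖ ^ (2 * n) ≤ 1 := pow_le_one₀ (norm_nonneg q) (by linarith)
      nlinarith [norm_nonneg q]
    · simpa using h0.norm.const_mul 4
  refine tendsto_nhds_unique h1 (h2.congr fun n => ?_)
  rw [eulerSeries_prod hq n, mul_right_comm, ← Finset.prod_mul_distrib, Finset.prod_eq_one,
    one_mul]
  intro k _
  have hne : 1 - (-q ^ 2) ^ k * q ≠ 0 := by
    intro h
    have := norm_factor_lt hq1 k
    have h5 : (-1 : ℂ) ^ k * q ^ (2 * k + 1) = (-q ^ 2) ^ k * q := by
      rw [neg_pow (q ^ 2)]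
      ring
    rw [h5, ← sub_eq_zero.mp h] at this
    simp at this
  have h5 : 1 + (-1 : ℂ) ^ (k + 1) * q ^ (2 * k + 1) = 1 - (-q ^ 2) ^ k * q := by
    rw [neg_pow (q ^ 2)]
    ring
  rw [h5, mul_inv_cancel₀ hne]

lemma eulerNum_eq (hq : ‖q‖ ≤ 1 / 2) (J : ℕ) :
    eulerNum q J = eulerDen q J * ∑ j ∈ Finset.range (J + 1), eulerCoeff q j * q ^ j := by
  induction J with
  | zero => simp [eulerNum, eulerDen, eulerCoeff_zero]
  | succ J ih =>
    have h2 := eulerDen_ne_zero hq (J + 1)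
    rw [eulerNum, ih, Finset.sum_range_succ _ (J + 1), mul_add]
    congr 1
    · rw [eulerDen]
      ring
    · rw [eulerCoeff]
      have h4 : (J + 1) ^ 2 = (J + 1) * (J + 1) - (J + 1) + (J + 1) := by
        rw [Nat.sub_add_cancel (Nat.le_mul_self _), sq]
      rw [h4, pow_add]
      field_simp

lemma norm_eulerSeries_tail_le (hq : ‖q‖ ≤ 1 / 2) (J : ℕ) :
    ‖eulerSeries q q - ∑ j ∈ Finset.range (J + 1), eulerCoeff q j * q ^ j‖
      ≤ 3 * (4 / 3) ^ (J + 1) * ‖q‖ ^ (J + 1) ^ 2 := by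
  have h := (hasSum_nat_add_iff' (f := fun j => eulerCoeff q j * q ^ j) (J + 1)).mpr
    (hasSum_eulerSeries hq hq)
  rw [← h.tsum_eq]
  have hg := (hasSum_geometric_of_lt_one (r := (2 / 3 : ℝ)) (by norm_num) (by norm_num)).mul_left
    ((4 / 3) ^ (J + 1) * ‖q‖ ^ (J + 1) ^ 2)
  refine (tsum_of_norm_bounded hg fun j => ?_).trans (le_of_eq (by norm_num; ring))
  have hn := Nat.le_mul_self (j + (J + 1))
  rw [norm_mul, norm_pow]
  calc ‖eulerCoeff q (j + (J + 1))‖ * ‖q‖ ^ (j + (J + 1))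
      ≤ (4 / 3) ^ (j + (J + 1)) * ‖q‖ ^ ((j + (J + 1)) * (j + (J + 1)) - (j + (J + 1))) *
        ‖q‖ ^ (j + (J + 1)) := by
        gcongr
        exact norm_eulerCoeff_le hq _
    _ = (4 / 3) ^ (j + (J + 1)) * ‖q‖ ^ ((j + (J + 1)) * (j + (J + 1))) := by
        rw [mul_assoc, ← pow_add, Nat.sub_add_cancel hn]
    _ ≤ (4 / 3) ^ (j + (J + 1)) * ‖q‖ ^ ((J + 1) ^ 2 + j) := by
        refine mul_le_mul_of_nonneg_left ?_ (by positivity)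
        exact pow_le_pow_of_le_one (norm_nonneg q) (by linarith) (by nlinarith)
    _ = (4 / 3) ^ (J + 1) * ‖q‖ ^ (J + 1) ^ 2 * ((4 / 3) ^ j * ‖q‖ ^ j) := by ring
    _ ≤ (4 / 3) ^ (J + 1) * ‖q‖ ^ (J + 1) ^ 2 * ((4 / 3) ^ j * (1 / 2) ^ j) := by gcongr
    _ = _ := by rw [← mul_pow]; norm_num

lemma eventually_norm_le_half : ∀ᶠ q : ℂ in 𝓝 0, ‖q‖ ≤ 1 / 2 := by
  filter_upwards [Metric.closedBall_mem_nhds (0 : ℂ) (by norm_num : (0 : ℝ) < 1 / 2)] with q hq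
  simpa using hq

lemma gen_isBigO_one : (gen : ℂ → ℂ) =O[𝓝 0] (fun _ => (1 : ℂ)) :=
  ((differentiableOn_gen.continuousOn.continuousAt
    (Metric.ball_mem_nhds 0 one_pos)).tendsto).isBigO_one ℂ

lemma gen_mul_eulerNum_isBigO (J : ℕ) :
    (fun q : ℂ => gen q * eulerNum q J - eulerDen q J) =O[𝓝 0] (fun q => q ^ (J + 1) ^ 2) := by
  have hden : (fun q : ℂ => eulerDen q J) =O[𝓝 0] (fun _ => (1 : ℂ)) := by
    have : Continuous fun q : ℂ => eulerDen q J := by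
      induction J with
      | zero => simpa [eulerDen] using continuous_const
      | succ J ih => simp only [eulerDen]; fun_prop
    exact this.continuousAt.tendsto.isBigO_one ℂ
  have htail : (fun q : ℂ => eulerSeries q q -
      ∑ j ∈ Finset.range (J + 1), eulerCoeff q j * q ^ j) =O[𝓝 0] (fun q => q ^ (J + 1) ^ 2) := by
    refine IsBigO.of_bound (3 * (4 / 3) ^ (J + 1)) ?_
    filter_upwards [eventually_norm_le_half] with q hq
    rw [norm_pow]
    exact norm_eulerSeries_tail_le hq J
  have h := ((gen_isBigO_one.mul hden).mul htail.neg_left).congr' (f₂ := fun q : ℂ =>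
    gen q * eulerNum q J - eulerDen q J) (g₂ := fun q => q ^ (J + 1) ^ 2) ?_ ?_
  · exact h
  · filter_upwards [eventually_norm_le_half] with q hq
    rw [eulerNum_eq hq]
    linear_combination (-eulerDen q J) * eulerSeries_mul_gen hq
  · exact Eventually.of_forall fun q => by ring

end Analytic

section Coefficients

open Polynomial Asymptotics

lemma X_pow_dvd_of_isBigO (P : ℂ[X]) (N : ℕ)
    (h : (fun q => P.eval q) =O[𝓝 0] (fun q : ℂ => q ^ N)) : X ^ N ∣ P := by
  induction N with
  | zero => simp
  | succ N ih =>
    have h1 : (fun q : ℂ => q ^ (N + 1)) =O[𝓝 0] (fun q : ℂ => q ^ N) := by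
      refine IsBigO.of_bound 1 ?_
      filter_upwards [eventually_norm_le_half] with q hq
      rw [norm_pow, norm_pow, one_mul]
      exact pow_le_pow_of_le_one (norm_nonneg q) (by linarith) (by omega)
    obtain ⟨R, rfl⟩ := ih (h.trans h1)
    rw [pow_succ]
    refine mul_dvd_mul_left _ ?_
    rw [X_dvd_iff, coeff_zero_eq_eval_zero]
    obtain ⟨C, hC⟩ := h.bound
    have hR : Tendsto (fun q : ℂ => R.eval q) (𝓝[≠] 0) (𝓝 (R.eval 0)) :=
      (R.continuous.tendsto 0).mono_left nhdsWithin_le_nhds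
    have hR0 : Tendsto (fun q : ℂ => R.eval q) (𝓝[≠] 0) (𝓝 0) := by
      rw [tendsto_zero_iff_norm_tendsto_zero]
      refine squeeze_zero' (Eventually.of_forall fun _ => norm_nonneg _)
        (g := fun q : ℂ => C * ‖q‖) ?_ ?_
      · filter_upwards [nhdsWithin_le_nhds hC, self_mem_nhdsWithin] with q hq hq0
        have hpos : 0 < ‖q‖ ^ N := pow_pos (norm_pos_iff.mpr hq0) N
        rw [eval_mul, eval_pow, eval_X, norm_mul, norm_pow, norm_pow, pow_succ] at hq
        refine le_of_mul_le_mul_left ?_ hpos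
        linarith
      · have : Tendsto (fun q : ℂ => C * ‖q‖) (𝓝 0) (𝓝 (C * ‖(0 : ℂ)‖)) :=
          (by fun_prop : Continuous fun q : ℂ => C * ‖q‖).tendsto 0
        simpa using this.mono_left nhdsWithin_le_nhds
    exact tendsto_nhds_unique hR hR0

lemma partial_sub_gen_isBigO {a : ℕ → ℝ}
    (ha : ∀ q : ℂ, ‖q‖ < 1 → HasSum (fun n : ℕ => (a n : ℂ) * q ^ n) (gen q)) (N : ℕ) :
    (fun q : ℂ => ∑ n ∈ Finset.range N, (a n : ℂ) * q ^ n - gen q) =O[𝓝 0] (fun q => q ^ N) := by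
  have hs := (ha (1 / 2) (by norm_num)).summable.norm
  have hs2 := ((summable_nat_add_iff N).mpr hs).mul_left (2 ^ N)
  refine IsBigO.of_bound (∑' n, 2 ^ N * ‖(a (n + N) : ℂ) * (1 / 2) ^ (n + N)‖) ?_
  filter_upwards [eventually_norm_le_half] with q hq
  have h := (hasSum_nat_add_iff' (f := fun n => (a n : ℂ) * q ^ n) N).mpr (ha q (by linarith))
  rw [norm_sub_rev, ← h.tsum_eq, ← tsum_mul_right, norm_pow]
  refine tsum_of_norm_bounded (hs2.mul_right _).hasSum fun n => ?_
  simp only [norm_mul, norm_pow, norm_div, norm_one, RCLike.norm_ofNat]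
  calc ‖(a (n + N) : ℂ)‖ * ‖q‖ ^ (n + N) = ‖(a (n + N) : ℂ)‖ * (‖q‖ ^ n * ‖q‖ ^ N) := by ring
    _ ≤ ‖(a (n + N) : ℂ)‖ * ((1 / 2) ^ n * ‖q‖ ^ N) := by gcongr
    _ = ‖(a (n + N) : ℂ)‖ * ((1 / 2) ^ n * (2 ^ N * (1 / 2) ^ N) * ‖q‖ ^ N) := by
        rw [← mul_pow]; norm_num
    _ = _ := by ring

/-- The Taylor coefficients are integers, and the truncated Taylor polynomial satisfies Euler's
identity to order `N`. -/
theorem exists_int_coeff {a : ℕ → ℝ}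
    (ha : ∀ q : ℂ, ‖q‖ < 1 → HasSum (fun n : ℕ => (a n : ℂ) * q ^ n) (gen q)) {N J : ℕ}
    (hN : N ≤ (J + 1) ^ 2) : ∃ b : ℕ → ℤ, (∀ n < N, a n = b n) ∧
      (X : ℤ[X]) ^ N ∣ (∑ n ∈ Finset.range N, C (b n) * X ^ n) * eulerNum X J - eulerDen X J := by
  set A : ℂ[X] := ∑ n ∈ Finset.range N, C (a n : ℂ) * X ^ n with hA
  have hAe : ∀ q : ℂ, A.eval q = ∑ n ∈ Finset.range N, (a n : ℂ) * q ^ n := by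
    intro q
    simp [hA, eval_finsetSum]
  have hNe : ∀ q : ℂ, (eulerNum (X : ℂ[X]) J).eval q = eulerNum q J := by
    intro q
    simpa using map_eulerNum (evalRingHom q) (X : ℂ[X]) J
  have hDe : ∀ q : ℂ, (eulerDen (X : ℂ[X]) J).eval q = eulerDen q J := by
    intro q
    simpa using map_eulerDen (evalRingHom q) (X : ℂ[X]) J
  have h1 : (X : ℂ[X]) ^ N ∣ A * eulerNum X J - eulerDen X J := by
    refine X_pow_dvd_of_isBigO _ _ ?_
    have hnum : (fun q : ℂ => (eulerNum (X : ℂ[X]) J).eval q) =O[𝓝 0] (fun _ => (1 : ℂ)) :=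
      ((eulerNum (X : ℂ[X]) J).continuous.tendsto 0).isBigO_one ℂ
    have hpow : (fun q : ℂ => q ^ (J + 1) ^ 2) =O[𝓝 0] (fun q => q ^ N) := by
      refine IsBigO.of_bound 1 ?_
      filter_upwards [eventually_norm_le_half] with q hq
      rw [norm_pow, norm_pow, one_mul]
      exact pow_le_pow_of_le_one (norm_nonneg q) (by linarith) hN
    have h2 := (partial_sub_gen_isBigO ha N).mul hnum
    simp only [mul_one] at h2
    refine (h2.add ((gen_mul_eulerNum_isBigO J).trans hpow)).congr_left fun q => ?_
    rw [eval_sub, eval_mul, hAe, hNe, hDe]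
    ring
  set num : PowerSeries ℤ := ((eulerNum (X : ℤ[X]) J : ℤ[X]) : PowerSeries ℤ) with hnum
  set den : PowerSeries ℤ := ((eulerDen (X : ℤ[X]) J : ℤ[X]) : PowerSeries ℤ) with hden
  set B : PowerSeries ℤ := PowerSeries.invOfUnit num 1 * den with hB
  have hn0 : (eulerNum (X : ℤ[X]) J).coeff 0 = 1 := by
    rw [coeff_zero_eq_eval_zero]
    have := map_eulerNum (evalRingHom (0 : ℤ)) (X : ℤ[X]) J
    simpa [eulerNum_zero] using this
  have hBmul : B * num = den := by
    have h3 := PowerSeries.mul_invOfUnit num 1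
      (by rw [hnum, ← PowerSeries.coeff_zero_eq_constantCoeff_apply, coeff_coe, hn0]; simp)
    rw [hB, mul_right_comm, mul_comm (PowerSeries.invOfUnit _ _), h3, one_mul]
  set P : ℤ[X] := ∑ n ∈ Finset.range N, C (PowerSeries.coeff n B) * X ^ n with hP
  have hPc : ∀ d < N, P.coeff d = PowerSeries.coeff d B := by
    intro d hd
    simp [hP, finsetSum_coeff, hd]
  have hPdvd : (X : ℤ[X]) ^ N ∣ P * eulerNum X J - eulerDen X J := by
    rw [X_pow_dvd_iff]
    intro d hd
    have h4 := congrArg (PowerSeries.coeff d) hBmul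
    rw [PowerSeries.coeff_mul, coeff_coe] at h4
    rw [coeff_sub, coeff_mul, ← h4, sub_eq_zero]
    refine Finset.sum_congr rfl fun x hx => ?_
    have := Finset.HasAntidiagonal.mem_antidiagonal.mp hx
    rw [hPc _ (by omega), coeff_coe]
  refine ⟨fun n => PowerSeries.coeff n B, fun n hn => ?_, hPdvd⟩
  have h5 : (X : ℂ[X]) ^ N ∣ P.map (Int.castRingHom ℂ) * eulerNum X J - eulerDen X J := by
    have := map_dvd (mapRingHom (Int.castRingHom ℂ)) hPdvd
    rw [map_sub, map_mul, map_eulerNum, map_eulerDen] at this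
    simpa using this
  have h6 : (X : ℂ[X]) ^ N ∣ (A - P.map (Int.castRingHom ℂ)) * eulerNum X J := by
    have := dvd_sub h1 h5
    convert this using 1
    ring
  have hcop : IsCoprime ((X : ℂ[X]) ^ N) (eulerNum X J) := by
    refine IsCoprime.pow_left ?_
    rw [(prime_X : Prime (X : ℂ[X])).irreducible.coprime_iff_not_dvd, X_dvd_iff,
      coeff_zero_eq_eval_zero, hNe, eulerNum_zero]
    exact one_ne_zero
  have h7 := X_pow_dvd_iff.mp (hcop.dvd_of_dvd_mul_right h6) n hn
  rw [coeff_sub, coeff_map, hPc n hn, sub_eq_zero, hA] at h7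
  simp only [finsetSum_coeff, coeff_C_mul_X_pow, Finset.sum_ite_eq, Finset.mem_range, hn,
    if_true, eq_intCast] at h7
  exact_mod_cast h7

end Coefficients

section Digits

open Polynomial

/-- The number whose base-`2^B` digits, `N` of them, are all `2^(B-1)`. -/
def topBits (B : ℕ) : ℕ → ℕ
  | 0 => 0
  | N + 1 => 2 ^ (B - 1) + 2 ^ B * topBits B N

lemma topBits_eq {B : ℕ} (hB : 0 < B) (N : ℕ) :
    topBits B N = 2 ^ (B - 1) * ((2 ^ (B * N) - 1) / (2 ^ B - 1)) := by
  have h2 : 2 ≤ 2 ^ B := by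
    calc 2 = 2 ^ 1 := by norm_num
      _ ≤ 2 ^ B := Nat.pow_le_pow_right (by norm_num) hB
  rw [pow_mul, ← Nat.geomSum_eq h2]
  induction N with
  | zero => simp [topBits]
  | succ N ih =>
    rw [topBits, ih, Finset.sum_range_succ', Finset.mul_sum, mul_add, Finset.mul_sum,
      Finset.mul_sum, pow_zero, mul_one, add_comm]
    congr 1
    refine Finset.sum_congr rfl fun i _ => ?_
    ring

lemma mod_lt_of_land_topBits {B : ℕ} (hB : 0 < B) {N V : ℕ} (h : V &&& topBits B (N + 1) = 0) :
    V % 2 ^ B < 2 ^ (B - 1) ∧ V / 2 ^ B &&& topBits B N = 0 := by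
  obtain ⟨b, rfl⟩ : ∃ b, B = b + 1 := ⟨B - 1, by omega⟩
  have hpos : 0 < 2 ^ b := by positivity
  rw [topBits, Nat.add_sub_cancel] at h
  constructor
  · have h1 := congrArg (fun x => x.testBit b) h
    simp only [Nat.testBit_and, Nat.zero_testBit] at h1
    rw [Nat.testBit_eq_decide_div_mod_eq, Nat.testBit_eq_decide_div_mod_eq] at h1
    have h2 : (2 ^ b + 2 ^ (b + 1) * topBits (b + 1) N) / 2 ^ b % 2 = 1 := by
      have : 2 ^ b + 2 ^ (b + 1) * topBits (b + 1) N = 2 ^ b * (1 + 2 * topBits (b + 1) N) := by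
        ring
      rw [this, Nat.mul_div_cancel_left _ hpos]
      omega
    rw [h2] at h1
    simp only [decide_true, Bool.and_true, decide_eq_false_iff_not] at h1
    rw [pow_succ, Nat.mod_mul, show V / 2 ^ b % 2 = 0 by omega]
    simpa using Nat.mod_lt V hpos
  · have h1 := congrArg (fun x => x >>> (b + 1)) h
    simp only [Nat.shiftRight_and_distrib, Nat.zero_shiftRight] at h1
    rw [Nat.shiftRight_eq_div_pow, Nat.shiftRight_eq_div_pow, Nat.add_mul_div_left _ _ (by positivity),
      Nat.div_eq_of_lt (Nat.pow_lt_pow_right (by norm_num) (Nat.lt_succ_self b)), zero_add] at h1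
    exact h1

lemma digits_nonneg {B : ℕ} (hB : 0 < B) {N : ℕ} : ∀ {b : ℕ → ℤ} {V : ℕ},
    (∀ n < N, |b n| < 2 ^ (B - 1)) →
    (2 : ℤ) ^ (B * N) ∣ ∑ n ∈ Finset.range N, b n * (2 ^ B) ^ n - V →
    V &&& topBits B N = 0 → ∀ n < N, 0 ≤ b n := by
  induction N with
  | zero => intro b V _ _ _ n hn; omega
  | succ N ih =>
    intro b V hb hdvd hV n hn
    obtain ⟨hV1, hV2⟩ := mod_lt_of_land_topBits hB hV
    have hpow : (2 : ℤ) ^ B = 2 * 2 ^ (B - 1) := by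
      rw [← pow_succ', Nat.sub_add_cancel hB]
    have hVd : (V : ℤ) = (V % 2 ^ B : ℕ) + 2 ^ B * (V / 2 ^ B : ℕ) := by
      exact_mod_cast (Nat.mod_add_div V (2 ^ B)).symm
    have hsum : ∑ n ∈ Finset.range (N + 1), b n * ((2 : ℤ) ^ B) ^ n - V =
        (b 0 - (V % 2 ^ B : ℕ)) +
          2 ^ B * (∑ n ∈ Finset.range N, b (n + 1) * (2 ^ B) ^ n - (V / 2 ^ B : ℕ)) := by
      rw [Finset.sum_range_succ', mul_sub, Finset.mul_sum, pow_zero, mul_one]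
      have : ∀ i, b (i + 1) * ((2 : ℤ) ^ B) ^ (i + 1) = 2 ^ B * (b (i + 1) * (2 ^ B) ^ i) := by
        intro i; ring
      simp_rw [this]
      linear_combination (-1 : ℤ) * hVd
    have h0 : b 0 = (V % 2 ^ B : ℕ) := by
      have h1 : (2 : ℤ) ^ B ∣ b 0 - (V % 2 ^ B : ℕ) := by
        have h2 : (2 : ℤ) ^ B ∣ ∑ n ∈ Finset.range (N + 1), b n * ((2 : ℤ) ^ B) ^ n - V :=
          (pow_dvd_pow 2 (by nlinarith)).trans hdvd
        rw [hsum] at h2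
        exact (dvd_add_left (dvd_mul_right _ _)).mp h2
      have h3 := abs_lt.mp (hb 0 (by omega))
      have h4 : ((V % 2 ^ B : ℕ) : ℤ) < 2 ^ (B - 1) := by exact_mod_cast hV1
      have h5 : (0 : ℤ) ≤ (V % 2 ^ B : ℕ) := by positivity
      refine sub_eq_zero.mp (Int.eq_zero_of_abs_lt_dvd h1 ?_)
      rw [abs_lt]
      constructor <;> linarith
    rcases n with _ | n
    · rw [h0]; positivity
    · refine ih (b := fun n => b (n + 1)) (V := V / 2 ^ B) (fun n hn => hb (n + 1) (by omega))
        ?_ hV2 n (by omega)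
      rw [hsum, h0, sub_self, zero_add, mul_add, mul_one, add_comm, pow_add] at hdvd
      exact (mul_dvd_mul_iff_left (by positivity)).mp hdvd

end Digits

section Check

open Polynomial

/-- Evaluates `n` before passing it on; this controls sharing when the kernel computes. -/
def force {α : Type} (n : ℕ) (f : ℕ → α) : α :=
  match n with
  | 0 => f 0
  | k + 1 => f (k + 1)

lemma force_eq {α : Type} (n : ℕ) (f : ℕ → α) : force n f = f n := by
  cases n <;> rfl

/-- Multiplication by `1 - (-x²)^j` for `x = 2^B`. -/
def twist (B j : ℕ) (z : ℤ) : ℤ :=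
  if j % 2 = 0 then z - z <<< (2 * B * j) else z + z <<< (2 * B * j)

/-- The signed power `± x^(j²)` for `x = 2^B`. -/
def signedPow (B j : ℕ) : ℤ :=
  if j % 4 = 0 ∨ j % 4 = 3 then (1 : ℤ) <<< (B * j ^ 2) else (-1 : ℤ) <<< (B * j ^ 2)

/-- `eulerNum` and `eulerDen` at `2^B`. -/
def eulerPair (B : ℕ) : ℕ → ℤ × ℤ
  | 0 => (1, 1)
  | J + 1 => (fun r => (twist B (J + 1) r.1 + signedPow B (J + 1), twist B (J + 1) r.2))
      (eulerPair B J)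

/-- The residue modulo `2^M`. -/
def low (M : ℕ) : ℤ → ℕ
  | .ofNat n => n &&& (2 ^ M - 1)
  | .negSucc n => (2 ^ M - 1) - (n &&& (2 ^ M - 1))

/-- Newton iteration for the inverse of `P` modulo `2^(B * 2^k)`. -/
def newton (B P : ℕ) : ℕ → ℕ
  | 0 => 1
  | k + 1 => force (newton B P k) fun x => force (2 ^ (B * 2 ^ (k + 1))) fun m =>
      (x * (2 + m - ((P &&& (m - 1)) * x &&& (m - 1)))) &&& (m - 1)

/-- Computes the first `N` coefficients in base `2^B` and tests that every digit has top bit `0`. -/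
def check (B N J k : ℕ) : Bool :=
  (fun r : ℤ × ℤ => force (low (B * N) r.1) fun P => force (low (B * N) r.2) fun D =>
    force (newton B P k * D &&& (2 ^ (B * N) - 1)) fun V =>
      Nat.beq (V * P &&& (2 ^ (B * N) - 1)) D &&
      Nat.beq (V &&& (2 ^ (B - 1) * ((2 ^ (B * N) - 1) / (2 ^ B - 1)))) 0) (eulerPair B J)

lemma twist_eq (B j : ℕ) (z : ℤ) : twist B j z = z * (1 - (-((2 : ℤ) ^ B) ^ 2) ^ j) := by
  have h : (((2 : ℤ) ^ B) ^ 2) ^ j = 2 ^ (2 * B * j) := by ring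
  rw [twist, neg_pow, h, Int.shiftLeft_eq]
  split_ifs with hj
  · rw [Even.neg_one_pow (Nat.even_iff.mpr hj)]
    ring
  · rw [Odd.neg_one_pow (Nat.odd_iff.mpr (by omega))]
    ring

lemma signedPow_eq (B j : ℕ) : signedPow B j = eulerSign ℤ j * ((2 : ℤ) ^ B) ^ j ^ 2 := by
  rw [signedPow, eulerSign, ← pow_mul]
  split_ifs <;> rw [Int.shiftLeft_eq]

lemma eulerPair_eq (B J : ℕ) :
    eulerPair B J = (eulerNum ((2 : ℤ) ^ B) J, eulerDen ((2 : ℤ) ^ B) J) := by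
  induction J with
  | zero => rfl
  | succ J ih => simp only [eulerPair, ih, eulerNum, eulerDen, twist_eq, signedPow_eq]

lemma low_dvd (M : ℕ) (z : ℤ) : (2 : ℤ) ^ M ∣ z - low M z := by
  have hpos : 0 < 2 ^ M := by positivity
  rcases z with n | n
  · rw [low, Nat.and_two_pow_sub_one_eq_mod, Int.ofNat_eq_natCast]
    refine ⟨(n / 2 ^ M : ℕ), ?_⟩
    have : (n : ℤ) = (n % 2 ^ M : ℕ) + 2 ^ M * (n / 2 ^ M : ℕ) := by
      exact_mod_cast (Nat.mod_add_div n (2 ^ M)).symm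
    linear_combination this
  · rw [low, Nat.and_two_pow_sub_one_eq_mod, Int.negSucc_eq]
    refine ⟨-(n / 2 ^ M : ℕ) - 1, ?_⟩
    have h1 : (n : ℤ) = (n % 2 ^ M : ℕ) + 2 ^ M * (n / 2 ^ M : ℕ) := by
      exact_mod_cast (Nat.mod_add_div n (2 ^ M)).symm
    have h2 := Nat.mod_lt n hpos
    have h3 : ((2 ^ M - 1 - n % 2 ^ M : ℕ) : ℤ) = 2 ^ M - 1 - (n % 2 ^ M : ℕ) := by
      rw [Nat.cast_sub (by omega), Nat.cast_sub (by omega)]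
      push_cast
      ring
    rw [h3]
    linear_combination -h1

lemma natLow_dvd (M n : ℕ) : (2 : ℤ) ^ M ∣ n - (n &&& (2 ^ M - 1) : ℕ) :=
  low_dvd M (Int.ofNat n)

lemma exists_of_check {B N J k : ℕ} (hB : 0 < B) (h : check B N J k = true) :
    ∃ V : ℕ, (2 : ℤ) ^ (B * N) ∣ V * eulerNum ((2 : ℤ) ^ B) J - eulerDen ((2 : ℤ) ^ B) J ∧
      V &&& topBits B N = 0 := by
  simp only [check, eulerPair_eq, force_eq, Bool.and_eq_true, Nat.beq_eq] at h
  rw [← topBits_eq hB] at h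
  set P := low (B * N) (eulerNum ((2 : ℤ) ^ B) J) with hP
  set D := low (B * N) (eulerDen ((2 : ℤ) ^ B) J) with hD
  set V := newton B P k * D &&& (2 ^ (B * N) - 1)
  refine ⟨V, ?_, h.2⟩
  have h1 := low_dvd (B * N) (eulerNum ((2 : ℤ) ^ B) J)
  have h2 := low_dvd (B * N) (eulerDen ((2 : ℤ) ^ B) J)
  have h3 := natLow_dvd (B * N) (V * P)
  rw [h.1] at h3
  rw [← hP] at h1
  rw [← hD] at h2
  obtain ⟨c, hc⟩ := dvd_sub (dvd_add (h1.mul_left (V : ℤ)) h3) h2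
  push_cast at hc
  exact ⟨c, by linear_combination hc⟩

/-- If the computation succeeds, the first `N` Taylor coefficients are nonnegative. -/
theorem coeff_nonneg_of_check {a : ℕ → ℝ}
    (ha : ∀ q : ℂ, ‖q‖ < 1 → HasSum (fun n : ℕ => (a n : ℂ) * q ^ n) (gen q)) {B N J k : ℕ}
    (hB : 0 < B) (hN : N ≤ (J + 1) ^ 2) (hbound : ∀ n < N, |a n| < 2 ^ (B - 1))
    (h : check B N J k = true) : ∀ n < N, 0 ≤ a n := by
  obtain ⟨b, hab, hdvd⟩ := exists_int_coeff ha hN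
  obtain ⟨V, hV, hV0⟩ := exists_of_check hB h
  have h1 : (2 : ℤ) ^ (B * N) ∣ (∑ n ∈ Finset.range N, b n * (2 ^ B) ^ n) *
      eulerNum ((2 : ℤ) ^ B) J - eulerDen ((2 : ℤ) ^ B) J := by
    have := map_dvd (evalRingHom ((2 : ℤ) ^ B)) hdvd
    rw [map_sub, map_mul, map_eulerNum, map_eulerDen, map_pow] at this
    simpa [eval_finsetSum, ← pow_mul] using this
  have hcop : IsCoprime ((2 : ℤ) ^ (B * N)) (eulerNum ((2 : ℤ) ^ B) J) := by
    refine IsCoprime.pow_left ?_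
    rw [Int.prime_two.irreducible.coprime_iff_not_dvd]
    intro h2
    have h3 := (ZMod.intCast_zmod_eq_zero_iff_dvd (eulerNum ((2 : ℤ) ^ B) J) 2).mpr
      (by exact_mod_cast h2)
    have h4 := map_eulerNum (Int.castRingHom (ZMod 2)) ((2 : ℤ) ^ B) J
    have h5 : (Int.castRingHom (ZMod 2)) ((2 : ℤ) ^ B) = 0 := by
      rw [map_pow, map_ofNat, show (OfNat.ofNat 2 : ZMod 2) = 0 from rfl, zero_pow hB.ne']
    rw [h5, eulerNum_zero, eq_intCast, h3] at h4
    exact zero_ne_one h4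
  have h6 : (2 : ℤ) ^ (B * N) ∣ (∑ n ∈ Finset.range N, b n * (2 ^ B) ^ n - V) *
      eulerNum ((2 : ℤ) ^ B) J := by
    obtain ⟨c, hc⟩ := dvd_sub h1 hV
    exact ⟨c, by linear_combination hc⟩
  have hb : ∀ n < N, |b n| < 2 ^ (B - 1) := by
    intro n hn
    have := hbound n hn
    rw [hab n hn] at this
    exact_mod_cast this
  intro n hn
  rw [hab n hn]
  exact_mod_cast digits_nonneg hB hb (hcop.dvd_of_dvd_mul_right h6) hV0 n hn

end Check

theorem check_true : check 473 32400 179 15 = true := by decide +kernel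

section TermBounds

lemma logTerm_zero (q : ℂ) : logTerm q 0 = 0 := by simp [logTerm]

/-- The logarithm of the generating function. -/
noncomputable def logGen (q : ℂ) : ℂ := ∑' m, logTerm q m

lemma norm_gen (q : ℂ) : ‖gen q‖ = exp (logGen q).re := by
  rw [gen, Complex.norm_exp, logGen]

lemma logTerm_I_mul_exp {w : ℂ} (m : ℕ) :
    logTerm (Complex.I * Complex.exp (-w)) m = Complex.I ^ m / (2 * m * Complex.sinh (m * w)) := by
  have h1 : (Complex.I * Complex.exp (-w)) ^ m = Complex.I ^ m * Complex.exp (-(m * w)) := by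
    rw [mul_pow, ← Complex.exp_nat_mul, mul_neg]
  have h2 : (-1 : ℂ) ^ m * (Complex.I * Complex.exp (-w)) ^ (2 * m) =
      Complex.exp (-(m * w)) * Complex.exp (-(m * w)) := by
    rw [pow_mul', h1, ← Complex.I_sq, ← pow_mul, mul_pow, ← pow_mul, mul_comm 2 m, ← mul_assoc,
      ← mul_pow, ← Complex.exp_add, ← Complex.exp_nat_mul]
    have : (Complex.I * Complex.I) ^ (m * 2) = 1 := by
      rw [Complex.I_mul_I, pow_mul']
      norm_num
    rw [this, one_mul]
    congr 1
    push_cast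
    ring
  have h3 : 2 * Complex.sinh (m * w) * Complex.exp (-(m * w)) =
      1 - Complex.exp (-(m * w)) * Complex.exp (-(m * w)) := by
    rw [Complex.two_sinh, sub_mul, ← Complex.exp_add, add_neg_cancel, Complex.exp_zero]
  rw [logTerm, h2, h1, ← h3]
  have h4 := Complex.exp_ne_zero (-(m * w))
  rw [show (m : ℂ) * (2 * Complex.sinh (m * w) * Complex.exp (-(m * w))) =
    (2 * m * Complex.sinh (m * w)) * Complex.exp (-(m * w)) by ring, mul_div_mul_right _ _ h4]

lemma norm_sinh_sq (x y : ℝ) :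
    ‖Complex.sinh (x + y * Complex.I)‖ ^ 2 = sinh x ^ 2 + sin y ^ 2 := by
  rw [Complex.sinh_add, Complex.cosh_mul_I, Complex.sinh_mul_I, ← Complex.ofReal_sinh,
    ← Complex.ofReal_cosh, ← Complex.ofReal_cos, ← Complex.ofReal_sin, ← mul_assoc,
    ← Complex.ofReal_mul, ← Complex.ofReal_mul, ← Complex.normSq_eq_norm_sq,
    Complex.normSq_add_mul_I]
  have h1 := sin_sq_add_cos_sq y
  have h2 := cosh_sq x
  linear_combination sinh x ^ 2 * h1 + sin y ^ 2 * h2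

lemma norm_cosh_sq (x y : ℝ) :
    ‖Complex.cosh (x + y * Complex.I)‖ ^ 2 = cosh x ^ 2 - sin y ^ 2 := by
  rw [Complex.cosh_add, Complex.cosh_mul_I, Complex.sinh_mul_I, ← Complex.ofReal_sinh,
    ← Complex.ofReal_cosh, ← Complex.ofReal_cos, ← Complex.ofReal_sin, ← mul_assoc,
    ← Complex.ofReal_mul, ← Complex.ofReal_mul, ← Complex.normSq_eq_norm_sq,
    Complex.normSq_add_mul_I]
  have h1 := sin_sq_add_cos_sq y
  have h2 := cosh_sq x
  linear_combination cosh x ^ 2 * h1 - sin y ^ 2 * h2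

lemma norm_sinh_ge_sinh {x : ℝ} (hx : 0 ≤ x) (y : ℝ) :
    sinh x ≤ ‖Complex.sinh (x + y * Complex.I)‖ := by
  refine (pow_le_pow_iff_left₀ (sinh_nonneg_iff.mpr hx) (norm_nonneg _) two_ne_zero).mp ?_
  rw [norm_sinh_sq]
  nlinarith [sq_nonneg (sin y)]

lemma abs_sin_le_norm_sinh (x y : ℝ) : |sin y| ≤ ‖Complex.sinh (x + y * Complex.I)‖ := by
  refine (pow_le_pow_iff_left₀ (abs_nonneg _) (norm_nonneg _) two_ne_zero).mp ?_
  rw [norm_sinh_sq, sq_abs]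
  nlinarith [sq_nonneg (sinh x)]

variable {t θ : ℝ}

lemma exp_eq_I_mul_exp (t θ : ℝ) : Complex.exp (-t + θ * Complex.I) =
    Complex.I * Complex.exp (-(t + (π / 2 - θ : ℝ) * Complex.I)) := by
  trans Complex.exp (π / 2 * Complex.I) * Complex.exp (-(t + (π / 2 - θ : ℝ) * Complex.I))
  · rw [← Complex.exp_add]
    congr 1
    push_cast
    ring
  · rw [Complex.exp_pi_div_two_mul_I]

lemma norm_logTerm (t θ : ℝ) (m : ℕ) : ‖logTerm (Complex.exp (-t + θ * Complex.I)) m‖ =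
    1 / (2 * m * ‖Complex.sinh ((m * t : ℝ) + (m * (π / 2 - θ) : ℝ) * Complex.I)‖) := by
  rw [exp_eq_I_mul_exp, logTerm_I_mul_exp, norm_div, norm_mul, norm_pow, Complex.norm_I, one_pow,
    norm_mul, Complex.norm_natCast, Complex.norm_ofNat]
  congr 4
  push_cast
  ring

lemma norm_logTerm_le (ht : 0 < t) (θ : ℝ) (m : ℕ) :
    ‖logTerm (Complex.exp (-t + θ * Complex.I)) m‖ ≤ 1 / (2 * t) * (1 / (m : ℝ) ^ 2) := by
  rcases Nat.eq_zero_or_pos m with rfl | hm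
  · simp [logTerm_zero]
  have hm' : (0 : ℝ) < m := by exact_mod_cast hm
  rw [norm_logTerm, one_div_mul_one_div]
  have h1 := norm_sinh_ge_sinh (x := m * t) (by positivity) (m * (π / 2 - θ))
  have h2 : m * t ≤ sinh (m * t) := self_le_sinh_iff.mpr (by positivity)
  refine one_div_le_one_div_of_le (by positivity) ?_
  calc 2 * t * (m : ℝ) ^ 2 = 2 * m * (m * t) := by ring
    _ ≤ _ := by gcongr; exact h2.trans h1

lemma norm_logTerm_le_of_sin {m : ℕ} (hm : 0 < m) {d : ℝ} (hd : 0 < d)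
    (h : d ≤ |sin (m * (π / 2 - θ))|) :
    ‖logTerm (Complex.exp (-t + θ * Complex.I)) m‖ ≤ 1 / (2 * m * d) := by
  have hm' : (0 : ℝ) < m := by exact_mod_cast hm
  rw [norm_logTerm]
  have h1 := abs_sin_le_norm_sinh (m * t) (m * (π / 2 - θ))
  refine one_div_le_one_div_of_le (by positivity) ?_
  gcongr
  exact h.trans h1

lemma hasSum_one_div_sq_sub (S : Finset ℕ) :
    HasSum (fun m : {m // m ∉ S} => 1 / ((m : ℕ) : ℝ) ^ 2) (π ^ 2 / 6 - ∑ m ∈ S, 1 / (m : ℝ) ^ 2) := by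
  refine (S.hasSum_compl_iff (f := fun m : ℕ => 1 / (m : ℝ) ^ 2)).mpr ?_
  rw [sub_add_cancel]
  exact hasSum_zeta_two

/-- All terms outside a finite set are bounded by their size at `θ = 0`. -/
lemma norm_logGen_sub_le (ht : 0 < t) (θ : ℝ) (S : Finset ℕ) :
    ‖logGen (Complex.exp (-t + θ * Complex.I)) -
      ∑ m ∈ S, logTerm (Complex.exp (-t + θ * Complex.I)) m‖ ≤
      1 / (2 * t) * (π ^ 2 / 6 - ∑ m ∈ S, 1 / (m : ℝ) ^ 2) := by
  set q := Complex.exp (-t + θ * Complex.I) with hq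
  have h1 : HasSum (fun m : {m // m ∉ S} => logTerm q m) (logGen q - ∑ m ∈ S, logTerm q m) := by
    refine S.hasSum_compl_iff.mpr ?_
    rw [sub_add_cancel]
    exact (summable_logTerm (norm_exp_lt_one ht θ)).hasSum
  rw [← h1.tsum_eq]
  exact tsum_of_norm_bounded ((hasSum_one_div_sq_sub S).mul_left _)
    fun m => norm_logTerm_le ht θ m

lemma re_logGen_le (ht : 0 < t) (θ : ℝ) (S : Finset ℕ) {K : ℝ}
    (hK : (∑ m ∈ S, logTerm (Complex.exp (-t + θ * Complex.I)) m).re ≤ K) :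
    (logGen (Complex.exp (-t + θ * Complex.I))).re ≤
      K + 1 / (2 * t) * (π ^ 2 / 6 - ∑ m ∈ S, 1 / (m : ℝ) ^ 2) := by
  have h1 := (Complex.re_le_norm _).trans (norm_logGen_sub_le ht θ S)
  rw [Complex.sub_re] at h1
  linarith

lemma re_logGen_le_of_sin (ht : 0 < t) (θ : ℝ) (S : Finset ℕ) (d : ℕ → ℝ)
    (hd : ∀ m ∈ S, 0 < m → 0 < d m ∧ d m ≤ |sin (m * (π / 2 - θ))|) :
    (logGen (Complex.exp (-t + θ * Complex.I))).re ≤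
      ∑ m ∈ S, 1 / (2 * m * d m) + 1 / (2 * t) * (π ^ 2 / 6 - ∑ m ∈ S, 1 / (m : ℝ) ^ 2) := by
  refine re_logGen_le ht θ S ?_
  refine (Complex.re_le_norm _).trans (norm_sum_le_of_le S fun m hm => ?_)
  rcases Nat.eq_zero_or_pos m with rfl | hm0
  · simp [logTerm_zero]
  · exact norm_logTerm_le_of_sin hm0 (hd m hm hm0).1 (hd m hm hm0).2

end TermBounds

lemma norm_gen_le {t : ℝ} (ht : 0 < t) (θ : ℝ) :
    ‖gen (Complex.exp (-t + θ * Complex.I))‖ ≤ exp (π ^ 2 / (12 * t)) := by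
  rw [norm_gen, exp_le_exp]
  have := re_logGen_le ht θ ∅ (K := 0) (by simp)
  refine this.trans (le_of_eq ?_)
  simp
  field_simp
  norm_num

lemma abs_integrand_le (t : ℝ) (n : ℕ) (θ : ℝ) :
    |integrand t n θ| ≤ ‖gen (Complex.exp (-t + θ * Complex.I))‖ := by
  refine (Complex.abs_re_le_norm _).trans (le_of_eq ?_)
  rw [norm_mul, Complex.norm_exp]
  simp

lemma abs_coeff_le {a : ℕ → ℝ}
    (ha : ∀ q : ℂ, ‖q‖ < 1 → HasSum (fun n : ℕ => (a n : ℂ) * q ^ n) (gen q))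
    {t : ℝ} (ht : 0 < t) (n : ℕ) : |a n| ≤ exp (n * t + π ^ 2 / (12 * t)) := by
  have h1 := intervalIntegral.norm_integral_le_of_norm_le_const (a := 0) (b := π)
    (f := integrand t n) (C := exp (π ^ 2 / (12 * t)))
    fun θ _ => (abs_integrand_le t n θ).trans (norm_gen_le ht θ)
  rw [integral_integrand ha ht, sub_zero, abs_of_pos pi_pos, norm_mul, norm_mul,
    norm_of_nonneg pi_pos.le, mul_comm _ π] at h1
  have h2 := le_of_mul_le_mul_left h1 pi_pos
  rw [← exp_nat_mul, norm_eq_abs, norm_eq_abs, abs_of_pos (exp_pos _)] at h2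
  rw [exp_add, mul_comm]
  calc |a n| = |a n| * exp (n * -t) * exp (n * t) := by
        rw [mul_assoc, ← exp_add]
        simp
    _ ≤ _ := by gcongr

theorem coeff_nonneg_of_lt {a : ℕ → ℝ}
    (ha : ∀ q : ℂ, ‖q‖ < 1 → HasSum (fun n : ℕ => (a n : ℂ) * q ^ n) (gen q)) :
    ∀ n < 32400, 0 ≤ a n := by
  refine coeff_nonneg_of_check ha (B := 473) (J := 179) (k := 15) (by norm_num) (by norm_num)
    (fun n hn => ?_) check_true
  refine (abs_coeff_le ha (t := 63 / 12500) (by norm_num) n).trans_lt ?_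
  have h1 : (n : ℝ) ≤ 32400 := by exact_mod_cast hn.le
  have h2 : (2 : ℝ) ^ (473 - 1) = exp (472 * log 2) := by
    rw [show (472 : ℝ) = (472 : ℕ) by norm_num, exp_nat_mul, exp_log (by norm_num)]
  rw [h2, exp_lt_exp]
  have h3 := log_two_gt_d9
  have h4 := pi_lt_d6
  have h5 : π ^ 2 < 9.86961 := by nlinarith [pi_pos]
  rw [show (12 : ℝ) * (63 / 12500) = 189 / 3125 by norm_num, div_div_eq_mul_div]
  linarith

section Rest

variable {t θ : ℝ}

lemma abs_sin_mul_abs (m φ : ℝ) : |sin (m * |φ|)| = |sin (m * φ)| := by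
  rcases abs_choice φ with h | h <;> simp [h]

/-- A lower bound for the sine on a symmetric interval about `π / 2`. -/
lemma le_sin_of_mem {a x : ℝ} (ha : 0 < a) (h1 : a ≤ x) (h2 : x ≤ π - a) :
    a - a ^ 3 / 6 ≤ sin x := by
  refine (sin_gt_sub_cube ha).le.trans ?_
  have h3 := pi_gt_three
  rcases le_total x (π / 2) with h | h
  · exact sin_le_sin_of_le_of_le_pi_div_two (by linarith) h h1
  · rw [← sin_pi_sub x]
    exact sin_le_sin_of_le_of_le_pi_div_two (by linarith) (by linarith) (by linarith)

lemma mul_le_sin_of_le {a x : ℝ} (hx : 0 < x) (hxa : x ≤ a) :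
    (1 - a ^ 2 / 6) * x ≤ sin x := by
  refine le_trans ?_ (sin_gt_sub_cube hx).le
  nlinarith [mul_le_mul hxa hxa hx.le (hx.le.trans hxa), hx]

lemma re_logGen_le_of_mul_le_sin (ht : 0 < t) (N : ℕ) {b l : ℝ} (hb : 0 < b) (hl : 0 < l)
    (h1 : l ≤ |π / 2 - θ|) (h : ∀ m ∈ Finset.range (N + 1), 0 < m →
      b * (m * |π / 2 - θ|) ≤ sin (m * |π / 2 - θ|)) :
    (logGen (Complex.exp (-t + θ * Complex.I))).re ≤
      1 / (2 * b * l) * ∑ m ∈ Finset.range (N + 1), 1 / (m : ℝ) ^ 2 +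
      1 / (2 * t) * (π ^ 2 / 6 - ∑ m ∈ Finset.range (N + 1), 1 / (m : ℝ) ^ 2) := by
  have h2 := re_logGen_le_of_sin ht θ (Finset.range (N + 1)) (fun m => b * (m * l))
    fun m hm hm0 => ⟨by positivity, ?_⟩
  · refine h2.trans (le_of_eq ?_)
    rw [Finset.mul_sum]
    congr 1
    refine Finset.sum_congr rfl fun m _ => ?_
    rw [one_div_mul_one_div]
    congr 1
    ring
  · rw [← abs_sin_mul_abs]
    refine le_trans ?_ ((h m hm hm0).trans (le_abs_self _))
    gcongr

lemma re_logGen_le_of_le_one (ht : 0 < t) (N : ℕ) {a l : ℝ} (ha : a ≤ 1) (hl : 0 < l)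
    (h1 : l ≤ |π / 2 - θ|) (h2 : N * |π / 2 - θ| ≤ a) :
    (logGen (Complex.exp (-t + θ * Complex.I))).re ≤
      1 / (2 * (1 - a ^ 2 / 6) * l) * ∑ m ∈ Finset.range (N + 1), 1 / (m : ℝ) ^ 2 +
      1 / (2 * t) * (π ^ 2 / 6 - ∑ m ∈ Finset.range (N + 1), 1 / (m : ℝ) ^ 2) := by
  have ha0 : 0 ≤ a := le_trans (by positivity) h2
  refine re_logGen_le_of_mul_le_sin ht N (by nlinarith) hl h1 fun m hm hm0 => ?_
  have hm1 : (m : ℝ) ≤ N := by exact_mod_cast Nat.lt_succ_iff.mp (Finset.mem_range.mp hm)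
  have hm2 : (0 : ℝ) < m := by exact_mod_cast hm0
  have h3 : 0 < |π / 2 - θ| := hl.trans_le h1
  exact mul_le_sin_of_le (by positivity) (le_trans (by gcongr) h2)

/-- Away from the singularities at `±1` and `±i`, the function is small. -/
lemma re_logGen_rest (ht : 0 < t) (ht' : t ≤ 1 / 396) (h1 : 1 / 66 ≤ |π / 2 - θ|)
    (h2 : |π / 2 - θ| ≤ π / 2 - 1 / 66) :
    (logGen (Complex.exp (-t + θ * Complex.I))).re ≤ 69 / 400 * (1 / t) := by
  have hp1 := pi_gt_d6
  have hp2 := pi_lt_d6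
  have hp3 : π ^ 2 < 9.86961 := by nlinarith
  have ht2 : 396 ≤ 1 / t := by rw [le_div_iff₀ ht]; linarith
  have ht3 : 1 / (2 * t) = 1 / 2 * (1 / t) := by rw [one_div_mul_one_div]
  have combine : ∀ {r K Z : ℝ}, r ≤ K + 1 / (2 * t) * (π ^ 2 / 6 - Z) →
      K + 396 * (1 / 2 * (9.86961 / 6 - Z) - 69 / 400) ≤ 0 →
      1 / 2 * (9.86961 / 6 - Z) ≤ 69 / 400 → r ≤ 69 / 400 * (1 / t) := by
    intro r K Z hr hK hZ
    rw [ht3] at hr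
    refine hr.trans ?_
    nlinarith
  set ψ := |π / 2 - θ| with hψ
  rcases le_total ψ (1 / 32) with h3 | h3
  · refine combine (re_logGen_le_of_le_one ht 16 (a := 1 / 2) (by norm_num) (by norm_num) h1 ?_) ?_ ?_
    · rw [← hψ]; push_cast; linarith
    all_goals norm_num [Finset.sum_range_succ]
  rcases le_total ψ (1 / 8) with h4 | h4
  · refine combine (re_logGen_le_of_le_one ht 8 (a := 1) (by norm_num) (by norm_num) h3 ?_) ?_ ?_
    · rw [← hψ]; push_cast; linarith
    all_goals norm_num [Finset.sum_range_succ]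
  rcases le_total ψ (3 / 8) with h5 | h5
  · refine combine (re_logGen_le_of_mul_le_sin ht 4 (b := 0.636) (by norm_num) (by norm_num) h4
      fun m hm hm0 => ?_) ?_ ?_
    · rw [← hψ]
      have hm1 : (m : ℝ) ≤ 4 := by exact_mod_cast Nat.lt_succ_iff.mp (Finset.mem_range.mp hm)
      have hm2 : (0 : ℝ) < m := by exact_mod_cast hm0
      have h6 : (0.636 : ℝ) ≤ 2 / π := by rw [le_div_iff₀ pi_pos]; linarith
      refine le_trans ?_ (mul_le_sin (x := m * ψ) (by positivity) ?_)
      · gcongr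
      · nlinarith
    all_goals norm_num [Finset.sum_range_succ]
  rcases le_total ψ 0.9 with h6 | h6
  · have k1 := le_sin_of_mem (a := 0.375) (x := 1 * ψ) (by norm_num)
      (by linarith) (by linarith)
    have k2 := le_sin_of_mem (a := 0.75) (x := 2 * ψ) (by norm_num)
      (by linarith) (by linarith)
    have k3 := le_sin_of_mem (a := 0.44) (x := 3 * ψ) (by norm_num)
      (by linarith) (by linarith)
    refine combine (re_logGen_le_of_sin ht θ {1, 2, 3}
      (fun m => if m = 1 then 0.36 else if m = 2 then 0.64 else 0.418) fun m hm _ => ?_) ?_ ?_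
    · rw [← abs_sin_mul_abs, ← hψ]
      simp only [Finset.mem_insert, Finset.mem_singleton] at hm
      rcases hm with rfl | rfl | rfl
      · exact ⟨by norm_num, le_trans (by norm_num at k1 ⊢; linarith) (le_abs_self _)⟩
      · exact ⟨by norm_num, le_trans (by norm_num at k2 ⊢; linarith) (le_abs_self _)⟩
      · exact ⟨by norm_num, le_trans (by norm_num at k3 ⊢; linarith) (le_abs_self _)⟩
    all_goals norm_num
  rcases le_total ψ (π / 2 - 1 / 4) with h7 | h7
  · have k1 := le_sin_of_mem (a := 0.9) (x := 1 * ψ) (by norm_num)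
      (by linarith) (by linarith)
    have k2 := le_sin_of_mem (a := 0.5) (x := 2 * ψ) (by norm_num)
      (by linarith) (by linarith)
    have k3 := le_sin_of_mem (a := 0.458) (x := 4 * ψ - π) (by norm_num)
      (by linarith) (by linarith)
    rw [sin_sub_pi] at k3
    refine combine (re_logGen_le_of_sin ht θ {1, 2, 4}
      (fun m => if m = 1 then 0.717 else if m = 2 then 0.468 else 0.433) fun m hm _ => ?_) ?_ ?_
    · rw [← abs_sin_mul_abs, ← hψ]
      simp only [Finset.mem_insert, Finset.mem_singleton] at hm
      rcases hm with rfl | rfl | rfl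
      · exact ⟨by norm_num, le_trans (by norm_num at k1 ⊢; linarith) (le_abs_self _)⟩
      · exact ⟨by norm_num, le_trans (by norm_num at k2 ⊢; linarith) (le_abs_self _)⟩
      · exact ⟨by norm_num, le_trans (by norm_num at k3 ⊢; linarith) (neg_le_abs _)⟩
    all_goals norm_num
  · obtain ⟨η, hη⟩ : ∃ η, ψ = π / 2 - η := ⟨π / 2 - ψ, by ring⟩
    have k1 := one_sub_sq_div_two_le_cos (x := η)
    have k2 := mul_le_sin_of_le (a := 1 / 2) (x := 2 * η) (by linarith) (by linarith)
    have k3 := one_sub_sq_div_two_le_cos (x := 3 * η)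
    have k4 := mul_le_sin_of_le (a := 1) (x := 4 * η) (by linarith) (by linarith)
    have e1 : sin (1 * ψ) = cos η := by rw [hη, one_mul, sin_pi_div_two_sub]
    have e2 : sin (2 * ψ) = sin (2 * η) := by
      rw [hη, ← sin_pi_sub]; congr 1; ring
    have e3 : sin (3 * ψ) = -cos (3 * η) := by
      rw [hη, show 3 * (π / 2 - η) = (π / 2 - 3 * η) + π by ring, sin_add_pi, sin_pi_div_two_sub]
    have e4 : sin (4 * ψ) = -sin (4 * η) := by
      rw [hη, show 4 * (π / 2 - η) = 2 * π - 4 * η by ring, sin_two_pi_sub]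
    rw [← e1] at k1
    rw [← e2] at k2
    have k3' : 1 - (3 * η) ^ 2 / 2 ≤ -sin (3 * ψ) := by rw [e3, neg_neg]; exact k3
    have k4' : (1 - 1 ^ 2 / 6) * (4 * η) ≤ -sin (4 * ψ) := by rw [e4, neg_neg]; exact k4
    have hη1 : 1 / 66 ≤ η := by linarith
    have hη2 : η ≤ 1 / 4 := by linarith
    refine combine (re_logGen_le_of_sin ht θ {1, 2, 3, 4}
      (fun m => if m = 1 then 0.96 else if m = 2 then 0.0284 else if m = 3 then 0.7 else 0.0454)
      fun m hm _ => ?_) ?_ ?_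
    · rw [← abs_sin_mul_abs, ← hψ]
      simp only [Finset.mem_insert, Finset.mem_singleton] at hm
      rcases hm with rfl | rfl | rfl | rfl
      · exact ⟨by norm_num, le_trans (by norm_num at k1 ⊢; nlinarith) (le_abs_self _)⟩
      · exact ⟨by norm_num, le_trans (by norm_num at k2 ⊢; linarith) (le_abs_self _)⟩
      · exact ⟨by norm_num, le_trans (by norm_num at k3' ⊢; nlinarith) (neg_le_abs _)⟩
      · exact ⟨by norm_num, le_trans (by norm_num at k4' ⊢; linarith) (neg_le_abs _)⟩
    all_goals norm_num

end Rest

section Csch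

lemma norm_sinh_sub_le {z : ℂ} (hz : ‖z‖ ≤ 1) : ‖Complex.sinh z - z‖ ≤ 9 / 50 * ‖z‖ ^ 3 := by
  have h1 := Complex.exp_bound hz (n := 5) (by norm_num)
  have h2 := Complex.exp_bound (x := -z) (by rwa [norm_neg]) (n := 5) (by norm_num)
  rw [norm_neg] at h2
  have h3 : Complex.sinh z - z = ((Complex.exp z - ∑ m ∈ Finset.range 5, z ^ m / m.factorial) -
      (Complex.exp (-z) - ∑ m ∈ Finset.range 5, (-z) ^ m / m.factorial)) / 2 + z ^ 3 / 6 := by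
    rw [Complex.sinh]
    simp [Finset.sum_range_succ, Nat.factorial]
    ring
  rw [h3]
  refine (norm_add_le _ _).trans ?_
  rw [norm_div, norm_div, Complex.norm_ofNat, Complex.norm_ofNat, norm_pow]
  have h4 := (norm_sub_le _ _).trans (add_le_add h1 h2)
  norm_num [Nat.factorial] at h4
  have h5 : ‖z‖ ^ 5 ≤ ‖z‖ ^ 3 := pow_le_pow_of_le_one (norm_nonneg _) hz (by norm_num)
  linarith [pow_nonneg (norm_nonneg z) 3]

lemma norm_sinh_ge {z : ℂ} (hz : ‖z‖ ≤ 1) : 41 / 50 * ‖z‖ ≤ ‖Complex.sinh z‖ := by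
  have h1 := norm_sinh_sub_le hz
  have h2 := norm_sub_norm_le z (z - Complex.sinh z)
  rw [sub_sub_cancel, norm_sub_rev] at h2
  have h3 : ‖z‖ ^ 3 ≤ ‖z‖ := pow_le_of_le_one (norm_nonneg _) hz (by norm_num)
  linarith

/-- The difference between `1 / sinh z` and its polar part at `0`. -/
noncomputable def cschReg (z : ℂ) : ℂ := 1 / Complex.sinh z - 1 / z

lemma norm_cschReg_le {z : ℂ} (hz : ‖z‖ ≤ 1) : ‖cschReg z‖ ≤ ‖z‖ / 4 := by
  rcases eq_or_ne z 0 with rfl | h0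
  · simp [cschReg]
  have hz0 : 0 < ‖z‖ := norm_pos_iff.mpr h0
  have h1 := norm_sinh_sub_le hz
  have h2 := norm_sinh_ge hz
  have hs : 0 < ‖Complex.sinh z‖ := lt_of_lt_of_le (by positivity) h2
  rw [cschReg, div_sub_div _ _ (norm_pos_iff.mp hs) h0, norm_div, norm_mul, one_mul, mul_one,
    norm_sub_rev, div_le_iff₀ (by positivity)]
  nlinarith [mul_le_mul_of_nonneg_left h2 (by positivity : 0 ≤ ‖z‖ * ‖z‖)]

end Csch

section ImaginaryUnit

lemma re_div_le {P : ℝ} {Z w : ℂ} (hw : 0 < w.re) (hP : 0 < P)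
    (h : Z.im ^ 2 ≤ P * (P - 2 * Z.re)) : (Z / w).re ≤ P / (2 * w.re) := by
  have h2 : 0 < Complex.normSq w := Complex.normSq_pos.mpr fun h => by simp [h] at hw
  rw [Complex.div_re, ← add_div, div_le_div_iff₀ h2 (by positivity), Complex.normSq_apply]
  have h3 : 0 ≤ P * (Z.re * w.re * (-2 * w.re) + P * w.re ^ 2 + P * w.im ^ 2 -
      2 * w.re * (Z.im * w.im)) := by
    nlinarith [sq_nonneg (P * w.im - Z.im * w.re), sq_nonneg w.re]
  nlinarith [nonneg_of_mul_nonneg_right h3 hP]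

lemma sum_range_four_mul {M : Type*} [AddCommMonoid M] (f : ℕ → M) (N : ℕ) :
    ∑ m ∈ Finset.range (4 * N), f m =
      ∑ k ∈ Finset.range N, (f (4 * k) + f (4 * k + 1) + f (4 * k + 2) + f (4 * k + 3)) := by
  induction N with
  | zero => simp
  | succ N ih =>
    rw [Finset.sum_range_succ, ← ih, show 4 * (N + 1) = 4 * N + 1 + 1 + 1 + 1 by ring]
    simp only [Finset.sum_range_succ]
    abel

lemma sum_I_pow_div (N : ℕ) : ∑ m ∈ Finset.range (4 * N), Complex.I ^ m / (m : ℂ) ^ 2 =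
    ((∑ k ∈ Finset.range N, (1 / (4 * k : ℝ) ^ 2 - 1 / (4 * k + 2 : ℝ) ^ 2) : ℝ) : ℂ) +
    ((∑ k ∈ Finset.range N, (1 / (4 * k + 1 : ℝ) ^ 2 - 1 / (4 * k + 3 : ℝ) ^ 2) : ℝ) : ℂ) *
      Complex.I := by
  rw [sum_range_four_mul]
  push_cast
  rw [Finset.sum_mul, ← Finset.sum_add_distrib]
  refine Finset.sum_congr rfl fun k _ => ?_
  have h0 : Complex.I ^ (4 * k) = 1 := by rw [pow_mul, Complex.I_pow_four, one_pow]
  have h1 : Complex.I ^ (4 * k + 1) = Complex.I := by rw [pow_succ, h0, one_mul]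
  have h2 : Complex.I ^ (4 * k + 2) = -1 := by rw [pow_succ, h1, Complex.I_mul_I]
  have h3 : Complex.I ^ (4 * k + 3) = -Complex.I := by rw [pow_succ, h2, neg_one_mul]
  rw [h0, h1, h2, h3]
  ring

lemma norm_add_mul_I_le {t y r : ℝ} (hr : 0 ≤ r) (h : t ^ 2 + y ^ 2 ≤ r ^ 2) :
    ‖(t : ℂ) + y * Complex.I‖ ≤ r := by
  refine (pow_le_pow_iff_left₀ (norm_nonneg _) hr two_ne_zero).mp ?_
  rwa [← Complex.normSq_eq_norm_sq, Complex.normSq_add_mul_I]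

lemma re_logGen_near_I {t θ : ℝ} (ht : 0 < t) (ht' : t ≤ 1 / 396) (h1 : |π / 2 - θ| ≤ 1 / 66) :
    (logGen (Complex.exp (-t + θ * Complex.I))).re ≤ 239 / 1250 * (1 / t) + 1 / 8 := by
  have hp2 := pi_lt_d6
  have hp3 : π ^ 2 < 9.86961 := by nlinarith [pi_pos]
  have ht1 : 0 < 1 / t := by positivity
  set w : ℂ := t + (π / 2 - θ : ℝ) * Complex.I with hw
  have hwre : w.re = t := by simp [hw]
  have hwn : ‖w‖ ≤ 1 / 64 := by
    refine norm_add_mul_I_le (by norm_num) ?_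
    have h2 := sq_le_sq' (neg_le_of_abs_le h1) (le_of_abs_le h1)
    nlinarith
  set Z : ℂ := ∑ m ∈ Finset.range (4 * 16), Complex.I ^ m / (m : ℂ) ^ 2 with hZ
  have hsum : ∑ m ∈ Finset.range (4 * 16), logTerm (Complex.exp (-t + θ * Complex.I)) m =
      1 / 2 * (Z / w) +
        ∑ m ∈ Finset.range (4 * 16), Complex.I ^ m / (2 * m) * cschReg (m * w) := by
    rw [hZ, Finset.sum_div, Finset.mul_sum, ← Finset.sum_add_distrib]
    refine Finset.sum_congr rfl fun m _ => ?_
    rw [exp_eq_I_mul_exp, logTerm_I_mul_exp, cschReg, ← hw]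
    generalize Complex.sinh (m * w) = u
    ring_nf
  have herr : ‖∑ m ∈ Finset.range (4 * 16), Complex.I ^ m / (2 * m) * cschReg (m * w)‖ ≤
      ∑ m ∈ Finset.range (4 * 16), (1 / 512 : ℝ) := by
    refine norm_sum_le_of_le _ fun m hm => ?_
    rcases Nat.eq_zero_or_pos m with rfl | hm0
    · simp
    have hm' : (0 : ℝ) < m := by exact_mod_cast hm0
    have hm1 : (m : ℝ) ≤ 64 := by exact_mod_cast (Finset.mem_range.mp hm).le
    have h2 : ‖(m : ℂ) * w‖ = m * ‖w‖ := by rw [norm_mul, Complex.norm_natCast]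
    have h3 := norm_cschReg_le (z := m * w) (by rw [h2]; nlinarith [norm_nonneg w])
    rw [norm_mul, norm_div, norm_pow, Complex.norm_I, one_pow, norm_mul, Complex.norm_natCast,
      Complex.norm_ofNat]
    calc 1 / (2 * m) * ‖cschReg (m * w)‖ ≤ 1 / (2 * m) * (m * ‖w‖ / 4) := by
          rw [h2] at h3; gcongr
      _ = ‖w‖ / 8 := by field_simp; ring
      _ ≤ _ := by linarith
  have hZ2 : (Z / w).re ≤ 0.733 / (2 * t) := by
    rw [← hwre]
    refine re_div_le (by rw [hwre]; exact ht) (by norm_num) ?_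
    rw [hZ, sum_I_pow_div]
    simp only [Complex.add_re, Complex.add_im, Complex.re_ofReal_mul, Complex.im_ofReal_mul,
      Complex.ofReal_re, Complex.ofReal_im, Complex.I_re, Complex.I_im, mul_zero, mul_one,
      add_zero, zero_add]
    norm_num [Finset.sum_range_succ]
  have hmain := re_logGen_le ht θ (Finset.range (4 * 16))
    (K := 0.733 / (4 * t) + 1 / 8) (by
      rw [hsum, Complex.add_re]
      refine add_le_add ?_ ?_
      · have : ((1 / 2 : ℂ) * (Z / w)).re = 1 / 2 * (Z / w).re := by
          rw [show (1 / 2 : ℂ) = ((1 / 2 : ℝ) : ℂ) by norm_num, Complex.re_ofReal_mul]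
        rw [this]
        calc 1 / 2 * (Z / w).re ≤ 1 / 2 * (0.733 / (2 * t)) := by gcongr
          _ = _ := by field_simp; norm_num
      · refine ((Complex.re_le_norm _).trans herr).trans ?_
        norm_num)
  refine hmain.trans ?_
  have e1 : 1 / (2 * t) = 1 / 2 * (1 / t) := by rw [one_div_mul_one_div]
  have e2 : 0.733 / (4 * t) = 0.733 / 4 * (1 / t) := by field_simp
  have h3 : 1 / 2 * (9.86961 / 6 - ∑ m ∈ Finset.range (4 * 16), 1 / (m : ℝ) ^ 2) ≤
      239 / 1250 - 0.733 / 4 := by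
    norm_num [Finset.sum_range_succ]
  rw [e1, e2]
  nlinarith

end ImaginaryUnit

section RealPoints

variable {ε w : ℂ}

lemma logTerm_mul_exp_even (hε : ε ^ 2 = 1) (w : ℂ) (l : ℕ) :
    logTerm (ε * Complex.exp (-w)) (2 * l) = 1 / (4 * l * Complex.sinh (2 * l * w)) := by
  have h1 : (ε * Complex.exp (-w)) ^ (2 * l) = Complex.exp (-(2 * l * w)) := by
    rw [mul_pow, pow_mul, hε, one_pow, one_mul, ← Complex.exp_nat_mul]
    push_cast
    ring_nf
  have h4 := Complex.exp_ne_zero (-(2 * l * w))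
  have h3 : 2 * Complex.sinh (2 * l * w) * Complex.exp (-(2 * l * w)) =
      1 - Complex.exp (-(2 * l * w)) ^ 2 := by
    rw [Complex.two_sinh, sub_mul, ← Complex.exp_add, add_neg_cancel, Complex.exp_zero, sq]
  rw [logTerm, pow_mul' _ 2 (2 * l), h1, pow_mul (-1 : ℂ), neg_one_sq, one_pow, one_mul, ← h3]
  push_cast
  rw [show (2 * l : ℂ) * (2 * Complex.sinh (2 * l * w) * Complex.exp (-(2 * l * w))) =
    (4 * l * Complex.sinh (2 * l * w)) * Complex.exp (-(2 * l * w)) by ring, ← div_div,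
    div_right_comm, div_self h4]

lemma logTerm_mul_exp_odd (hε : ε ^ 2 = 1) (w : ℂ) (l : ℕ) :
    logTerm (ε * Complex.exp (-w)) (2 * l + 1) =
      ε / (2 * (2 * l + 1) * Complex.cosh ((2 * l + 1) * w)) := by
  have h1 : (ε * Complex.exp (-w)) ^ (2 * l + 1) = ε * Complex.exp (-((2 * l + 1) * w)) := by
    rw [mul_pow, pow_succ, pow_mul, hε, one_pow, one_mul, ← Complex.exp_nat_mul]
    push_cast
    ring_nf
  have h4 := Complex.exp_ne_zero (-((2 * l + 1) * w))
  have h3 : 2 * Complex.cosh ((2 * l + 1) * w) * Complex.exp (-((2 * l + 1) * w)) =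
      1 + Complex.exp (-((2 * l + 1) * w)) ^ 2 := by
    rw [Complex.two_cosh, add_mul, ← Complex.exp_add, add_neg_cancel, Complex.exp_zero, sq]
  have h5 : (1 : ℂ) - (-1) ^ (2 * l + 1) * (ε * Complex.exp (-((2 * l + 1) * w))) ^ 2 =
      2 * Complex.cosh ((2 * l + 1) * w) * Complex.exp (-((2 * l + 1) * w)) := by
    rw [h3, pow_succ, pow_mul, neg_one_sq, one_pow, mul_pow, hε]
    ring
  rw [logTerm, pow_mul' _ 2 (2 * l + 1), h1, h5]
  push_cast
  rw [show (2 * l + 1 : ℂ) * (2 * Complex.cosh ((2 * l + 1) * w) *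
    Complex.exp (-((2 * l + 1) * w))) = (2 * (2 * l + 1) * Complex.cosh ((2 * l + 1) * w)) *
    Complex.exp (-((2 * l + 1) * w)) by ring, mul_div_mul_right _ _ h4]

lemma sum_range_two_mul {M : Type*} [AddCommMonoid M] (f : ℕ → M) (N : ℕ) :
    ∑ m ∈ Finset.range (2 * N), f m =
      ∑ k ∈ Finset.range N, f (2 * k) + ∑ k ∈ Finset.range N, f (2 * k + 1) := by
  induction N with
  | zero => simp
  | succ N ih =>
    rw [Finset.sum_range_succ _ N, Finset.sum_range_succ _ N, show 2 * (N + 1) = 2 * N + 1 + 1 by ring,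
      Finset.sum_range_succ, Finset.sum_range_succ, ih]
    abel

lemma cos_le_norm_cosh {x y : ℝ} : cos y ≤ ‖Complex.cosh (x + y * Complex.I)‖ := by
  refine (le_abs_self _).trans ((pow_le_pow_iff_left₀ (abs_nonneg _) (norm_nonneg _) two_ne_zero).mp ?_)
  rw [norm_cosh_sq, sq_abs, cos_sq', sub_le_sub_iff_right]
  nlinarith [one_le_cosh x]

variable {t η : ℝ}

lemma re_sum_logTerm_le (hε : ε ^ 2 = 1) (ht : 0 < t) (ht' : t ≤ 1 / 396) (h1 : t / 2 ≤ |η|)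
    (h2 : |η| ≤ 1 / 66) :
    (∑ m ∈ Finset.range (2 * 32), logTerm (ε * Complex.exp (-(t + η * Complex.I))) m).re ≤
      0.1614 * (1 / t) + 3 / 2 := by
  set w : ℂ := t + η * Complex.I with hw
  have ht1 : 0 < 1 / t := by positivity
  have hη1 : t ^ 2 / 4 ≤ η ^ 2 := by
    rw [← sq_abs η]; nlinarith [abs_nonneg η]
  have hη2 : η ^ 2 ≤ (1 / 66) ^ 2 := sq_le_sq' (neg_le_of_abs_le h2) (le_of_abs_le h2)
  have hwn : ‖w‖ ≤ 1 / 64 := norm_add_mul_I_le (by norm_num) (by nlinarith)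
  have hre : (1 / w).re ≤ 4 / 5 * (1 / t) := by
    rw [one_div, Complex.inv_re, hw, Complex.normSq_add_mul_I]
    simp only [Complex.add_re, Complex.ofReal_re, Complex.re_ofReal_mul, Complex.I_re, mul_zero,
      add_zero]
    rw [div_le_iff₀ (by positivity)]
    have : 4 / 5 * (1 / t) * (t ^ 2 + η ^ 2) = t + 4 / 5 * (1 / t) * (η ^ 2 - t ^ 2 / 4) := by
      field_simp
      ring
    rw [this]
    have := mul_nonneg (mul_nonneg (by norm_num : (0 : ℝ) ≤ 4 / 5) ht1.le) (sub_nonneg.mpr hη1)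
    linarith
  have heven : ∀ l ∈ Finset.range 32, (logTerm (ε * Complex.exp (-w)) (2 * l)).re ≤
      1 / (8 * (l : ℝ) ^ 2) * (4 / 5 * (1 / t)) + 1 / 512 := by
    intro l hl
    rcases Nat.eq_zero_or_pos l with rfl | hl0
    · simp [logTerm_zero]
    have hl' : (0 : ℝ) < l := by exact_mod_cast hl0
    have hl1 : (l : ℝ) ≤ 32 := by exact_mod_cast (Finset.mem_range.mp hl).le
    have hlc : (l : ℂ) ≠ 0 := by exact_mod_cast hl0.ne'
    have e1 : logTerm (ε * Complex.exp (-w)) (2 * l) =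
        ((1 / (8 * (l : ℝ) ^ 2) : ℝ) : ℂ) * (1 / w) + 1 / (4 * l) * cschReg (2 * l * w) := by
      rw [logTerm_mul_exp_even hε, cschReg]
      generalize Complex.sinh (2 * l * w) = u
      push_cast
      ring_nf
    have h3 : ‖(2 * l : ℂ) * w‖ = 2 * l * ‖w‖ := by
      rw [norm_mul, norm_mul, Complex.norm_natCast, Complex.norm_ofNat]
    have h4 := norm_cschReg_le (z := 2 * l * w) (by rw [h3]; nlinarith [norm_nonneg w])
    rw [e1, Complex.add_re, Complex.re_ofReal_mul]
    refine add_le_add (by gcongr) ((Complex.re_le_norm _).trans ?_)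
    rw [norm_mul, norm_div, norm_mul, Complex.norm_natCast, Complex.norm_ofNat, norm_one]
    calc 1 / (4 * l) * ‖cschReg (2 * l * w)‖ ≤ 1 / (4 * l) * (2 * l * ‖w‖ / 4) := by
          rw [h3] at h4; gcongr
      _ = ‖w‖ / 8 := by field_simp; ring
      _ ≤ _ := by linarith
  have hεn : ‖ε‖ = 1 := by
    rw [← pow_eq_one_iff_of_nonneg (norm_nonneg _) two_ne_zero, ← norm_pow, hε, norm_one]
  have hodd : ∀ l ∈ Finset.range 32, (logTerm (ε * Complex.exp (-w)) (2 * l + 1)).re ≤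
      1 / (2 * (2 * l + 1) * (1 - ((2 * l + 1) / 66 : ℝ) ^ 2 / 2)) := by
    intro l hl
    have hl1 : (l : ℝ) ≤ 31 := by exact_mod_cast Nat.lt_succ_iff.mp (Finset.mem_range.mp hl)
    have h3 := cos_le_norm_cosh (x := (2 * l + 1) * t) (y := (2 * l + 1) * η)
    have h4 := one_sub_sq_div_two_le_cos (x := (2 * l + 1) * η)
    refine (Complex.re_le_norm _).trans ?_
    rw [logTerm_mul_exp_odd hε, norm_div, hεn, norm_mul, norm_mul,
      show (2 * l + 1 : ℂ) = ((2 * l + 1 : ℕ) : ℂ) by push_cast; rfl, Complex.norm_natCast,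
      Complex.norm_ofNat]
    push_cast
    have h5 : 1 - ((2 * l + 1) / 66 : ℝ) ^ 2 / 2 ≤ ‖Complex.cosh ((2 * l + 1) * w)‖ := by
      have e1 : (2 * l + 1) * w = (((2 * l + 1) * t : ℝ) : ℂ) +
          (((2 * l + 1) * η : ℝ) : ℂ) * Complex.I := by
        rw [hw]; push_cast; ring
      rw [e1]
      refine le_trans ?_ (h4.trans h3)
      rw [mul_pow, div_pow]
      nlinarith [sq_nonneg (2 * l + 1 : ℝ)]
    have h6 : 0 < 1 - ((2 * l + 1) / 66 : ℝ) ^ 2 / 2 := by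
      nlinarith [(Nat.cast_nonneg l : (0 : ℝ) ≤ l)]
    gcongr
  rw [sum_range_two_mul, Complex.add_re, Complex.re_sum, Complex.re_sum]
  refine (add_le_add (Finset.sum_le_sum heven) (Finset.sum_le_sum hodd)).trans ?_
  rw [Finset.sum_add_distrib, ← Finset.sum_mul]
  have h3 : (∑ l ∈ Finset.range 32, 1 / (8 * (l : ℝ) ^ 2)) * (4 / 5) ≤ 0.1614 := by
    norm_num [Finset.sum_range_succ]
  have h4 : ∑ l ∈ Finset.range 32, (1 / 512 : ℝ) + ∑ l ∈ Finset.range 32,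
      1 / (2 * (2 * l + 1) * (1 - ((2 * l + 1) / 66 : ℝ) ^ 2 / 2)) ≤ 3 / 2 := by
    norm_num [Finset.sum_range_succ]
  nlinarith

lemma exp_eq_one_mul_exp (t θ : ℝ) : Complex.exp (-t + θ * Complex.I) =
    1 * Complex.exp (-(t + (-θ : ℝ) * Complex.I)) := by
  rw [one_mul]
  congr 1
  push_cast
  ring

lemma exp_eq_neg_one_mul_exp (t θ : ℝ) : Complex.exp (-t + θ * Complex.I) =
    -1 * Complex.exp (-(t + (π - θ : ℝ) * Complex.I)) := by
  rw [← Complex.exp_pi_mul_I, ← Complex.exp_add]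
  congr 1
  push_cast
  ring

/-- The function is small away from `±i` and from small neighbourhoods of `±1`. -/
lemma re_logGen_minor {t θ : ℝ} (ht : 0 < t) (ht' : t ≤ 1 / 396) (h1 : t / 2 ≤ θ)
    (h2 : θ ≤ π - t / 2) (h3 : 1 / 66 ≤ |π / 2 - θ|) :
    (logGen (Complex.exp (-t + θ * Complex.I))).re ≤ 69 / 400 * (1 / t) + 3 / 2 := by
  have hp2 := pi_lt_d6
  have hp3 : π ^ 2 < 9.86961 := by nlinarith [pi_pos]
  have ht1 : 0 < 1 / t := by positivity
  have key : ∀ {η : ℝ} {ε : ℂ}, ε ^ 2 = 1 → t / 2 ≤ |η| → |η| ≤ 1 / 66 →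
      Complex.exp (-t + θ * Complex.I) = ε * Complex.exp (-(t + η * Complex.I)) →
      (logGen (Complex.exp (-t + θ * Complex.I))).re ≤ 69 / 400 * (1 / t) + 3 / 2 := by
    intro η ε hε hη1 hη2 h
    refine (re_logGen_le ht θ (Finset.range (2 * 32))
      (K := 0.1614 * (1 / t) + 3 / 2) (by
      rw [h]; exact re_sum_logTerm_le hε ht ht' hη1 hη2)).trans ?_
    have e1 : 1 / (2 * t) = 1 / 2 * (1 / t) := by rw [one_div_mul_one_div]
    have h3 : 1 / 2 * (9.86961 / 6 - ∑ m ∈ Finset.range (2 * 32), 1 / (m : ℝ) ^ 2) ≤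
        69 / 400 - 0.1614 := by
      norm_num [Finset.sum_range_succ]
    rw [e1]
    nlinarith
  rcases le_total |π / 2 - θ| (π / 2 - 1 / 66) with h4 | h4
  · linarith [re_logGen_rest ht ht' h3 h4]
  rcases le_abs.mp h4 with h5 | h5
  · refine key (η := -θ) (one_pow 2) ?_ ?_ (exp_eq_one_mul_exp t θ)
    · rw [abs_neg]; exact h1.trans (le_abs_self _)
    · rw [abs_neg, abs_of_nonneg (by linarith)]; linarith
  · refine key (η := π - θ) neg_one_sq ?_ ?_ (exp_eq_neg_one_mul_exp t θ)
    · exact le_trans (by linarith) (le_abs_self _)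
    · rw [abs_of_nonneg (by linarith)]; linarith

end RealPoints

section Vertical

variable {x : ℝ} (y : ℝ)

lemma sinh_sub_sinh (x y : ℝ) : Complex.sinh (x + y * Complex.I) - Complex.sinh x =
    ((sinh x * (cos y - 1) : ℝ) : ℂ) + ((cosh x * sin y : ℝ) : ℂ) * Complex.I := by
  rw [Complex.sinh_add, Complex.cosh_mul_I, Complex.sinh_mul_I]
  push_cast
  ring

lemma cosh_sub_cosh (x y : ℝ) : Complex.cosh (x + y * Complex.I) - Complex.cosh x =
    ((cosh x * (cos y - 1) : ℝ) : ℂ) + ((sinh x * sin y : ℝ) : ℂ) * Complex.I := by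
  rw [Complex.cosh_add, Complex.cosh_mul_I, Complex.sinh_mul_I]
  push_cast
  ring

lemma sq_cos_sub_one_add_sq_sin_le (y : ℝ) : (cos y - 1) ^ 2 + sin y ^ 2 ≤ y ^ 2 := by
  nlinarith [sin_sq_add_cos_sq y, one_sub_sq_div_two_le_cos (x := y)]

lemma norm_sinh_sub_sinh_le (x : ℝ) :
    ‖Complex.sinh (x + y * Complex.I) - Complex.sinh x‖ ≤ cosh x * |y| := by
  rw [sinh_sub_sinh]
  refine norm_add_mul_I_le (mul_nonneg (cosh_pos x).le (abs_nonneg y)) ?_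
  have h1 := mul_le_mul_of_nonneg_left (sq_cos_sub_one_add_sq_sin_le y) (sq_nonneg (cosh x))
  have h2 : (sinh x * (cos y - 1)) ^ 2 ≤ (cosh x * (cos y - 1)) ^ 2 := by
    rw [mul_pow, mul_pow, cosh_sq]
    nlinarith [sq_nonneg (cos y - 1)]
  rw [mul_pow (cosh x) |y|, sq_abs]
  linarith

lemma norm_cosh_sub_cosh_le (x : ℝ) :
    ‖Complex.cosh (x + y * Complex.I) - Complex.cosh x‖ ≤ cosh x * |y| := by
  rw [cosh_sub_cosh]
  refine norm_add_mul_I_le (mul_nonneg (cosh_pos x).le (abs_nonneg y)) ?_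
  have h1 := mul_le_mul_of_nonneg_left (sq_cos_sub_one_add_sq_sin_le y) (sq_nonneg (cosh x))
  have h2 : (sinh x * sin y) ^ 2 ≤ (cosh x * sin y) ^ 2 := by
    rw [mul_pow, mul_pow, cosh_sq]
    nlinarith [sq_nonneg (sin y)]
  rw [mul_pow (cosh x) |y|, sq_abs]
  linarith

lemma sinh_sub_self_le (hx : 0 ≤ x) (hx1 : x ≤ 1) : sinh x - x ≤ 9 / 50 * x ^ 3 := by
  have h := norm_sinh_sub_le (z := x) (by rwa [Complex.norm_real, norm_of_nonneg hx])
  rw [← Complex.ofReal_sinh, ← Complex.ofReal_sub, Complex.norm_real, Complex.norm_real,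
    norm_of_nonneg hx] at h
  exact (le_abs_self _).trans h

lemma cosh_sub_one_le (hx : 0 ≤ x) (hx1 : x ≤ 1) : cosh x - 1 ≤ 11 / 20 * x ^ 2 := by
  have h1 : cosh x - 1 = 2 * sinh (x / 2) ^ 2 := by
    have h2 := cosh_two_mul (x / 2)
    rw [mul_div_cancel₀ x two_ne_zero, cosh_sq] at h2
    linarith
  have h3 := sinh_sub_self_le (x := x / 2) (by linarith) (by linarith)
  have h4 : sinh (x / 2) ≤ 209 / 200 * (x / 2) := by nlinarith [mul_nonneg hx hx]
  have h5 := sinh_nonneg_iff.mpr (by linarith : 0 ≤ x / 2)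
  rw [h1]
  nlinarith

lemma abs_sin_sub_le (y : ℝ) : |sin y - y| ≤ |y| ^ 3 / 6 := by
  rcases lt_trichotomy y 0 with h | rfl | h
  · have h1 := sin_gt_sub_cube (neg_pos.mpr h)
    have h2 := sin_le (neg_pos.mpr h).le
    rw [sin_neg] at h1 h2
    rw [abs_of_neg h, abs_le]
    constructor <;> linarith [pow_pos (neg_pos.mpr h) 3]
  · simp
  · have h1 := sin_gt_sub_cube h
    have h2 := sin_le h.le
    rw [abs_of_pos h, abs_le]
    constructor <;> linarith [pow_pos h 3]

lemma norm_sinh_sub_sinh_sub_le (hx : 0 ≤ x) (hx1 : x ≤ 1) (hy : |y| ≤ x / 2) :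
    ‖Complex.sinh (x + y * Complex.I) - Complex.sinh x - y * Complex.I‖ ≤
      9 / 10 * x ^ 2 * |y| := by
  have h1 : Complex.sinh (x + y * Complex.I) - Complex.sinh x - y * Complex.I =
      ((sinh x * (cos y - 1) : ℝ) : ℂ) +
        (((cosh x - 1) * sin y + (sin y - y) : ℝ) : ℂ) * Complex.I := by
    rw [sinh_sub_sinh]
    push_cast
    ring
  have hy0 := abs_nonneg y
  have hs := sinh_sub_self_le hx hx1
  have hs0 := sinh_nonneg_iff.mpr hx
  have hs1 : sinh x ≤ 59 / 50 * x := by nlinarith [mul_nonneg hx hx]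
  have hc := cosh_sub_one_le hx hx1
  have hcos : |cos y - 1| ≤ |y| ^ 2 / 2 := by
    rw [sq_abs, abs_sub_comm, abs_of_nonneg (by linarith [cos_le_one y])]
    linarith [one_sub_sq_div_two_le_cos (x := y)]
  have h2 : |sinh x * (cos y - 1)| ≤ 59 / 200 * x ^ 2 * |y| := by
    rw [abs_mul, abs_of_nonneg hs0]
    calc sinh x * |cos y - 1| ≤ 59 / 50 * x * (|y| ^ 2 / 2) := by gcongr
      _ = 59 / 100 * x * |y| * |y| := by ring
      _ ≤ 59 / 100 * x * |y| * (x / 2) := by gcongr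
      _ = _ := by ring
  have h3 : |(cosh x - 1) * sin y + (sin y - y)| ≤ 3 / 5 * x ^ 2 * |y| := by
    refine (abs_add_le _ _).trans ?_
    rw [abs_mul, abs_of_nonneg (by linarith [one_le_cosh x])]
    have h4 : |y| ^ 3 ≤ x ^ 2 / 4 * |y| := by
      rw [pow_succ]
      gcongr
      nlinarith
    calc (cosh x - 1) * |sin y| + |sin y - y| ≤ 11 / 20 * x ^ 2 * |y| + |y| ^ 3 / 6 :=
          add_le_add (mul_le_mul hc abs_sin_le_abs (abs_nonneg _) (by positivity))
            (abs_sin_sub_le y)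
      _ ≤ _ := by nlinarith [mul_nonneg (sq_nonneg x) hy0]
  rw [h1]
  refine (norm_add_le _ _).trans ?_
  rw [norm_mul, Complex.norm_I, mul_one, Complex.norm_real, Complex.norm_real]
  exact (add_le_add h2 h3).trans (by nlinarith [mul_nonneg (sq_nonneg x) hy0])

lemma le_norm_add_mul_I (x : ℝ) : x ≤ ‖(x : ℂ) + y * Complex.I‖ := by
  have := Complex.re_le_norm (x + y * Complex.I)
  simpa using this

lemma norm_cschReg_sub_le_of_le_one (hx : 0 < x) (hx1 : x ≤ 1) (hy : |y| ≤ x / 2) :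
    ‖cschReg (x + y * Complex.I) - cschReg x‖ ≤ 1.36 * |y| := by
  set z : ℂ := x + y * Complex.I with hz
  have hs := self_le_sinh_iff.mpr hx.le
  have h1 : x ≤ ‖z‖ := le_norm_add_mul_I y x
  have h2 : x ≤ ‖Complex.sinh z‖ := hs.trans (norm_sinh_ge_sinh hx.le y)
  have hz0 : z ≠ 0 := norm_pos_iff.mp (hx.trans_le h1)
  have hs0 : Complex.sinh z ≠ 0 := norm_pos_iff.mp (hx.trans_le h2)
  have hx0 : (x : ℂ) ≠ 0 := Complex.ofReal_ne_zero.mpr hx.ne'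
  have hsx0 : Complex.sinh x ≠ 0 := by
    rw [← Complex.ofReal_sinh]
    exact Complex.ofReal_ne_zero.mpr (hx.trans_le hs).ne'
  have hsx : ‖Complex.sinh x‖ = sinh x := by
    rw [← Complex.ofReal_sinh, Complex.norm_real, norm_of_nonneg (hx.le.trans hs)]
  have hzx : z - x = y * Complex.I := by rw [hz]; ring
  have hzxn : ‖(x : ℂ) - z‖ = |y| := by
    rw [norm_sub_rev, hzx, norm_mul, Complex.norm_I, mul_one, Complex.norm_real, norm_eq_abs]
  have hid : cschReg z - cschReg x =
      -((Complex.sinh z - Complex.sinh x - y * Complex.I) / (z * Complex.sinh z)) -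
      (Complex.sinh x - x) * ((Complex.sinh x - Complex.sinh z) /
        (z * Complex.sinh z * Complex.sinh x) + (x - z) / (z * x * Complex.sinh x)) := by
    rw [cschReg, cschReg, ← hzx]
    field_simp
    ring
  have hc := cosh_sub_one_le hx.le hx1
  have hx2 : x ^ 2 ≤ 1 := pow_le_one₀ hx.le hx1
  have n1 : ‖(Complex.sinh z - Complex.sinh x - y * Complex.I) / (z * Complex.sinh z)‖ ≤
      9 / 10 * |y| := by
    rw [norm_div, norm_mul]
    refine (div_le_div₀ (by positivity) (norm_sinh_sub_sinh_sub_le y hx.le hx1 hy)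
      (by positivity) (mul_le_mul h1 h2 hx.le (norm_nonneg _))).trans (le_of_eq ?_)
    field_simp
  have n2 : ‖(Complex.sinh x - Complex.sinh z) / (z * Complex.sinh z * Complex.sinh x)‖ ≤
      1.55 * |y| / x ^ 3 := by
    rw [norm_div, norm_mul, norm_mul, hsx, norm_sub_rev]
    refine div_le_div₀ (by positivity) ((norm_sinh_sub_sinh_le y x).trans ?_) (by positivity) ?_
    · gcongr
      nlinarith
    · calc x ^ 3 = x * x * x := by ring
        _ ≤ _ := by gcongr
  have n3 : ‖((x : ℂ) - z) / (z * x * Complex.sinh x)‖ ≤ |y| / x ^ 3 := by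
    rw [norm_div, norm_mul, norm_mul, hsx, hzxn, Complex.norm_real, norm_of_nonneg hx.le]
    gcongr
    calc x ^ 3 = x * x * x := by ring
        _ ≤ _ := by gcongr
  have n4 : ‖Complex.sinh x - x‖ ≤ 9 / 50 * x ^ 3 := by
    have := norm_sinh_sub_le (z := x) (by rwa [Complex.norm_real, norm_of_nonneg hx.le])
    rwa [Complex.norm_real, norm_of_nonneg hx.le] at this
  rw [hid]
  refine (norm_sub_le _ _).trans ?_
  rw [norm_neg, norm_mul]
  have n5 := (norm_add_le _ _).trans (add_le_add n2 n3)
  refine (add_le_add n1 (mul_le_mul n4 n5 (norm_nonneg _) (by positivity))).trans ?_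
  have n6 : 9 / 50 * x ^ 3 * (1.55 * |y| / x ^ 3 + |y| / x ^ 3) = 0.459 * |y| := by
    field_simp
    ring
  rw [n6]
  linarith [abs_nonneg y]

lemma sq_mul_cosh_le (hx : 0 ≤ x) : x ^ 2 * cosh x ≤ 2 * sinh x ^ 2 := by
  have h1 : x ^ 2 / 2 ≤ cosh x - 1 := by
    have h2 := cosh_two_mul (x / 2)
    rw [mul_div_cancel₀ x two_ne_zero, cosh_sq] at h2
    have h3 : (x / 2) ^ 2 ≤ sinh (x / 2) ^ 2 :=
      pow_le_pow_left₀ (by positivity) (self_le_sinh_iff.mpr (by positivity)) 2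
    linarith
  rw [sinh_sq]
  nlinarith [one_le_cosh x]

lemma norm_cschReg_sub_le (hx : 0 < x) :
    ‖cschReg (x + y * Complex.I) - cschReg x‖ ≤ 3 * |y| / x ^ 2 := by
  set z : ℂ := x + y * Complex.I with hz
  have hs := self_le_sinh_iff.mpr hx.le
  have hsp := hx.trans_le hs
  have h1 : x ≤ ‖z‖ := le_norm_add_mul_I y x
  have h2 : sinh x ≤ ‖Complex.sinh z‖ := norm_sinh_ge_sinh hx.le y
  have hz0 : z ≠ 0 := norm_pos_iff.mp (hx.trans_le h1)
  have hs0 : Complex.sinh z ≠ 0 := norm_pos_iff.mp (hsp.trans_le h2)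
  have hx0 : (x : ℂ) ≠ 0 := Complex.ofReal_ne_zero.mpr hx.ne'
  have hsx : ‖Complex.sinh x‖ = sinh x := by
    rw [← Complex.ofReal_sinh, Complex.norm_real, norm_of_nonneg hsp.le]
  have hsx0 : Complex.sinh x ≠ 0 := norm_pos_iff.mp (by rwa [hsx])
  have hzxn : ‖(x : ℂ) - z‖ = |y| := by
    rw [hz, sub_add_cancel_left, norm_neg, norm_mul, Complex.norm_I, mul_one, Complex.norm_real,
      norm_eq_abs]
  have hid : cschReg z - cschReg x = (Complex.sinh x - Complex.sinh z) /
      (Complex.sinh z * Complex.sinh x) - (x - z) / (z * x) := by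
    rw [cschReg, cschReg]
    field_simp
    ring
  rw [hid]
  refine (norm_sub_le _ _).trans ?_
  rw [norm_div, norm_div, norm_mul, norm_mul, hsx, hzxn, norm_sub_rev, Complex.norm_real,
    norm_of_nonneg hx.le]
  have n1 : ‖Complex.sinh z - Complex.sinh x‖ / (‖Complex.sinh z‖ * sinh x) ≤
      2 * |y| / x ^ 2 := by
    rw [div_le_div_iff₀ (by positivity) (by positivity)]
    calc ‖Complex.sinh z - Complex.sinh x‖ * x ^ 2 ≤ cosh x * |y| * x ^ 2 := by
          gcongr; exact norm_sinh_sub_sinh_le y x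
      _ = |y| * (x ^ 2 * cosh x) := by ring
      _ ≤ |y| * (2 * sinh x ^ 2) := mul_le_mul_of_nonneg_left (sq_mul_cosh_le hx.le) (abs_nonneg y)
      _ = 2 * |y| * (sinh x * sinh x) := by ring
      _ ≤ _ := by gcongr
  have n2 : |y| / (‖z‖ * x) ≤ |y| / x ^ 2 := by
    rw [sq]
    gcongr
  exact (add_le_add n1 n2).trans (le_of_eq (by ring))

lemma norm_sech_sub_le (hy : |y| ≤ x / 2) :
    ‖1 / Complex.cosh (x + y * Complex.I) - 1 / Complex.cosh x‖ ≤ 2.31 * |y| * exp (-x) := by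
  have hx : 0 ≤ x := by linarith [abs_nonneg y]
  have hc := cosh_pos x
  have hcx : ‖Complex.cosh x‖ = cosh x := by
    rw [← Complex.ofReal_cosh, Complex.norm_real, norm_of_nonneg hc.le]
  have hlow : 0.866 * cosh x ≤ ‖Complex.cosh (x + y * Complex.I)‖ := by
    refine (pow_le_pow_iff_left₀ (by positivity) (norm_nonneg _) two_ne_zero).mp ?_
    rw [norm_cosh_sq, mul_pow]
    have h1 : sin y ^ 2 ≤ (x / 2) ^ 2 :=
      (sq_le_sq.mpr abs_sin_le_abs).trans (sq_le_sq.mpr (by rwa [abs_of_nonneg (by linarith : 0 ≤ x / 2)]))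
    have h2 : x ^ 2 ≤ cosh x ^ 2 := by
      rw [cosh_sq]
      nlinarith [self_le_sinh_iff.mpr hx]
    nlinarith
  have hlow0 : 0 < ‖Complex.cosh (x + y * Complex.I)‖ := lt_of_lt_of_le (by positivity) hlow
  have hexp : 1 / 2 * exp x ≤ cosh x := by
    rw [cosh_eq]
    linarith [exp_pos (-x)]
  rw [div_sub_div _ _ (norm_pos_iff.mp hlow0) (norm_pos_iff.mp (by rwa [hcx])), one_mul, mul_one,
    norm_div, norm_mul, hcx, norm_sub_rev]
  calc _ ≤ cosh x * |y| / (0.866 * cosh x * cosh x) := by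
        gcongr
        exact norm_cosh_sub_cosh_le y x
    _ = |y| / (0.866 * cosh x) := by field_simp
    _ ≤ |y| / (0.866 * (1 / 2 * exp x)) := by gcongr
    _ = 2 / 0.866 * |y| * exp (-x) := by rw [exp_neg]; field_simp
    _ ≤ _ := by gcongr; norm_num

end Vertical

section Series

/-- Comparison of a sum with the integral of the minimum of `b` and `B / x ^ 2`. -/
lemma sum_range_le_of_min {δ b B : ℝ} (hδ : 0 < δ) (hδ1 : δ ≤ 1 / 198) (hb : 0 ≤ b) (hB : 0 ≤ B)
    {g : ℕ → ℝ} (h0 : g 0 ≤ 0) (h1 : ∀ l : ℕ, l * δ ≤ 1 → g l ≤ b * δ)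
    (h2 : ∀ l : ℕ, 0 < l → g l ≤ B / (δ * l ^ 2)) (N : ℕ) :
    ∑ l ∈ Finset.range N, g l ≤ b + 198 / 197 * B := by
  set K : ℕ := ⌊1 / δ⌋₊ with hK
  have hδ' : 198 ≤ 1 / δ := by rw [le_div_iff₀ hδ]; linarith
  have hK1 : (K : ℝ) ≤ 1 / δ := Nat.floor_le (by positivity)
  have hK2 : 1 / δ < K + 1 := Nat.lt_floor_add_one _
  have hK0 : (0 : ℝ) < K := by linarith
  have hKδ : K * δ ≤ 1 := by rwa [le_div_iff₀ hδ] at hK1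
  have hKδ' : 197 / 198 ≤ K * δ := by
    rw [div_lt_iff₀ hδ] at hK2
    linarith
  have key : ∀ N : ℕ, ∑ l ∈ Finset.range (N + 1), g l ≤
      b * δ * min (N : ℝ) K + B / δ * (1 / K - 1 / max (N : ℝ) K) := by
    intro N
    induction N with
    | zero => simpa using h0
    | succ N ih =>
      rw [Finset.sum_range_succ]
      rcases Nat.lt_or_ge N K with h | h
      · have h3 : (N : ℝ) + 1 ≤ K := by exact_mod_cast h
        have h4 := h1 (N + 1) (le_trans (by push_cast; gcongr) hKδ)
        rw [min_eq_left (by linarith), max_eq_right (by linarith)] at ih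
        push_cast
        rw [min_eq_left h3, max_eq_right h3]
        linarith
      · have h3 : (K : ℝ) ≤ N := by exact_mod_cast h
        have h4 := h2 (N + 1) N.succ_pos
        rw [min_eq_right h3, max_eq_left h3] at ih
        push_cast at h4 ⊢
        rw [min_eq_right (by linarith), max_eq_left (by linarith)]
        have h5 : B / (δ * (N + 1 : ℝ) ^ 2) ≤ B / δ * (1 / N - 1 / (N + 1)) := by
          have hN : (0 : ℝ) < N := hK0.trans_le h3
          rw [← div_div, div_eq_mul_one_div (B / δ)]
          gcongr
          rw [div_sub_div _ _ hN.ne' (by positivity), div_le_div_iff₀ (by positivity) (by positivity)]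
          nlinarith
        linarith
  have hB' : B / δ * (1 / K) ≤ 198 / 197 * B := by
    rw [div_mul_div_comm, mul_one, div_le_iff₀ (by positivity)]
    nlinarith
  cases N with
  | zero => simp only [Finset.range_zero, Finset.sum_empty]; positivity
  | succ N =>
    refine (key N).trans (add_le_add ?_ (le_trans ?_ hB'))
    · calc b * δ * min (N : ℝ) K ≤ b * δ * K := by gcongr; exact min_le_right _ _
        _ = b * (K * δ) := by ring
        _ ≤ b * 1 := by gcongr
        _ = b := mul_one b
    · gcongr
      exact sub_le_self _ (by positivity)

lemma tendsto_two_mul_atTop : Tendsto (fun N : ℕ => 2 * N) atTop atTop :=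
  tendsto_id.const_mul_atTop' two_pos

lemma norm_le_of_hasSum {f : ℕ → ℂ} {a : ℂ} (hf : HasSum f a) {K₁ K₂ : ℝ}
    (h1 : ∀ N, ∑ l ∈ Finset.range N, ‖f (2 * l)‖ ≤ K₁)
    (h2 : ∀ N, ∑ l ∈ Finset.range N, ‖f (2 * l + 1)‖ ≤ K₂) : ‖a‖ ≤ K₁ + K₂ := by
  refine le_of_tendsto (hf.tendsto_sum_nat.comp tendsto_two_mul_atTop).norm
    (Eventually.of_forall fun N => ?_)
  rw [Function.comp_apply, sum_range_two_mul]
  exact (norm_add_le _ _).trans (add_le_add ((norm_sum_le _ _).trans (h1 N))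
    ((norm_sum_le _ _).trans (h2 N)))

lemma le_of_hasSum {f : ℕ → ℝ} {a : ℝ} (hf : HasSum f a) {K₁ K₂ : ℝ} {N₀ : ℕ}
    (h1 : ∀ N, K₁ ≤ ∑ l ∈ Finset.range N, f (2 * l))
    (h2 : ∀ N, N₀ ≤ N → K₂ ≤ ∑ l ∈ Finset.range N, f (2 * l + 1)) : K₁ + K₂ ≤ a := by
  refine ge_of_tendsto (hf.tendsto_sum_nat.comp tendsto_two_mul_atTop)
    ((eventually_ge_atTop N₀).mono fun N hN => ?_)
  rw [Function.comp_apply, sum_range_two_mul]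
  exact add_le_add (h1 N) (h2 N hN)

lemma hasSum_one_add_neg_one_pow_div :
    HasSum (fun m : ℕ => (1 + (-1 : ℝ) ^ m) / (4 * (m : ℝ) ^ 2)) (π ^ 2 / 48) := by
  have h1 : HasSum (fun l : ℕ => (1 + (-1 : ℝ) ^ (2 * l)) / (4 * ((2 * l : ℕ) : ℝ) ^ 2))
      (1 / 8 * (π ^ 2 / 6)) := by
    refine (hasSum_zeta_two.mul_left (1 / 8)).congr_fun fun l => ?_
    rw [pow_mul, neg_one_sq, one_pow]
    push_cast
    rcases Nat.eq_zero_or_pos l with rfl | hl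
    · simp
    · have : (l : ℝ) ≠ 0 := by positivity
      field_simp
      norm_num
  have h2 : HasSum (fun l : ℕ => (1 + (-1 : ℝ) ^ (2 * l + 1)) / (4 * ((2 * l + 1 : ℕ) : ℝ) ^ 2)) 0 := by
    refine hasSum_zero.congr_fun fun l => ?_
    rw [pow_succ, pow_mul, neg_one_sq, one_pow]
    simp
  have h3 := HasSum.even_add_odd (f := fun m : ℕ => (1 + (-1 : ℝ) ^ m) / (4 * (m : ℝ) ^ 2)) h1 h2
  rwa [add_zero, show 1 / 8 * (π ^ 2 / 6) = π ^ 2 / 48 by ring] at h3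

end Series

section MajorArc

variable {ε : ℂ} {t η : ℝ}

/-- The terms of the logarithm with the polar part at `w = 0` removed. -/
noncomputable def regTerm (ε w : ℂ) (m : ℕ) : ℂ :=
  logTerm (ε * Complex.exp (-w)) m - ((1 + (-1) ^ m) / (4 * (m : ℝ) ^ 2) : ℝ) / w

lemma regTerm_even (hε : ε ^ 2 = 1) (w : ℂ) (l : ℕ) :
    regTerm ε w (2 * l) = 1 / (4 * l) * cschReg (2 * l * w) := by
  rw [regTerm, logTerm_mul_exp_even hε, cschReg, pow_mul, neg_one_sq, one_pow]
  generalize Complex.sinh (2 * l * w) = u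
  push_cast
  ring_nf

lemma regTerm_odd (hε : ε ^ 2 = 1) (w : ℂ) (l : ℕ) :
    regTerm ε w (2 * l + 1) = ε / (2 * (2 * l + 1) * Complex.cosh ((2 * l + 1) * w)) := by
  rw [regTerm, logTerm_mul_exp_odd hε, pow_succ, pow_mul, neg_one_sq, one_pow]
  simp

lemma norm_eq_one_of_sq (hε : ε ^ 2 = 1) : ‖ε‖ = 1 := by
  rw [← pow_eq_one_iff_of_nonneg (norm_nonneg _) two_ne_zero, ← norm_pow, hε, norm_one]

lemma norm_mul_exp_lt_one (hε : ε ^ 2 = 1) (ht : 0 < t) (η : ℝ) :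
    ‖ε * Complex.exp (-(t + η * Complex.I))‖ < 1 := by
  rw [norm_mul, norm_eq_one_of_sq hε, one_mul, Complex.norm_exp]
  simpa using ht

/-- The logarithm without its polar part at `w = 0`. -/
noncomputable def regLog (ε w : ℂ) : ℂ :=
  logGen (ε * Complex.exp (-w)) - (π ^ 2 / 48 : ℝ) / w

lemma hasSum_regTerm (hε : ε ^ 2 = 1) (ht : 0 < t) (η : ℝ) :
    HasSum (regTerm ε (t + η * Complex.I)) (regLog ε (t + η * Complex.I)) :=
  (summable_logTerm (norm_mul_exp_lt_one hε ht η)).hasSum.sub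
    ((Complex.hasSum_ofReal.mpr hasSum_one_add_neg_one_pow_div).div_const _)

lemma sum_exp_neg_odd_mul_le (ht : 0 < t) (N : ℕ) :
    ∑ l ∈ Finset.range N, exp (-((2 * l + 1) * t)) ≤ 1 / (2 * t) := by
  have key : (∑ l ∈ Finset.range N, exp (-((2 * l + 1) * t))) * (2 * sinh t) =
      1 - exp (-(2 * N * t)) := by
    induction N with
    | zero => simp
    | succ N ih =>
      rw [Finset.sum_range_succ, add_mul, ih, sinh_eq, mul_div_cancel₀ _ two_ne_zero, mul_sub,
        ← exp_add, ← exp_add]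
      push_cast
      ring_nf
  have h1 := self_le_sinh_iff.mpr ht.le
  rw [le_div_iff₀ (by positivity)]
  calc _ ≤ (∑ l ∈ Finset.range N, exp (-((2 * l + 1) * t))) * (2 * sinh t) := by gcongr
    _ ≤ 1 := by rw [key]; linarith [exp_pos (-(2 * N * t))]

/-- The regular part of the logarithm varies slowly. -/
lemma norm_regLog_sub_le (hε : ε ^ 2 = 1) (ht : 0 < t) (ht' : t ≤ 1 / 396) (hη : |η| ≤ t / 2) :
    ‖regLog ε (t + η * Complex.I) - regLog ε t‖ ≤ 1.7 * (|η| / t) := by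
  have h0 := hasSum_regTerm hε ht 0
  rw [Complex.ofReal_zero, zero_mul, add_zero] at h0
  have hη0 := abs_nonneg η
  refine (norm_le_of_hasSum ((hasSum_regTerm hε ht η).sub h0)
    (K₁ := 1.36 / 4 * (|η| / t) + 198 / 197 * (3 / 4 * (|η| / t))) (K₂ := 1.155 / 2 * (|η| / t))
    ?_ ?_).trans ?_
  · have e : ∀ l : ℕ, 0 < l → ‖regTerm ε (t + η * Complex.I) (2 * l) - regTerm ε t (2 * l)‖ =
        1 / (4 * l) * ‖cschReg ((2 * l * t : ℝ) + (2 * l * η : ℝ) * Complex.I) -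
          cschReg (2 * l * t : ℝ)‖ := by
      intro l hl
      rw [regTerm_even hε, regTerm_even hε, ← mul_sub, norm_mul, norm_div, norm_mul, norm_one,
        Complex.norm_natCast, Complex.norm_ofNat]
      push_cast
      ring_nf
    refine sum_range_le_of_min (δ := 2 * t) (by positivity) (by linarith) (by positivity)
      (by positivity) ?_ (fun l hl => ?_) fun l hl => ?_
    · simp [regTerm, logTerm_zero]
    · rcases Nat.eq_zero_or_pos l with rfl | hl0
      · simp only [regTerm, mul_zero, logTerm_zero]
        simp
        positivity
      have hl' : (0 : ℝ) < l := by exact_mod_cast hl0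
      rw [e l hl0]
      have h3 := norm_cschReg_sub_le_of_le_one (x := 2 * l * t) (2 * l * η) (by positivity)
        (by linarith) (by
          rw [abs_mul, abs_of_pos (by positivity : (0 : ℝ) < 2 * l)]
          nlinarith)
      rw [abs_mul, abs_of_pos (by positivity : (0 : ℝ) < 2 * l)] at h3
      calc _ ≤ 1 / (4 * (l : ℝ)) * (1.36 * (2 * l * |η|)) := by gcongr
        _ = _ := by field_simp
    · have hl' : (0 : ℝ) < l := by exact_mod_cast hl
      rw [e l hl]
      have h3 := norm_cschReg_sub_le (x := 2 * l * t) (2 * l * η) (by positivity)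
      rw [abs_mul, abs_of_pos (by positivity : (0 : ℝ) < 2 * l)] at h3
      calc _ ≤ 1 / (4 * (l : ℝ)) * (3 * (2 * l * |η|) / (2 * l * t) ^ 2) := by gcongr
        _ = _ := by field_simp
  · intro N
    have e : ∀ l ∈ Finset.range N,
        ‖regTerm ε (t + η * Complex.I) (2 * l + 1) - regTerm ε t (2 * l + 1)‖ ≤
        1.155 * |η| * exp (-((2 * l + 1) * t)) := by
      intro l _
      have h3 := norm_sech_sub_le (x := (2 * l + 1) * t) ((2 * l + 1) * η) (by
        rw [abs_mul, abs_of_pos (by positivity : (0 : ℝ) < 2 * l + 1)]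
        nlinarith)
      rw [abs_mul, abs_of_pos (by positivity : (0 : ℝ) < 2 * l + 1)] at h3
      have e1 : regTerm ε (t + η * Complex.I) (2 * l + 1) - regTerm ε t (2 * l + 1) =
          ε / ((2 * (2 * l + 1) : ℝ) : ℂ) *
          (1 / Complex.cosh (((2 * l + 1) * t : ℝ) + ((2 * l + 1) * η : ℝ) * Complex.I) -
            1 / Complex.cosh ((2 * l + 1) * t : ℝ)) := by
        have e2 : (2 * l + 1 : ℂ) * (t + η * Complex.I) =
            ((2 * l + 1) * t : ℝ) + ((2 * l + 1) * η : ℝ) * Complex.I := by push_cast; ring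
        have e3 : (2 * l + 1 : ℂ) * t = ((2 * l + 1) * t : ℝ) := by push_cast; ring
        rw [regTerm_odd hε, regTerm_odd hε, e2, e3, mul_sub, div_mul_div_comm, div_mul_div_comm,
          mul_one]
        push_cast
        rfl
      rw [e1, norm_mul, norm_div, norm_eq_one_of_sq hε, Complex.norm_real,
        norm_of_nonneg (by positivity)]
      calc _ ≤ 1 / (2 * (2 * l + 1) : ℝ) * (2.31 * ((2 * l + 1) * |η|) * exp (-((2 * l + 1) * t))) := by
            gcongr
        _ = _ := by field_simp; ring
    refine (Finset.sum_le_sum e).trans ?_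
    rw [← Finset.mul_sum]
    calc _ ≤ 1.155 * |η| * (1 / (2 * t)) := by gcongr; exact sum_exp_neg_odd_mul_le ht N
      _ = _ := by field_simp
  · have : 0 ≤ |η| / t := by positivity
    linarith

end MajorArc

section RealPoint

variable {t : ℝ}

lemma regTerm_even_ofReal {ε : ℂ} (hε : ε ^ 2 = 1) (t : ℝ) (l : ℕ) :
    regTerm ε t (2 * l) = ((1 / (4 * l) * (1 / sinh (2 * l * t) - 1 / (2 * l * t)) : ℝ) : ℂ) := by
  rw [regTerm_even hε, cschReg]
  push_cast
  rfl

lemma regTerm_odd_ofReal {ε : ℝ} (hε : (ε : ℂ) ^ 2 = 1) (t : ℝ) (l : ℕ) :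
    regTerm ε t (2 * l + 1) = ((ε / (2 * (2 * l + 1) * cosh ((2 * l + 1) * t)) : ℝ) : ℂ) := by
  rw [regTerm_odd hε]
  push_cast
  rfl

lemma hasSum_regTerm_ofReal {ε : ℂ} (hε : ε ^ 2 = 1) (ht : 0 < t) :
    HasSum (regTerm ε t) (regLog ε t) := by
  simpa using hasSum_regTerm hε ht 0

lemma regLog_one_im (ht : 0 < t) : (regLog 1 t).im = 0 := by
  have h := Complex.hasSum_im (hasSum_regTerm_ofReal (one_pow 2) ht)
  refine h.unique (hasSum_zero.congr_fun fun m => ?_)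
  obtain ⟨l, rfl | rfl⟩ := m.even_or_odd'
  · rw [regTerm_even_ofReal (one_pow 2), Complex.ofReal_im]
  · rw [← Complex.ofReal_one, regTerm_odd_ofReal (by simp), Complex.ofReal_im]

lemma one_le_sum_sech (ht : 0 < t) (ht' : t ≤ 1 / 396) {N : ℕ} (hN : 9 ≤ N) :
    1 ≤ ∑ l ∈ Finset.range N, 1 / (2 * (2 * l + 1) * cosh ((2 * l + 1) * t)) := by
  have h1 : ∀ l ∈ Finset.range 9, 1 / (2 * (2 * l + 1) * (1002 / 1000)) ≤
      1 / (2 * (2 * l + 1) * cosh ((2 * l + 1) * t)) := by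
    intro l hl
    have hl' : (l : ℝ) ≤ 8 := by exact_mod_cast Nat.le_of_lt_succ (Finset.mem_range.mp hl)
    have h2 : (2 * l + 1) * t ≤ 17 / 396 := by nlinarith
    have h3 := cosh_sub_one_le (x := (2 * l + 1) * t) (by positivity) (by linarith)
    have h4 : ((2 * l + 1) * t) ^ 2 ≤ (17 / 396) ^ 2 := by gcongr
    have h5 := cosh_pos ((2 * l + 1) * t)
    gcongr
    linarith
  calc (1 : ℝ) ≤ ∑ l ∈ Finset.range 9, 1 / (2 * (2 * (l : ℝ) + 1) * (1002 / 1000)) := by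
        norm_num [Finset.sum_range_succ]
    _ ≤ _ := Finset.sum_le_sum h1
    _ ≤ _ := Finset.sum_le_sum_of_subset_of_nonneg (Finset.range_mono hN) fun l _ _ => by
        have := cosh_pos ((2 * l + 1) * t)
        positivity

lemma le_re_regLog_one (ht : 0 < t) (ht' : t ≤ 1 / 396) : 7 / 10 ≤ (regLog 1 t).re := by
  have h := Complex.hasSum_re (hasSum_regTerm_ofReal (one_pow 2) ht)
  refine le_trans ?_ (le_of_hasSum h (K₁ := -(0.045 + 198 / 197 * (1 / 4))) (K₂ := 1) (N₀ := 9)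
    (fun N => ?_) fun N hN => ?_)
  · norm_num
  · rw [neg_le, ← Finset.sum_neg_distrib]
    have hpos : ∀ l : ℕ, 0 < l → (0 : ℝ) < l := fun l hl => by exact_mod_cast hl
    refine sum_range_le_of_min (N := N) (δ := 2 * t) (b := 0.045) (B := 1 / 4) (by positivity) (by linarith) (by norm_num)
      (by norm_num) ?_ (fun l hl => ?_) fun l hl => ?_
    · simp [regTerm, logTerm_zero]
    · rcases Nat.eq_zero_or_pos l with rfl | hl0
      · simp only [regTerm, mul_zero, logTerm_zero]
        simp
        positivity
      have hl' := hpos l hl0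
      have hx : 0 < 2 * l * t := by positivity
      rw [regTerm_even_ofReal (one_pow 2), Complex.ofReal_re]
      have h1 := sinh_sub_self_le (x := 2 * l * t) hx.le (by linarith)
      have h2 := self_le_sinh_iff.mpr hx.le
      have h3 : 1 / (2 * l * t) - 1 / sinh (2 * l * t) ≤ 9 / 50 * (2 * l * t) := by
        rw [div_sub_div _ _ hx.ne' (hx.trans_le h2).ne', div_le_iff₀ (by positivity)]
        have := mul_le_mul_of_nonneg_left h2 (by positivity : 0 ≤ 9 / 50 * (2 * l * t) ^ 2)
        linarith
      calc _ = 1 / (4 * l) * (1 / (2 * l * t) - 1 / sinh (2 * l * t)) := by ring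
        _ ≤ 1 / (4 * l) * (9 / 50 * (2 * l * t)) := by gcongr
        _ = _ := by field_simp; norm_num
    · have hl' := hpos l hl
      have hx : 0 < 2 * l * t := by positivity
      rw [regTerm_even_ofReal (one_pow 2), Complex.ofReal_re]
      have h2 : 0 < sinh (2 * l * t) := sinh_pos_iff.mpr hx
      calc _ = 1 / (4 * l) * (1 / (2 * l * t) - 1 / sinh (2 * l * t)) := by ring
        _ ≤ 1 / (4 * l) * (1 / (2 * l * t)) := by
            gcongr
            exact sub_le_self _ (by positivity)
        _ = _ := by field_simp
  · refine (one_le_sum_sech ht ht' hN).trans (le_of_eq (Finset.sum_congr rfl fun l _ => ?_))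
    rw [← Complex.ofReal_one, regTerm_odd_ofReal (by simp), Complex.ofReal_re]

lemma re_regLog_neg_one_le (ht : 0 < t) (ht' : t ≤ 1 / 396) :
    (regLog (-1) t).re ≤ (regLog 1 t).re - 2 := by
  have h1 : (-1 : ℂ) ^ 2 = 1 := by norm_num
  have h := (Complex.hasSum_re (hasSum_regTerm_ofReal (one_pow 2) ht)).sub
    (Complex.hasSum_re (hasSum_regTerm_ofReal h1 ht))
  have h2 := le_of_hasSum h (K₁ := 0) (K₂ := 2 * 1) (N₀ := 9) (fun N => ?_) fun N hN => ?_
  · linarith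
  · refine Finset.sum_nonneg fun l _ => ?_
    rw [regTerm_even_ofReal (one_pow 2), regTerm_even_ofReal h1, sub_self]
  · refine (mul_le_mul_of_nonneg_left (one_le_sum_sech ht ht' hN) two_pos.le).trans (le_of_eq ?_)
    rw [Finset.mul_sum]
    refine Finset.sum_congr rfl fun l _ => ?_
    have h3 : (regTerm 1 t (2 * l + 1)).re = 1 / (2 * (2 * l + 1) * cosh ((2 * l + 1) * t)) := by
      rw [← Complex.ofReal_one, regTerm_odd_ofReal (by simp), Complex.ofReal_re]
    have h4 : (regTerm (-1) t (2 * l + 1)).re =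
        -1 / (2 * (2 * l + 1) * cosh ((2 * l + 1) * t)) := by
      rw [show (-1 : ℂ) = ((-1 : ℝ) : ℂ) by simp, regTerm_odd_ofReal (by simp), Complex.ofReal_re]
    rw [h3, h4]
    ring

end RealPoint

section Saddle

variable {t : ℝ} {n : ℕ}

lemma re_div_add_mul_I (c t η : ℝ) : ((c : ℂ) / (t + η * Complex.I)).re = c * t / (t ^ 2 + η ^ 2) := by
  rw [Complex.div_re]
  simp [Complex.normSq_apply]
  ring

lemma im_div_add_mul_I (c t η : ℝ) :
    ((c : ℂ) / (t + η * Complex.I)).im = -(c * η / (t ^ 2 + η ^ 2)) := by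
  rw [Complex.div_im]
  simp [Complex.normSq_apply]
  ring

lemma le_sqrt_div (ht' : 396.9 ≤ 1 / t) : 9.03 ≤ √(π ^ 2 / 48 / t) := by
  refine le_sqrt_of_sq_le ?_
  have hp : 9.869 < π ^ 2 := by nlinarith [pi_gt_d6]
  rw [div_eq_mul_one_div _ t]
  nlinarith

lemma div_le_scaled (ht : 0 < t) (ht' : 396.9 ≤ 1 / t) {s θ : ℝ} (hθ0 : 0 ≤ θ)
    (hs : s = √(π ^ 2 / 48 / t) / t * θ) : θ / t ≤ 0.111 * s := by
  have hY := le_sqrt_div ht'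
  have : 0 ≤ θ / t := by positivity
  rw [hs, div_mul_eq_mul_div, mul_div_assoc]
  nlinarith

/-- The size of the main exponential in the variable `s = θ √(c / t) / t`, where `c = π ^ 2 / 48`. -/
lemma exists_decay (ht : 0 < t) {s θ : ℝ} (hθ0 : 0 ≤ θ) (hθ : θ ≤ t / 2)
    (hs : s = √(π ^ 2 / 48 / t) / t * θ) :
    ∃ q, 4 / 5 * s ^ 2 ≤ q ∧ q ≤ s ^ 2 ∧
      π ^ 2 / 48 * t / (t ^ 2 + θ ^ 2) = π ^ 2 / 48 / t - q ∧
      π ^ 2 / 48 * θ / (t ^ 2 + θ ^ 2) - π ^ 2 / 48 / t ^ 2 * θ = -(q * (θ / t)) := by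
  have hs2 : s ^ 2 = π ^ 2 / 48 * θ ^ 2 / t ^ 3 := by
    rw [hs, mul_pow, div_pow, sq_sqrt (by positivity)]
    field_simp
  refine ⟨π ^ 2 / 48 * θ ^ 2 / (t * (t ^ 2 + θ ^ 2)), ?_, ?_, ?_, ?_⟩
  · rw [hs2, ← mul_div_assoc, div_le_div_iff₀ (by positivity) (by positivity)]
    have : 0 ≤ t ^ 2 - 4 * θ ^ 2 := by nlinarith
    have h2 : 0 ≤ π ^ 2 / 48 * θ ^ 2 * t * (t ^ 2 - 4 * θ ^ 2) := by positivity
    nlinarith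
  · rw [hs2]
    gcongr
    nlinarith [mul_nonneg ht.le (sq_nonneg θ)]
  · field_simp
    ring
  · field_simp
    ring

lemma integrand_near_one (ht : 0 < t) (ht' : 396.9 ≤ 1 / t) (hn : n * t ^ 2 = π ^ 2 / 48)
    {s θ : ℝ} (hθ0 : 0 ≤ θ) (hθ : θ ≤ t / 2) (hs : s = √(π ^ 2 / 48 / t) / t * θ) :
    ∃ u q φ, |u| ≤ 0.19 * s ∧ 4 / 5 * s ^ 2 ≤ q ∧ q ≤ s ^ 2 ∧ |φ| ≤ 0.19 * s + 0.111 * s ^ 3 ∧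
      integrand t n θ =
        exp (π ^ 2 / 48 / t + (regLog 1 t).re) * (exp (u - q) * cos φ) := by
  obtain ⟨q, hq1, hq2, hq3, hq4⟩ := exists_decay ht hθ0 hθ hs
  have hls := div_le_scaled ht ht' hθ0 hs
  have hs0 : 0 ≤ s := by rw [hs]; positivity
  have hl0 : 0 ≤ θ / t := by positivity
  have ht1 : t ≤ 1 / 396 := by
    rw [le_div_iff₀ ht] at ht'
    linarith
  have hD := norm_regLog_sub_le (one_pow 2) ht ht1 (η := -θ) (by rwa [abs_neg, abs_of_nonneg hθ0])
  rw [abs_neg, abs_of_nonneg hθ0] at hD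
  set w : ℂ := t + (-θ : ℝ) * Complex.I with hw
  set D := regLog 1 w - regLog 1 t with hDdef
  have hu := (Complex.abs_re_le_norm D).trans hD
  have hv := (Complex.abs_im_le_norm D).trans hD
  refine ⟨D.re, q, D.im - q * (θ / t), by linarith, hq1, hq2, ?_, ?_⟩
  · have h1 : q * (θ / t) ≤ s ^ 2 * (0.111 * s) := by gcongr
    have h2 : 0 ≤ q * (θ / t) := mul_nonneg ((by positivity : 0 ≤ 4 / 5 * s ^ 2).trans hq1) hl0
    rw [abs_le] at hv ⊢
    constructor <;> nlinarith
  · have hn' : (n : ℝ) = π ^ 2 / 48 / t ^ 2 := by rw [← hn]; field_simp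
    have hL : logGen (Complex.exp (-t + θ * Complex.I)) =
        D + regLog 1 t + (π ^ 2 / 48 : ℝ) / w := by
      rw [hDdef, sub_add_cancel, regLog, exp_eq_one_mul_exp, sub_add_cancel]
    have hg : gen (Complex.exp (-t + θ * Complex.I)) * Complex.exp (-(n * θ * Complex.I)) =
        Complex.exp (D + regLog 1 t + (π ^ 2 / 48 : ℝ) / w + -(n * θ * Complex.I)) := by
      rw [Complex.exp_add _ (-(n * θ * Complex.I)), ← hL]
      rfl
    have him : (D + regLog 1 t + (π ^ 2 / 48 : ℝ) / w + -(n * θ * Complex.I)).im =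
        D.im - q * (θ / t) := by
      have h1 : (-(n * θ * Complex.I)).im = -(n * θ) := by simp
      rw [Complex.add_im, Complex.add_im, Complex.add_im, regLog_one_im ht, hw, im_div_add_mul_I,
        h1, hn', neg_sq, mul_neg, neg_div, neg_neg]
      linarith
    have hre : (D + regLog 1 t + (π ^ 2 / 48 : ℝ) / w + -(n * θ * Complex.I)).re =
        π ^ 2 / 48 / t + (regLog 1 t).re + (D.re - q) := by
      have h1 : (-(n * θ * Complex.I)).re = 0 := by simp
      rw [Complex.add_re, Complex.add_re, Complex.add_re, hw, re_div_add_mul_I, h1, neg_sq, hq3]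
      ring
    rw [integrand, hg, Complex.exp_re, him, hre, exp_add, mul_assoc]

lemma abs_integrand_near_neg_one (ht : 0 < t) (ht' : 396.9 ≤ 1 / t) {s θ : ℝ}
    (hθ0 : 0 ≤ θ) (hθ : θ ≤ t / 2) (hs : s = √(π ^ 2 / 48 / t) / t * θ) :
    |integrand t n (π - θ)| ≤
      exp (π ^ 2 / 48 / t + (regLog 1 t).re) * exp (-2 + 0.19 * s - 4 / 5 * s ^ 2) := by
  obtain ⟨q, hq1, -, hq3, -⟩ := exists_decay ht hθ0 hθ hs
  have hls := div_le_scaled ht ht' hθ0 hs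
  have ht1 : t ≤ 1 / 396 := by
    rw [le_div_iff₀ ht] at ht'
    linarith
  have hD := norm_regLog_sub_le (ε := -1) (by norm_num) ht ht1 (η := θ)
    (by rwa [abs_of_nonneg hθ0])
  rw [abs_of_nonneg hθ0] at hD
  have hu := (le_abs_self _).trans ((Complex.abs_re_le_norm _).trans hD)
  rw [Complex.sub_re] at hu
  refine (abs_integrand_le t n (π - θ)).trans ?_
  rw [norm_gen, ← exp_add, exp_le_exp, exp_eq_neg_one_mul_exp, sub_sub_cancel]
  have h1 := re_regLog_neg_one_le ht ht1
  have h2 : logGen (-1 * Complex.exp (-(t + θ * Complex.I))) =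
      regLog (-1) (t + θ * Complex.I) + (π ^ 2 / 48 : ℝ) / (t + θ * Complex.I) := by
    rw [regLog, sub_add_cancel]
  have hs0 : 0 ≤ s := by rw [hs]; positivity
  rw [h2, Complex.add_re, re_div_add_mul_I, hq3]
  linarith

end Saddle

section Integral

lemma sub_le_integral {f F F' : ℝ → ℝ} {a b : ℝ} (hab : a ≤ b) (hf : Continuous f)
    (hF : ∀ x, HasDerivAt F (F' x) x) (h : ∀ x, a ≤ x → x ≤ b → F' x ≤ f x) :
    F b - F a ≤ ∫ x in a..b, f x :=
  intervalIntegral.sub_le_integral_of_hasDeriv_right_of_le hab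
    (fun x _ => (hF x).continuousAt.continuousWithinAt) (fun x _ => (hF x).hasDerivWithinAt)
    (hf.integrableOn_Icc) fun x hx => h x hx.1.le hx.2.le

lemma neg_mul_sub_le_integral {f : ℝ → ℝ} {a b C : ℝ} (hab : a ≤ b) (hf : Continuous f)
    (h : ∀ x, a ≤ x → x ≤ b → |f x| ≤ C) : -(C * (b - a)) ≤ ∫ x in a..b, f x := by
  have := sub_le_integral (F := fun x => -C * x) (F' := fun _ => -C) hab hf
    (fun x => by simpa using (hasDerivAt_id x).const_mul (-C))
    fun x ha hb => neg_le_of_abs_le (h x ha hb)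
  linarith

variable {t : ℝ} {n : ℕ}

lemma hasDerivAt_exp_mul (c k x : ℝ) (hk : k ≠ 0) :
    HasDerivAt (fun x => c * exp (-(k * x)) / k) (-(c * exp (-(k * x)))) x := by
  have h := (((((hasDerivAt_id x).const_mul k).neg).exp).const_mul c).div_const k
  refine h.congr_deriv ?_
  simp
  field_simp

/-- The contribution of a neighbourhood of `q = 1`. -/
lemma le_integral_near_one (ht : 0 < t) (ht' : 396.9 ≤ 1 / t) (hn : n * t ^ 2 = π ^ 2 / 48) :
    exp (π ^ 2 / 48 / t + (regLog 1 t).re) * (0.5608 - exp (-2.82) / 1.41) /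
      (√(π ^ 2 / 48 / t) / t) ≤ ∫ θ in 0..t / 2, integrand t n θ := by
  have hY := le_sqrt_div ht'
  set A := exp (π ^ 2 / 48 / t + (regLog 1 t).re) with hA
  have hA0 : 0 < A := exp_pos _
  set k := √(π ^ 2 / 48 / t) / t with hk
  have hk0 : 0 < k := by positivity
  have hkt : 2 / k ≤ t / 2 := by
    rw [hk, div_div_eq_mul_div, div_le_div_iff₀ (by positivity) two_pos]
    nlinarith
  have hk9 : 0.9 / k ≤ 2 / k := by gcongr; norm_num
  have hkpos : 0 ≤ 0.9 / k := by positivity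
  have hcont := continuous_integrand ht n
  have h1 : A * 0.967 * (0.58 / k) ≤ ∫ θ in 0..0.9 / k, integrand t n θ := by
    refine le_trans (le_of_sub_nonneg ?_) (sub_le_integral
      (F := fun θ => A * 0.967 * (θ - k ^ 2 * θ ^ 3 / 3 - 0.095 * k * θ ^ 2))
      (F' := fun θ => A * 0.967 * (1 - (k * θ) ^ 2 - 0.19 * (k * θ))) hkpos hcont
      (fun x => ?_) fun θ h0 h9 => ?_)
    · have : A * 0.967 * (0.9 / k - k ^ 2 * (0.9 / k) ^ 3 / 3 - 0.095 * k * (0.9 / k) ^ 2) -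
          A * 0.967 * (0 - k ^ 2 * 0 ^ 3 / 3 - 0.095 * k * 0 ^ 2) - A * 0.967 * (0.58 / k) =
          A * 0.967 * (0.00005 / k) := by
        field_simp
        norm_num
      rw [this]
      positivity
    · have h := ((((hasDerivAt_id x)).sub (((hasDerivAt_pow 3 x).const_mul (k ^ 2)).div_const 3)).sub
        ((hasDerivAt_pow 2 x).const_mul (0.095 * k))).const_mul (A * 0.967)
      refine h.congr_deriv ?_
      simp only [Nat.cast_ofNat, Nat.reduceSub, pow_one]
      ring
    · rw [le_div_iff₀ hk0] at h9
      obtain ⟨u, q, φ, hu, -, hq, hφ, h⟩ :=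
        integrand_near_one (s := k * θ) ht ht' hn h0 (by
          refine le_trans ?_ (hk9.trans hkt)
          rwa [le_div_iff₀ hk0]) rfl
      have hs0 : 0 ≤ k * θ := by positivity
      have hs9 : k * θ ≤ 0.9 := by linarith
      generalize k * θ = s at *
      have hs3 : s ^ 3 ≤ 0.9 ^ 3 := by gcongr
      have hφ' : |φ| ≤ 0.252 := by norm_num at hs3; linarith
      have hcos : 0.967 ≤ cos φ := by
        have h2 := one_sub_sq_div_two_le_cos (x := φ)
        have h3 : φ ^ 2 ≤ 0.252 ^ 2 := sq_le_sq' (neg_le_of_abs_le hφ') (le_of_abs_le hφ')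
        norm_num at h3
        linarith
      have hexp : 1 - s ^ 2 - 0.19 * s ≤ exp (u - q) := by
        have := add_one_le_exp (u - q)
        have := neg_le_of_abs_le hu
        linarith
      rw [h, mul_assoc]
      refine mul_le_mul_of_nonneg_left ?_ hA0.le
      have h5 := exp_pos (u - q)
      nlinarith
  have h2 : 0 ≤ ∫ θ in 0.9 / k..2 / k, integrand t n θ := by
    refine intervalIntegral.integral_nonneg hk9 fun θ hθ => ?_
    have h0 : 0 ≤ θ := hkpos.trans hθ.1
    have h9 := hθ.2
    obtain ⟨u, q, φ, -, -, -, hφ, h⟩ :=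
      integrand_near_one (s := k * θ) ht ht' hn h0 (h9.trans hkt) rfl
    rw [le_div_iff₀ hk0] at h9
    have hs0 : 0 ≤ k * θ := by positivity
    have hs3 : (k * θ) ^ 3 ≤ 2 ^ 3 := by gcongr; linarith
    have hcos : 0 ≤ cos φ := by
      rw [← cos_abs]
      refine cos_nonneg_of_neg_pi_div_two_le_of_le ?_ ?_
      · linarith [abs_nonneg φ, pi_pos]
      · linarith [pi_gt_three]
    rw [h]
    positivity
  have h3 : -(A * exp (-2.82) / (1.41 * k)) ≤ ∫ θ in 2 / k..t / 2, integrand t n θ := by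
    refine le_trans ?_ (sub_le_integral (F := fun θ => A * exp (-(1.41 * k * θ)) / (1.41 * k))
      (F' := fun θ => -(A * exp (-(1.41 * k * θ)))) hkt hcont
      (fun x => hasDerivAt_exp_mul A _ x (by positivity)) fun θ h2 ht2 => ?_)
    · have h4 : 1.41 * k * (2 / k) = 2.82 := by field_simp; norm_num
      have h5 : 0 ≤ A * exp (-(1.41 * k * (t / 2))) / (1.41 * k) := by positivity
      simp only [h4]
      linarith
    · have h0 : 0 ≤ θ := le_trans (by positivity) h2
      obtain ⟨u, q, φ, hu, hq, -, -, h⟩ :=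
        integrand_near_one (s := k * θ) ht ht' hn h0 ht2 rfl
      rw [div_le_iff₀ hk0] at h2
      have h4 : exp (u - q) ≤ exp (-(1.41 * k * θ)) := by
        rw [exp_le_exp, mul_assoc]
        have := le_of_abs_le hu
        nlinarith
      rw [h, ← mul_neg]
      gcongr
      have h5 := neg_one_le_cos φ
      have h6 := exp_pos (u - q)
      nlinarith
  rw [← intervalIntegral.integral_add_adjacent_intervals (b := 0.9 / k)
    (hcont.intervalIntegrable _ _) (hcont.intervalIntegrable _ _),
    ← intervalIntegral.integral_add_adjacent_intervals (a := 0.9 / k) (b := 2 / k)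
    (hcont.intervalIntegrable _ _) (hcont.intervalIntegrable _ _)]
  have h4 : A * (0.5608 - exp (-2.82) / 1.41) / k + A * 0.00006 / k =
      A * 0.967 * (0.58 / k) - A * exp (-2.82) / (1.41 * k) := by
    field_simp
    ring
  have h5 : 0 ≤ A * 0.00006 / k := by positivity
  linarith

/-- The contribution of a neighbourhood of `q = -1`. -/
lemma le_integral_near_neg_one (ht : 0 < t) (ht' : 396.9 ≤ 1 / t) :
    -(exp (π ^ 2 / 48 / t + (regLog 1 t).re) * (exp (-1.2) / 1.41) / (√(π ^ 2 / 48 / t) / t)) ≤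
      ∫ θ in π - t / 2..π, integrand t n θ := by
  have hY := le_sqrt_div ht'
  set A := exp (π ^ 2 / 48 / t + (regLog 1 t).re) with hA
  have hA0 : 0 < A := exp_pos _
  set k := √(π ^ 2 / 48 / t) / t with hk
  have hk0 : 0 < k := by positivity
  have hcont : Continuous fun θ => integrand t n (π - θ) :=
    (continuous_integrand ht n).comp (continuous_sub_left π)
  have h1 := intervalIntegral.integral_comp_sub_left (a := 0) (b := t / 2) (integrand t n) π
  rw [sub_zero] at h1
  rw [← h1]
  refine le_trans ?_ (sub_le_integral
    (F := fun θ => A * exp (-1.2) * exp (-(1.41 * k * θ)) / (1.41 * k))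
    (F' := fun θ => -(A * exp (-1.2) * exp (-(1.41 * k * θ)))) (by positivity) hcont
    (fun x => hasDerivAt_exp_mul _ _ x (by positivity)) fun θ h0 ht2 => ?_)
  · have h5 : 0 ≤ A * exp (-1.2) * exp (-(1.41 * k * (t / 2))) / (1.41 * k) := by positivity
    have h6 : A * (exp (-1.2) / 1.41) / k = A * exp (-1.2) / (1.41 * k) := by field_simp
    simp only [mul_zero, neg_zero, exp_zero, mul_one]
    linarith
  · refine neg_le_of_abs_le ((abs_integrand_near_neg_one (s := k * θ) ht ht' h0 ht2 rfl).trans ?_)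
    rw [mul_assoc A, ← exp_add (-1.2)]
    refine mul_le_mul_of_nonneg_left (exp_le_exp.mpr ?_) hA0.le
    nlinarith [sq_nonneg (k * θ - 1)]

/-- The contribution of a neighbourhood of `q = I` and of the remaining arcs. -/
lemma le_integral_middle (ht : 0 < t) (ht' : t ≤ 1 / 396) :
    -(1 / 33 * exp (239 / 1250 * (1 / t) + 1 / 8) + π * exp (69 / 400 * (1 / t) + 3 / 2)) ≤
      ∫ θ in t / 2..π - t / 2, integrand t n θ := by
  have hcont := continuous_integrand ht n
  have hp := pi_gt_three
  have hle : ∀ θ : ℝ, |integrand t n θ| ≤ exp (logGen (Complex.exp (-t + θ * Complex.I))).re :=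
    fun θ => (abs_integrand_le t n θ).trans (norm_gen _).le
  have h1 := neg_mul_sub_le_integral (a := t / 2) (b := π / 2 - 1 / 66) (by linarith) hcont
    fun θ h1 h2 => (hle θ).trans (exp_le_exp.mpr (re_logGen_minor ht ht' h1 (by linarith) (by
      rw [le_abs]; left; linarith)))
  have h2 := neg_mul_sub_le_integral (a := π / 2 - 1 / 66) (b := π / 2 + 1 / 66) (by linarith) hcont
    fun θ h1 h2 => (hle θ).trans (exp_le_exp.mpr (re_logGen_near_I ht ht' (by
      rw [abs_le]; constructor <;> linarith)))
  have h3 := neg_mul_sub_le_integral (a := π / 2 + 1 / 66) (b := π - t / 2) (by linarith) hcont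
    fun θ h1 h2 => (hle θ).trans (exp_le_exp.mpr (re_logGen_minor ht ht' (by linarith) h2 (by
      rw [le_abs]; right; linarith)))
  rw [← intervalIntegral.integral_add_adjacent_intervals (b := π / 2 - 1 / 66)
    (hcont.intervalIntegrable _ _) (hcont.intervalIntegrable _ _),
    ← intervalIntegral.integral_add_adjacent_intervals (a := π / 2 - 1 / 66) (b := π / 2 + 1 / 66)
    (hcont.intervalIntegrable _ _) (hcont.intervalIntegrable _ _)]
  have h4 := exp_pos (69 / 400 * (1 / t) + 3 / 2)
  nlinarith

end Integral

section Conclusion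

lemma sq_le_mul_exp {τ₀ g E τ : ℝ} (hτ₀ : 0 < τ₀) (hg : 2 ≤ g * τ₀) (hτ : τ₀ ≤ τ)
    (hE : E ≤ exp (g * τ₀)) (hE0 : 0 < E) : τ ^ 2 ≤ τ₀ ^ 2 / E * exp (g * τ) := by
  have h1 : exp (g * τ) = exp (g * τ₀) * exp (g * τ₀ * (τ / τ₀ - 1)) := by
    rw [← exp_add]
    congr 1
    field_simp
    ring
  have hy : 0 ≤ τ / τ₀ - 1 := by
    rw [sub_nonneg, one_le_div hτ₀]
    exact hτ
  have h2 : (τ / τ₀) ^ 2 ≤ exp (g * τ₀ * (τ / τ₀ - 1)) := by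
    calc (τ / τ₀) ^ 2 ≤ exp (τ / τ₀ - 1) ^ 2 := by
          refine pow_le_pow_left₀ (by linarith) ?_ 2
          linarith [add_one_le_exp (τ / τ₀ - 1)]
      _ = exp (2 * (τ / τ₀ - 1)) := by rw [← exp_nat_mul]; norm_num
      _ ≤ _ := by gcongr
  calc τ ^ 2 = τ₀ ^ 2 / E * (E * (τ / τ₀) ^ 2) := by field_simp
    _ ≤ τ₀ ^ 2 / E * (exp (g * τ₀) * exp (g * τ₀ * (τ / τ₀ - 1))) := by gcongr
    _ = _ := by rw [h1]

lemma minor_lt_major {τ : ℝ} (hτ : 396.9 ≤ τ) :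
    1 / 33 * exp (239 / 1250 * τ + 1 / 8) + π * exp (69 / 400 * τ + 3 / 2) ≤
      26 / τ ^ 2 * exp (0.2056 * τ) := by
  have hexp1 := exp_one_gt_d9
  have hexp1' := exp_one_lt_d9
  have hτ0 : 0 < τ := by linarith
  have h1 : τ ^ 2 ≤ 396.9 ^ 2 / 296 * exp (0.0144 * τ) := by
    refine sq_le_mul_exp (by norm_num) (by norm_num) hτ ?_ (by norm_num)
    calc (296 : ℝ) ≤ 2.718 ^ 5 * (0.7 + 1 + 0.7 ^ 2 / 2 + 0.7 ^ 3 / 6) := by norm_num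
      _ ≤ exp 1 ^ 5 * exp 0.7 := by
          gcongr
          · linarith
          · have := sum_le_exp_of_nonneg (x := 0.7) (by norm_num) 4
            norm_num [Finset.sum_range_succ, Nat.factorial] at this ⊢
            linarith
      _ = exp 5.7 := by rw [← exp_nat_mul, ← exp_add]; norm_num
      _ ≤ _ := by rw [exp_le_exp]; norm_num
  have h2 : τ ^ 2 ≤ 396.9 ^ 2 / 400000 * exp (0.0331 * τ) := by
    refine sq_le_mul_exp (by norm_num) (by norm_num) hτ ?_ (by norm_num)
    calc (400000 : ℝ) ≤ 2.718 ^ 13 := by norm_num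
      _ ≤ exp 1 ^ 13 := by gcongr; linarith
      _ = exp 13 := by rw [← exp_nat_mul]; norm_num
      _ ≤ _ := by rw [exp_le_exp]; norm_num
  have h3 : exp (1 / 8) ≤ 1.15 := by
    have : exp (1 / 8) ^ 8 ≤ 1.15 ^ 8 := by
      rw [← exp_nat_mul]
      norm_num at hexp1' ⊢
      linarith
    exact le_of_pow_le_pow_left₀ (by norm_num) (by norm_num) this
  have h4 : exp (3 / 2) ≤ 4.5 := by
    have : exp (3 / 2) ^ 2 ≤ 4.5 ^ 2 := by
      calc exp (3 / 2) ^ 2 = exp 1 ^ 3 := by rw [← exp_nat_mul, ← exp_nat_mul]; norm_num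
        _ ≤ 2.7183 ^ 3 := by gcongr; linarith
        _ ≤ _ := by norm_num
    exact le_of_pow_le_pow_left₀ (by norm_num) (by norm_num) this
  have e1 : exp (0.2056 * τ) = exp (239 / 1250 * τ) * exp (0.0144 * τ) := by
    rw [← exp_add]; ring_nf
  have e2 : exp (0.2056 * τ) = exp (69 / 400 * τ) * exp (0.0331 * τ) := by
    rw [← exp_add]; ring_nf
  have h5 : exp (239 / 1250 * τ) ≤ 396.9 ^ 2 / 296 * exp (0.2056 * τ) / τ ^ 2 := by
    rw [le_div_iff₀ (by positivity), e1]
    calc _ ≤ exp (239 / 1250 * τ) * (396.9 ^ 2 / 296 * exp (0.0144 * τ)) := by gcongr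
      _ = _ := by ring
  have h6 : exp (69 / 400 * τ) ≤ 396.9 ^ 2 / 400000 * exp (0.2056 * τ) / τ ^ 2 := by
    rw [le_div_iff₀ (by positivity), e2]
    calc _ ≤ exp (69 / 400 * τ) * (396.9 ^ 2 / 400000 * exp (0.0331 * τ)) := by gcongr
      _ = _ := by ring
  rw [exp_add, exp_add]
  calc _ ≤ 1 / 33 * (396.9 ^ 2 / 296 * exp (0.2056 * τ) / τ ^ 2 * 1.15) +
        3.15 * (396.9 ^ 2 / 400000 * exp (0.2056 * τ) / τ ^ 2 * 4.5) := by
        gcongr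
        exact pi_lt_d2.le
    _ = (1 / 33 * (396.9 ^ 2 / 296 * 1.15) + 3.15 * (396.9 ^ 2 / 400000 * 4.5)) / τ ^ 2 *
        exp (0.2056 * τ) := by ring
    _ ≤ _ := by gcongr; norm_num

lemma integral_integrand_nonneg {t : ℝ} {n : ℕ} (ht : 0 < t) (ht' : 396.9 ≤ 1 / t)
    (hn : n * t ^ 2 = π ^ 2 / 48) : 0 ≤ ∫ θ in 0..π, integrand t n θ := by
  have hcont := continuous_integrand ht n
  have ht1 : t ≤ 1 / 396 := by
    rw [le_div_iff₀ ht] at ht'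
    linarith
  have h1 := le_integral_near_one ht ht' hn
  have h2 := le_integral_near_neg_one (n := n) ht ht'
  have h3 := le_integral_middle (n := n) ht ht1
  have h4 := minor_lt_major ht'
  have hR := le_re_regLog_one ht ht1
  have hp : 9.869 < π ^ 2 := by nlinarith [pi_gt_d6]
  have hp' : π ^ 2 < 9.8697 := by nlinarith [pi_lt_d6, pi_pos]
  have e1 : exp (-1.2) ≤ 0.303 := by
    have := sum_le_exp_of_nonneg (x := 1.2) (by norm_num) 6
    norm_num [Finset.sum_range_succ, Nat.factorial] at this
    rw [exp_neg, inv_le_comm₀ (exp_pos _) (by norm_num)]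
    norm_num at this ⊢
    linarith
  have e2 : exp (-2.82) ≤ 0.061 := by
    have := sum_le_exp_of_nonneg (x := 1.41) (by norm_num) 6
    norm_num [Finset.sum_range_succ, Nat.factorial] at this
    rw [exp_neg, inv_le_comm₀ (exp_pos _) (by norm_num),
      show (2.82 : ℝ) = (2 : ℕ) * 1.41 by norm_num, exp_nat_mul]
    refine le_trans ?_ (pow_le_pow_left₀ (by norm_num) (show 4.07 ≤ exp 1.41 from ?_) 2)
    · norm_num
    · norm_num at this ⊢
      linarith
  have e3 : 2 ≤ exp 0.7 := by
    have := sum_le_exp_of_nonneg (x := 0.7) (by norm_num) 4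
    norm_num [Finset.sum_range_succ, Nat.factorial] at this ⊢
    linarith
  have hA : 2 * exp (0.2056 * (1 / t)) ≤ exp (π ^ 2 / 48 / t + (regLog 1 t).re) := by
    rw [exp_add, mul_comm (exp _) (exp _)]
    gcongr ?_ * exp ?_
    · exact e3.trans (exp_le_exp.mpr (by linarith))
    · rw [div_eq_mul_one_div (π ^ 2 / 48) t]
      gcongr
      linarith
  have hk : √(π ^ 2 / 48 / t) / t ≤ (1 / t) ^ 2 / 43.89 := by
    have : √(π ^ 2 / 48 / t) ≤ 1 / t / 43.89 := by
      refine sqrt_le_iff.mpr ⟨by positivity, ?_⟩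
      rw [div_eq_mul_one_div (π ^ 2 / 48) t, div_pow]
      have : 0 < 1 / t := by positivity
      calc π ^ 2 / 48 * (1 / t) ≤ 396.9 / 43.89 ^ 2 * (1 / t) := by
            refine mul_le_mul_of_nonneg_right ?_ this.le
            norm_num at hp' ⊢
            linarith
        _ ≤ 1 / t / 43.89 ^ 2 * (1 / t) := by gcongr
        _ = _ := by ring
    calc _ ≤ 1 / t / 43.89 / t := by gcongr
      _ = _ := by field_simp
  have hmain : 26 / (1 / t) ^ 2 * exp (0.2056 * (1 / t)) ≤
      exp (π ^ 2 / 48 / t + (regLog 1 t).re) *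
        (0.5608 - exp (-2.82) / 1.41 - exp (-1.2) / 1.41) / (√(π ^ 2 / 48 / t) / t) := by
    calc _ = 26 / 43.89 * exp (0.2056 * (1 / t)) / ((1 / t) ^ 2 / 43.89) := by field_simp
      _ ≤ 2 * exp (0.2056 * (1 / t)) * 0.3025 / ((1 / t) ^ 2 / 43.89) := by
          gcongr ?_ / _
          linarith [exp_pos (0.2056 * (1 / t))]
      _ ≤ exp (π ^ 2 / 48 / t + (regLog 1 t).re) * 0.3025 / ((1 / t) ^ 2 / 43.89) := by gcongr
      _ ≤ exp (π ^ 2 / 48 / t + (regLog 1 t).re) * 0.3025 / (√(π ^ 2 / 48 / t) / t) := by gcongr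
      _ ≤ _ := by
          gcongr
          norm_num at e1 e2 ⊢
          linarith
  rw [← intervalIntegral.integral_add_adjacent_intervals (b := t / 2)
    (hcont.intervalIntegrable _ _) (hcont.intervalIntegrable _ _),
    ← intervalIntegral.integral_add_adjacent_intervals (a := t / 2) (b := π - t / 2)
    (hcont.intervalIntegrable _ _) (hcont.intervalIntegrable _ _)]
  rw [mul_sub, sub_div] at hmain
  linarith

theorem coeff_nonneg {a : ℕ → ℝ}
    (ha : ∀ q : ℂ, ‖q‖ < 1 → HasSum (fun n : ℕ => (a n : ℂ) * q ^ n) (gen q)) (n : ℕ) :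
    0 ≤ a n := by
  rcases Nat.lt_or_ge n 32400 with hn | hn
  · exact coeff_nonneg_of_lt ha n hn
  have hn' : (32400 : ℝ) ≤ n := by exact_mod_cast hn
  have hn0 : (0 : ℝ) < n := by linarith
  set t := √(π ^ 2 / 48 / n) with ht
  have ht0 : 0 < t := by positivity
  have ht2 : t ^ 2 = π ^ 2 / 48 / n := sq_sqrt (by positivity)
  have ht' : 396.9 ≤ 1 / t := by
    rw [le_div_iff₀ ht0, ← le_div_iff₀' (by norm_num)]
    refine sqrt_le_iff.mpr ⟨by norm_num, ?_⟩
    rw [div_le_iff₀ hn0]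
    have hp' : π ^ 2 < 9.8697 := by nlinarith [pi_lt_d6, pi_pos]
    norm_num
    linarith
  have h := integral_integrand_nonneg ht0 ht' (by rw [ht2]; field_simp)
  rw [integral_integrand ha ht0] at h
  exact nonneg_of_mul_nonneg_left (nonneg_of_mul_nonneg_right h pi_pos) (by positivity)

end Conclusion

end OddProduct

theorem stmt2 :
    ∃ a : ℕ → ℝ, (∀ n, 0 ≤ a n) ∧
      ∀ q : ℂ, ‖q‖ < 1 →
        HasSum (fun n : ℕ => (a n : ℂ) * q ^ n)
          (∏' k : ℕ, (1 + (-1 : ℂ) ^ (k + 1) * q ^ (2 * k + 1))⁻¹) := by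
  obtain ⟨a, ha⟩ := OddProduct.exists_real_coeff
  exact ⟨a, OddProduct.coeff_nonneg ha, fun q hq => (OddProduct.hasProd_gen hq).tprod_eq ▸ ha q hq⟩
end

section
/- Let b ≥ 2 be an integer, ξ a primitive b-th root of unity, and 0 ≤ θ < π/2. Then F_1(ξ; e^{−z}) = (1 − ξ)^{−1/2} · e^{−ξ·Φ(ξ,2,1)/z} · (1 + O(|z|)) as z → 0 in D_θ. Precisely: there exist constants C > 0 and δ > 0 such that for all z ∈ D_θ with 0 < |z| ≤ δ, | (1 − ξ)^{1/2} · e^{ξ·Φ(ξ,2,1)/z} · ∏_{n=1}^∞ (1 − ξ e^{−nz}) − 1 | ≤ C·|z|. -/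
open Filter Topology

/-- The dilogarithm series. -/
noncomputable def dilogSeries (u : ℂ) : ℂ := ∑' n : ℕ, u ^ (n + 1) / ((n : ℂ) + 1) ^ 2

lemma norm_natCast_add_one (n : ℕ) : ‖(n : ℂ) + 1‖ = (n : ℝ) + 1 := by
  have := Complex.norm_natCast (n + 1)
  push_cast at this
  exact this

lemma natCast_add_one_ne_zero (n : ℕ) : (n : ℂ) + 1 ≠ 0 := Nat.cast_add_one_ne_zero n

lemma summable_one_div_add_one_sq : Summable fun n : ℕ => 1 / ((n : ℝ) + 1) ^ 2 := by
  have := (summable_nat_add_iff 1).2 (Real.summable_one_div_nat_pow.2 (by norm_num : 1 < 2))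
  simpa using this

lemma norm_dilogSeries_term_le {u : ℂ} (hu : ‖u‖ ≤ 1) (n : ℕ) :
    ‖u ^ (n + 1) / ((n : ℂ) + 1) ^ 2‖ ≤ 1 / ((n : ℝ) + 1) ^ 2 := by
  rw [norm_div, norm_pow, norm_pow, norm_natCast_add_one]
  gcongr
  exact pow_le_one₀ (norm_nonneg _) hu

lemma continuousOn_dilogSeries : ContinuousOn dilogSeries (Metric.closedBall 0 1) := by
  refine continuousOn_tsum (fun n => by fun_prop) summable_one_div_add_one_sq ?_
  intro n u hu
  exact norm_dilogSeries_term_le (by simpa using hu) n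

lemma dilogSeries_zero : dilogSeries 0 = 0 := by simp [dilogSeries]

lemma hasSum_pow_div_add_one {u : ℂ} (hu : ‖u‖ < 1) (hu0 : u ≠ 0) :
    HasSum (fun n : ℕ => u ^ n / ((n : ℂ) + 1)) (-Complex.log (1 - u) / u) := by
  have h := (hasSum_nat_add_iff' 1).2 (Complex.hasSum_taylorSeries_neg_log hu)
  simp only [Finset.sum_range_one, Nat.cast_zero, div_zero, sub_zero] at h
  have hterm : (fun n : ℕ => u ^ n / ((n : ℂ) + 1)) =
      fun n => u ^ (n + 1) / ((n + 1 : ℕ) : ℂ) / u := by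
    funext n
    have := natCast_add_one_ne_zero n
    push_cast
    rw [pow_succ]
    field_simp
  rw [hterm]
  exact h.div_const u

lemma hasDerivAt_dilogSeries {u : ℂ} (hu : ‖u‖ < 1) (hu0 : u ≠ 0) :
    HasDerivAt dilogSeries (-Complex.log (1 - u) / u) u := by
  obtain ⟨r, hur, hr1⟩ := exists_between hu
  have hr0 : 0 ≤ r := (norm_nonneg u).trans hur.le
  rw [← (hasSum_pow_div_add_one hu hu0).tsum_eq]
  refine hasDerivAt_tsum_of_isPreconnected (t := Metric.ball 0 r) (u := fun n => r ^ n)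
    (g := fun (n : ℕ) v => v ^ (n + 1) / ((n : ℂ) + 1) ^ 2)
    (g' := fun (n : ℕ) v => v ^ n / ((n : ℂ) + 1)) (y₀ := 0)
    (summable_geometric_of_lt_one hr0 hr1) Metric.isOpen_ball
    (convex_ball _ _).isPreconnected ?_ ?_ ?_ ?_ ?_
  · intro n v _
    refine ((hasDerivAt_pow (n + 1) v).div_const (((n : ℂ) + 1) ^ 2)).congr_deriv ?_
    have := natCast_add_one_ne_zero n
    rw [Nat.add_sub_cancel]
    push_cast
    field_simp
  · intro n v hv
    have hv : ‖v‖ < r := by simpa using hv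
    rw [norm_div, norm_pow, norm_natCast_add_one]
    calc ‖v‖ ^ n / ((n : ℝ) + 1) ≤ ‖v‖ ^ n := div_le_self (by positivity) (by simp)
      _ ≤ r ^ n := by gcongr
  · simpa using (norm_nonneg u).trans_lt hur
  · simp
  · simpa using hur

/-- Error of the trapezoidal rule on a complex segment. -/
lemma norm_trapezoid_error_le {G f f' f'' : ℂ → ℂ} {a b : ℂ} {M : ℝ}
    (hG : ∀ x ∈ segment ℝ a b, HasDerivAt G (f x) x)
    (hf : ∀ x ∈ segment ℝ a b, HasDerivAt f (f' x) x)
    (hf' : ∀ x ∈ segment ℝ a b, HasDerivAt f' (f'' x) x)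
    (hM : ∀ x ∈ segment ℝ a b, ‖f'' x‖ ≤ M) :
    ‖G b - G a - (b - a) / 2 * (f a + f b)‖ ≤ M * ‖b - a‖ ^ 3 := by
  have hM0 : 0 ≤ M := (norm_nonneg _).trans (hM a (left_mem_segment ℝ a b))
  have hdist : ∀ x ∈ segment ℝ a b, ‖x - a‖ ≤ ‖b - a‖ := fun x hx => by
    obtain ⟨t, ht, rfl⟩ := (segment_eq_image' ℝ a b ▸ hx)
    simp only [add_sub_cancel_left, norm_smul, Real.norm_eq_abs, abs_of_nonneg ht.1]
    exact mul_le_of_le_one_left (norm_nonneg _) ht.2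
  have hp : ∀ x ∈ segment ℝ a b, ‖f x - f a - (x - a) * f' x‖ ≤ M * ‖b - a‖ ^ 2 := by
    intro x hx
    have h := (convex_segment a b).norm_image_sub_le_of_norm_hasDerivWithin_le
      (f := fun y => f y - f a - (y - a) * f' y) (f' := fun y => -((y - a) * f'' y))
      (C := ‖b - a‖ * M)
      (fun y hy => by
        refine HasDerivAt.hasDerivWithinAt ?_
        refine (((hf y hy).sub_const (f a)).sub
          (((hasDerivAt_id y).sub_const a).mul (hf' y hy))).congr_deriv ?_
        simp only [id]
        ring)
      (fun y hy => by
        rw [norm_neg, norm_mul]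
        exact mul_le_mul (hdist y hy) (hM y hy) (norm_nonneg _) (norm_nonneg _))
      (left_mem_segment ℝ a b) hx
    simp only [sub_self, zero_mul, sub_zero] at h
    calc _ ≤ _ := h
      _ ≤ ‖b - a‖ * M * ‖b - a‖ := by gcongr; exact hdist x hx
      _ = _ := by ring
  have h := (convex_segment a b).norm_image_sub_le_of_norm_hasDerivWithin_le
    (f := fun y => G y - G a - (y - a) / 2 * (f a + f y))
    (f' := fun y => (f y - f a - (y - a) * f' y) / 2)
    (C := M * ‖b - a‖ ^ 2)
    (fun y hy => by
      refine HasDerivAt.hasDerivWithinAt ?_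
      refine (((hG y hy).sub_const (G a)).sub
        ((((hasDerivAt_id y).sub_const a).div_const 2).mul
          ((hf y hy).const_add (f a)))).congr_deriv ?_
      simp only [id]
      ring)
    (fun y hy => by
      rw [norm_div, Complex.norm_ofNat]
      have := hp y hy
      have := norm_nonneg (f y - f a - (y - a) * f' y)
      linarith)
    (left_mem_segment ℝ a b) (right_mem_segment ℝ a b)
  simp only [sub_self, zero_div, zero_mul, sub_zero] at h
  calc _ ≤ _ := h
    _ = _ := by ring

lemma one_sub_mem_slitPlane {u : ℂ} (hu : ‖u‖ ≤ 1) (hu1 : u ≠ 1) :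
    1 - u ∈ Complex.slitPlane := by
  rw [Complex.mem_slitPlane_iff]
  by_contra! h
  obtain ⟨h1, h2⟩ := h
  simp only [Complex.sub_re, Complex.one_re, Complex.sub_im, Complex.one_im] at h1 h2
  refine hu1 (Complex.ext ?_ ?_)
  · exact le_antisymm ((Complex.re_le_norm u).trans hu) (by simpa using h1)
  · simpa using h2

lemma norm_mul_cos_le_re {z : ℂ} {θ : ℝ} (hθ : θ ≤ Real.pi) (hz : |z.arg| ≤ θ) :
    ‖z‖ * Real.cos θ ≤ z.re := by
  rw [← Complex.norm_mul_cos_arg z, ← Real.cos_abs z.arg]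
  exact mul_le_mul_of_nonneg_left
    (Real.cos_le_cos_of_nonneg_of_le_pi (abs_nonneg _) hθ hz) (norm_nonneg _)

lemma norm_mul_exp_neg {ξ : ℂ} (hξ : ‖ξ‖ = 1) (w : ℂ) :
    ‖ξ * Complex.exp (-w)‖ = Real.exp (-w.re) := by
  rw [norm_mul, hξ, Complex.norm_exp, one_mul, Complex.neg_re]

lemma exists_le_norm_one_sub_mul_exp_neg {ξ : ℂ} (hξ : ‖ξ‖ = 1) (hξ1 : ξ ≠ 1) {c : ℝ}
    (hc : 0 < c) :
    ∃ κ : ℝ, 0 < κ ∧ ∀ w : ℂ, ‖w‖ * c ≤ w.re → κ ≤ ‖1 - ξ * Complex.exp (-w)‖ := by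
  have hpos : 0 < ‖1 - ξ‖ := norm_pos_iff.2 (sub_ne_zero.2 hξ1.symm)
  have hcont : ContinuousAt (fun w : ℂ => ‖1 - ξ * Complex.exp (-w)‖) 0 := by fun_prop
  have hev : ∀ᶠ w : ℂ in 𝓝 0, ‖1 - ξ‖ / 2 < ‖1 - ξ * Complex.exp (-w)‖ :=
    hcont.eventually_const_lt (by simpa using half_lt_self hpos)
  obtain ⟨r, hr, hball⟩ := Metric.eventually_nhds_iff.1 hev
  have hlt : Real.exp (-(r * c)) < 1 := by
    rw [Real.exp_lt_one_iff]
    have := mul_pos hr hc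
    linarith
  refine ⟨min (‖1 - ξ‖ / 2) (1 - Real.exp (-(r * c))), lt_min (by positivity) (by linarith), ?_⟩
  intro w hw
  rcases lt_or_ge ‖w‖ r with h | h
  · exact (min_le_left _ _).trans (hball (by simpa using h)).le
  · refine (min_le_right _ _).trans ?_
    have h1 : r * c ≤ w.re := (mul_le_mul_of_nonneg_right h hc.le).trans hw
    have h2 := norm_sub_norm_le (1 : ℂ) (ξ * Complex.exp (-w))
    rw [norm_mul_exp_neg hξ, norm_one] at h2
    have h3 : Real.exp (-w.re) ≤ Real.exp (-(r * c)) := Real.exp_le_exp.2 (by linarith)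
    linarith

section Derivatives

variable {ξ w : ℂ}

lemma hasDerivAt_mul_exp_neg (ξ w : ℂ) :
    HasDerivAt (fun w : ℂ => ξ * Complex.exp (-w)) (-(ξ * Complex.exp (-w))) w := by
  refine (((hasDerivAt_neg w).cexp).const_mul ξ).congr_deriv ?_
  ring

lemma norm_mul_exp_neg_lt_one (hξ : ‖ξ‖ = 1) (hw : 0 < w.re) :
    ‖ξ * Complex.exp (-w)‖ < 1 := by
  rw [norm_mul_exp_neg hξ]
  simpa using hw

lemma ne_one_of_norm_lt_one {u : ℂ} (hu : ‖u‖ < 1) : u ≠ 1 := by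
  rintro rfl
  simp at hu

lemma hasDerivAt_dilogSeries_mul_exp_neg (hξ : ‖ξ‖ = 1) (hw : 0 < w.re) :
    HasDerivAt (fun w : ℂ => dilogSeries (ξ * Complex.exp (-w)))
      (Complex.log (1 - ξ * Complex.exp (-w))) w := by
  have h0 : ξ * Complex.exp (-w) ≠ 0 := by
    rw [← norm_pos_iff, norm_mul_exp_neg hξ]
    exact Real.exp_pos _
  refine ((hasDerivAt_dilogSeries (norm_mul_exp_neg_lt_one hξ hw) h0).comp w
    (hasDerivAt_mul_exp_neg ξ w)).congr_deriv ?_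
  rw [div_mul_eq_mul_div, neg_mul_neg, mul_div_cancel_right₀ _ h0]

lemma hasDerivAt_log_one_sub_mul_exp_neg (hξ : ‖ξ‖ = 1) (hw : 0 < w.re) :
    HasDerivAt (fun w : ℂ => Complex.log (1 - ξ * Complex.exp (-w)))
      (ξ * Complex.exp (-w) / (1 - ξ * Complex.exp (-w))) w := by
  have h := norm_mul_exp_neg_lt_one hξ hw
  refine (((hasDerivAt_mul_exp_neg ξ w).const_sub 1).clog
    (one_sub_mem_slitPlane h.le (ne_one_of_norm_lt_one h))).congr_deriv ?_
  rw [neg_neg]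

lemma hasDerivAt_mul_exp_neg_div (hξ : ‖ξ‖ = 1) (hw : 0 < w.re) :
    HasDerivAt (fun w : ℂ => ξ * Complex.exp (-w) / (1 - ξ * Complex.exp (-w)))
      (-(ξ * Complex.exp (-w)) / (1 - ξ * Complex.exp (-w)) ^ 2) w := by
  have h := hasDerivAt_mul_exp_neg ξ w
  have hne : 1 - ξ * Complex.exp (-w) ≠ 0 :=
    sub_ne_zero.2 (ne_one_of_norm_lt_one (norm_mul_exp_neg_lt_one hξ hw)).symm
  refine (h.div (h.const_sub 1) hne).congr_deriv ?_
  ring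

end Derivatives

lemma norm_mul_exp_neg_le_one {ξ : ℂ} (hξ : ‖ξ‖ = 1) {w : ℂ} (hw : 0 ≤ w.re) :
    ‖ξ * Complex.exp (-w)‖ ≤ 1 := by
  rw [norm_mul_exp_neg hξ]
  simpa using hw

/-- Trapezoidal rule for `log (1 - ξ exp (-w))` on the segment from `n z` to `(n + 1) z`. -/
lemma norm_dilogSeries_step_le {ξ : ℂ} (hξ : ‖ξ‖ = 1) {κ : ℝ} (hκ : 0 < κ)
    {z : ℂ} (hz : 0 < z.re)
    (hlow : ∀ t : ℝ, 0 ≤ t → κ ≤ ‖1 - ξ * Complex.exp (-(t * z))‖) (n : ℕ) :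
    ‖dilogSeries (ξ * Complex.exp (-(((n : ℂ) + 1) * z))) - dilogSeries (ξ * Complex.exp (-(n * z)))
        - z / 2 * (Complex.log (1 - ξ * Complex.exp (-(n * z))) +
          Complex.log (1 - ξ * Complex.exp (-(((n : ℂ) + 1) * z))))‖
      ≤ ‖z‖ ^ 3 / κ ^ 2 * Real.exp (-z.re) ^ n := by
  set G : ℂ → ℂ := fun w => dilogSeries (ξ * Complex.exp (-w)) with hG
  set f : ℂ → ℂ := fun w => Complex.log (1 - ξ * Complex.exp (-w)) with hf
  have key : ∀ t : ℝ, (n : ℝ) < t → t ≤ n + 1 →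
      ‖G (((n : ℂ) + 1) * z) - G (t * z) - (((n : ℂ) + 1) * z - t * z) / 2 *
        (f (t * z) + f (((n : ℂ) + 1) * z))‖ ≤
      Real.exp (-z.re) ^ n / κ ^ 2 * ‖((n : ℂ) + 1) * z - t * z‖ ^ 3 := by
    intro t hnt htn
    have hseg : ∀ x ∈ segment ℝ ((t : ℂ) * z) (((n : ℂ) + 1) * z),
        ∃ s : ℝ, (n : ℝ) < s ∧ x = s * z := by
      intro x hx
      rw [segment_eq_image'] at hx
      obtain ⟨q, hq, rfl⟩ := hx
      refine ⟨t + q * (n + 1 - t), ?_, ?_⟩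
      · have := mul_nonneg hq.1 (sub_nonneg.2 htn)
        linarith
      · simp only [Complex.real_smul]
        push_cast
        ring
    have hre : ∀ s : ℝ, (n : ℝ) < s → 0 < ((s : ℂ) * z).re := fun s hs => by
      rw [Complex.re_ofReal_mul]
      exact mul_pos (n.cast_nonneg.trans_lt hs) hz
    refine norm_trapezoid_error_le
      (f' := fun w => ξ * Complex.exp (-w) / (1 - ξ * Complex.exp (-w)))
      (f'' := fun w => -(ξ * Complex.exp (-w)) / (1 - ξ * Complex.exp (-w)) ^ 2) ?_ ?_ ?_ ?_
    · intro x hx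
      obtain ⟨s, hs, rfl⟩ := hseg x hx
      exact hasDerivAt_dilogSeries_mul_exp_neg hξ (hre s hs)
    · intro x hx
      obtain ⟨s, hs, rfl⟩ := hseg x hx
      exact hasDerivAt_log_one_sub_mul_exp_neg hξ (hre s hs)
    · intro x hx
      obtain ⟨s, hs, rfl⟩ := hseg x hx
      exact hasDerivAt_mul_exp_neg_div hξ (hre s hs)
    · intro x hx
      obtain ⟨s, hs, rfl⟩ := hseg x hx
      rw [norm_div, norm_neg, norm_pow, norm_mul_exp_neg hξ, ← Real.exp_nat_mul,
        Complex.re_ofReal_mul]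
      have h1 := hlow s (n.cast_nonneg.trans hs.le)
      have h2 : -(s * z.re) ≤ n * -z.re := by nlinarith
      gcongr
  have hGc : ContinuousOn (fun t : ℝ => G (t * z)) (Set.Ici 0) := by
    refine continuousOn_dilogSeries.comp (f := fun t : ℝ => ξ * Complex.exp (-((t : ℂ) * z)))
      (by fun_prop) ?_
    intro t ht
    rw [mem_closedBall_zero_iff]
    refine norm_mul_exp_neg_le_one hξ ?_
    rw [Complex.re_ofReal_mul]
    exact mul_nonneg ht hz.le
  have hfc : ContinuousOn (fun t : ℝ => f (t * z)) (Set.Ici 0) := by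
    refine ContinuousOn.clog (by fun_prop) ?_
    intro t ht
    refine one_sub_mem_slitPlane (norm_mul_exp_neg_le_one hξ ?_) ?_
    · rw [Complex.re_ofReal_mul]
      exact mul_nonneg ht hz.le
    · intro h
      have := hlow t ht
      rw [h] at this
      simp at this
      linarith
  have hn0 : (n : ℝ) ∈ Set.Ici (0 : ℝ) := Set.mem_Ici.2 n.cast_nonneg
  have hsub : Set.Ioi (n : ℝ) ⊆ Set.Ici 0 := fun t ht =>
    Set.mem_Ici.2 (n.cast_nonneg.trans (le_of_lt ht))
  have hGt : Tendsto (fun t : ℝ => G (t * z)) (𝓝[>] (n : ℝ)) (𝓝 (G (n * z))) := by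
    simpa using ((hGc n hn0).mono hsub).tendsto
  have hft : Tendsto (fun t : ℝ => f (t * z)) (𝓝[>] (n : ℝ)) (𝓝 (f (n * z))) := by
    simpa using ((hfc n hn0).mono hsub).tendsto
  have hdt : Tendsto (fun t : ℝ => ((n : ℂ) + 1) * z - t * z) (𝓝[>] (n : ℝ)) (𝓝 z) := by
    have h : ContinuousAt (fun t : ℝ => ((n : ℂ) + 1) * z - t * z) (n : ℝ) := by fun_prop
    have h := h.tendsto.mono_left (nhdsWithin_le_nhds (s := Set.Ioi (n : ℝ)))
    convert h using 2
    push_cast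
    ring
  have hlim := le_of_tendsto_of_tendsto
    (((tendsto_const_nhds (x := G (((n : ℂ) + 1) * z))).sub hGt).sub ((hdt.div_const 2).mul
      (hft.add (tendsto_const_nhds (x := f (((n : ℂ) + 1) * z)))))).norm
    ((hdt.norm.pow 3).const_mul (Real.exp (-z.re) ^ n / κ ^ 2))
    (by
      filter_upwards [Ioc_mem_nhdsGT (show (n : ℝ) < n + 1 by linarith)] with t ht
      exact key t ht.1 ht.2)
  calc _ ≤ _ := hlim
    _ = _ := by ring

lemma half_le_one_sub_exp_neg {x : ℝ} (hx : 0 ≤ x) (hx1 : x ≤ 1) :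
    x / 2 ≤ 1 - Real.exp (-x) := by
  have h := Real.add_one_le_exp x
  have h2 : Real.exp (-x) ≤ (x + 1)⁻¹ := by
    rw [Real.exp_neg]
    exact inv_anti₀ (by linarith) h
  have h3 : (x + 1)⁻¹ ≤ 1 - x / 2 := by
    rw [inv_le_iff_one_le_mul₀ (by linarith)]
    nlinarith
  linarith

lemma norm_dilogSeries_sum_le {ξ : ℂ} (hξ : ‖ξ‖ = 1) {κ c : ℝ} (hκ : 0 < κ) (hc : 0 < c)
    {z : ℂ} (hz0 : z ≠ 0) (hz1 : ‖z‖ ≤ 1) (hzc : ‖z‖ * c ≤ z.re)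
    (hlow : ∀ t : ℝ, 0 ≤ t → κ ≤ ‖1 - ξ * Complex.exp (-(t * z))‖) (N : ℕ) :
    ‖Complex.log (1 - ξ) / 2 + dilogSeries ξ / z
        + ∑ n ∈ Finset.range N, Complex.log (1 - ξ * Complex.exp (-(((n : ℂ) + 1) * z)))
        - (dilogSeries (ξ * Complex.exp (-(N * z))) / z +
          Complex.log (1 - ξ * Complex.exp (-(N * z))) / 2)‖
      ≤ 2 / (κ ^ 2 * c) * ‖z‖ := by
  have hzn : 0 < ‖z‖ := norm_pos_iff.2 hz0
  have hx : 0 < z.re := (mul_pos hzn hc).trans_le hzc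
  have hq1 : Real.exp (-z.re) < 1 := by simpa using hx
  set E : ℕ → ℂ := fun n =>
    dilogSeries (ξ * Complex.exp (-(((n : ℂ) + 1) * z))) - dilogSeries (ξ * Complex.exp (-(n * z)))
        - z / 2 * (Complex.log (1 - ξ * Complex.exp (-(n * z))) +
          Complex.log (1 - ξ * Complex.exp (-(((n : ℂ) + 1) * z)))) with hE
  have htel : ∀ N : ℕ, -(z * (Complex.log (1 - ξ) / 2 + dilogSeries ξ / z
        + ∑ n ∈ Finset.range N, Complex.log (1 - ξ * Complex.exp (-(((n : ℂ) + 1) * z)))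
        - (dilogSeries (ξ * Complex.exp (-(N * z))) / z +
          Complex.log (1 - ξ * Complex.exp (-(N * z))) / 2))) = ∑ n ∈ Finset.range N, E n := by
    intro N
    induction N with
    | zero =>
      simp only [Finset.range_zero, Finset.sum_empty, Nat.cast_zero, zero_mul, neg_zero,
        Complex.exp_zero, mul_one]
      ring
    | succ N ih =>
      rw [Finset.sum_range_succ, Finset.sum_range_succ, ← ih, hE]
      push_cast
      field_simp
      ring
  have hsum : ‖∑ n ∈ Finset.range N, E n‖ ≤ ‖z‖ ^ 3 / κ ^ 2 * (1 - Real.exp (-z.re))⁻¹ := by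
    calc _ ≤ ∑ n ∈ Finset.range N, ‖z‖ ^ 3 / κ ^ 2 * Real.exp (-z.re) ^ n :=
          norm_sum_le_of_le _ fun n _ => norm_dilogSeries_step_le hξ hκ hx hlow n
      _ = ‖z‖ ^ 3 / κ ^ 2 * ∑ n ∈ Finset.range N, Real.exp (-z.re) ^ n := by
          rw [Finset.mul_sum]
      _ ≤ _ := by
          gcongr
          rw [← tsum_geometric_of_lt_one (Real.exp_pos _).le hq1]
          exact (summable_geometric_of_lt_one (Real.exp_pos _).le hq1).sum_le_tsum _
            fun n _ => by positivity
  rw [← htel, norm_neg, norm_mul] at hsum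
  have hgeom : (1 - Real.exp (-z.re))⁻¹ ≤ 2 / (‖z‖ * c) := by
    have h := half_le_one_sub_exp_neg hx.le ((Complex.re_le_norm z).trans hz1)
    rw [inv_le_comm₀ (by linarith) (by positivity), inv_div]
    linarith
  refine le_of_mul_le_mul_left (hsum.trans ?_) hzn
  calc _ ≤ ‖z‖ ^ 3 / κ ^ 2 * (2 / (‖z‖ * c)) := by gcongr
    _ = _ := by field_simp

lemma norm_exp_dilogSeries_mul_tprod_sub_one_le {ξ : ℂ} (hξ : ‖ξ‖ = 1) (hξ1 : ξ ≠ 1)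
    {z : ℂ} (hz : 0 < z.re) {K : ℝ} (hK : K ≤ 1)
    (hsum : ∀ N : ℕ, ‖Complex.log (1 - ξ) / 2 + dilogSeries ξ / z
        + ∑ n ∈ Finset.range N, Complex.log (1 - ξ * Complex.exp (-(((n : ℂ) + 1) * z)))
        - (dilogSeries (ξ * Complex.exp (-(N * z))) / z +
          Complex.log (1 - ξ * Complex.exp (-(N * z))) / 2)‖ ≤ K) :
    ‖(1 - ξ) ^ ((1 : ℂ) / 2) * Complex.exp (dilogSeries ξ / z) *
      (∏' n : ℕ, (1 - ξ * Complex.exp (-((n : ℂ) + 1) * z))) - 1‖ ≤ 2 * K := by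
  have hnorm : ∀ n : ℕ, ‖ξ * Complex.exp (-(n * z))‖ = Real.exp (-z.re) ^ n := fun n => by
    rw [norm_mul_exp_neg hξ, ← Real.exp_nat_mul, ← Complex.ofReal_natCast, Complex.re_ofReal_mul]
    ring_nf
  have hq1 : Real.exp (-z.re) < 1 := by simpa using hz
  have hgeom : Summable fun n : ℕ => ‖ξ * Complex.exp (-(n * z))‖ := by
    simp only [hnorm]
    exact summable_geometric_of_lt_one (Real.exp_pos _).le hq1
  have hmul : Multipliable fun n : ℕ => 1 - ξ * Complex.exp (-(((n : ℂ) + 1) * z)) := by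
    simp only [sub_eq_add_neg]
    refine multipliable_one_add_of_summable ?_
    simpa using (summable_nat_add_iff 1).2 hgeom
  have hprod := hmul.hasProd.tendsto_prod_nat
  have hu : Tendsto (fun N : ℕ => ξ * Complex.exp (-(N * z))) atTop (𝓝 0) :=
    tendsto_zero_iff_norm_tendsto_zero.2 hgeom.tendsto_atTop_zero
  have hlog : Tendsto (fun N : ℕ => Complex.log (1 - ξ * Complex.exp (-(N * z)))) atTop
      (𝓝 0) := by
    have h := (hu.const_sub 1).clog (by simp)
    simpa using h
  have hdil : Tendsto (fun N : ℕ => dilogSeries (ξ * Complex.exp (-(N * z)))) atTop (𝓝 0) := by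
    have h := (continuousOn_dilogSeries.continuousAt
      (Metric.closedBall_mem_nhds (0 : ℂ) one_pos)).tendsto.comp hu
    rwa [dilogSeries_zero] at h
  have hrest := (((hdil.div_const z).add (hlog.div_const 2)).neg).cexp
  simp only [zero_div, add_zero, neg_zero, Complex.exp_zero] at hrest
  have hlim := (((hprod.const_mul ((1 - ξ) ^ ((1 : ℂ) / 2) *
    Complex.exp (dilogSeries ξ / z))).mul hrest).sub_const 1).norm
  simp only [mul_one] at hlim
  simp only [neg_mul]
  refine le_of_tendsto hlim (Eventually.of_forall fun N => ?_)
  have hne : ∀ n : ℕ, 1 - ξ * Complex.exp (-(((n : ℂ) + 1) * z)) ≠ 0 := fun n => by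
    refine sub_ne_zero.2 (ne_one_of_norm_lt_one ?_).symm
    have h := hnorm (n + 1)
    push_cast at h
    rw [h]
    exact pow_lt_one₀ (Real.exp_pos _).le hq1 n.succ_ne_zero
  have hexp := (Complex.norm_exp_sub_one_le ((hsum N).trans hK)).trans
    (mul_le_mul_of_nonneg_left (hsum N) zero_le_two)
  rw [sub_eq_add_neg (_ + _), Complex.exp_add, Complex.exp_add, Complex.exp_add, Complex.exp_sum,
    Finset.prod_congr rfl fun n _ => Complex.exp_log (hne n)] at hexp
  rw [Complex.cpow_def_of_ne_zero (sub_ne_zero.2 hξ1.symm), mul_one_div]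
  exact hexp

theorem stmt8 (b : ℕ) (hb : 2 ≤ b) (ξ : ℂ) (hξ : IsPrimitiveRoot ξ b)
    (θ : ℝ) (hθ0 : 0 ≤ θ) (hθ : θ < Real.pi / 2) :
    ∃ C : ℝ, 0 < C ∧ ∃ δ : ℝ, 0 < δ ∧ ∀ z : ℂ, z ≠ 0 → ‖z‖ ≤ δ → |z.arg| ≤ θ →
      ‖(1 - ξ) ^ ((1 : ℂ)/2) *
          Complex.exp (ξ * (∑' n : ℕ, ξ ^ n / ((n : ℂ) + 1) ^ 2) / z) *
          (∏' n : ℕ, (1 - ξ * Complex.exp (-((n : ℂ) + 1) * z))) - 1‖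
        ≤ C * ‖z‖ := by
  have hξ1 : ξ ≠ 1 := hξ.ne_one hb
  have hξn : ‖ξ‖ = 1 := Complex.norm_eq_one_of_pow_eq_one hξ.pow_eq_one (by omega)
  have hc : 0 < Real.cos θ := Real.cos_pos_of_mem_Ioo ⟨by linarith [Real.pi_pos], hθ⟩
  obtain ⟨κ, hκ, hlow⟩ := exists_le_norm_one_sub_mul_exp_neg hξn hξ1 hc
  have hA : 0 < 2 / (κ ^ 2 * Real.cos θ) := by positivity
  set A := 2 / (κ ^ 2 * Real.cos θ)
  refine ⟨2 * A, by positivity, min 1 A⁻¹, by positivity, fun z hz0 hzδ harg => ?_⟩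
  have hzc := norm_mul_cos_le_re (by linarith [Real.pi_pos]) harg
  have hK : A * ‖z‖ ≤ 1 := by
    calc A * ‖z‖ ≤ A * A⁻¹ := by gcongr; exact hzδ.trans (min_le_right _ _)
      _ = 1 := mul_inv_cancel₀ hA.ne'
  have hdil : ξ * (∑' n : ℕ, ξ ^ n / ((n : ℂ) + 1) ^ 2) = dilogSeries ξ := by
    rw [dilogSeries, ← tsum_mul_left]
    congr with n
    ring
  rw [hdil, mul_assoc 2]
  refine norm_exp_dilogSeries_mul_tprod_sub_one_le hξn hξ1
    ((mul_pos (norm_pos_iff.2 hz0) hc).trans_le hzc) hK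
    (norm_dilogSeries_sum_le hξn hκ hc hz0 (hzδ.trans (min_le_left _ _)) hzc fun t ht => ?_)
  refine hlow _ ?_
  rw [norm_mul, Complex.norm_real, Real.norm_of_nonneg ht, Complex.re_ofReal_mul, mul_assoc]
  exact mul_le_mul_of_nonneg_left hzc ht
end

section
/- For every real number N > 0, the function x ↦ e^{−x}/(x(1 − e^{−Nx})) − 1/(N x²) + (1/N − 1/2)·e^{−x}/x is integrable on (0, ∞), and ∫_0^∞ ( e^{−x}/(x(1 − e^{−Nx})) − 1/(N x²) + (1/N − 1/2)·e^{−x}/x ) dx = log Γ(1/N) + (1/2 − 1/N)·log(1/N) − (1/2)·log(2π). -/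
open MeasureTheory

open Filter Topology Set

/-- The kernel `(1 / (1 - e⁻ᵗ) - 1 / t - 1 / 2) / t` of Binet's first formula. -/
noncomputable def binetKernel (t : ℝ) : ℝ :=
  (1 / (1 - Real.exp (-t)) - 1 / t - 1 / 2) / t

/-- The remainder term of `log Γ` in Binet's first formula. -/
noncomputable def binetIntegral (a : ℝ) : ℝ :=
  ∫ t in Ioi (0 : ℝ), binetKernel t * Real.exp (-(a * t))

lemma one_sub_exp_neg_pos {t : ℝ} (ht : 0 < t) : 0 < 1 - Real.exp (-t) :=
  sub_pos.2 (Real.exp_lt_one_iff.2 (neg_neg_of_pos ht))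

lemma one_add_mul_exp_neg_le_one (t : ℝ) : (1 + t) * Real.exp (-t) ≤ 1 := by
  calc (1 + t) * Real.exp (-t) ≤ Real.exp t * Real.exp (-t) := by
        gcongr
        linarith [Real.add_one_le_exp t]
    _ = 1 := by rw [← Real.exp_add]; simp

lemma sub_two_add_mul_exp_neg_nonneg {t : ℝ} (ht : 0 ≤ t) :
    0 ≤ t - 2 + (t + 2) * Real.exp (-t) := by
  have hderiv (x : ℝ) : HasDerivAt (fun t : ℝ => t - 2 + (t + 2) * Real.exp (-t))
      (1 - (1 + x) * Real.exp (-x)) x := by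
    have h1 : HasDerivAt (fun t : ℝ => Real.exp (-t)) (Real.exp (-x) * -1) x :=
      (hasDerivAt_neg x).exp
    refine (((hasDerivAt_id' x).sub_const 2).add
      (((hasDerivAt_id' x).add_const 2).mul h1)).congr_deriv ?_
    ring
  have hmono : Monotone (fun t : ℝ => t - 2 + (t + 2) * Real.exp (-t)) :=
    monotone_of_hasDerivAt_nonneg hderiv fun x =>
      sub_nonneg.2 (one_add_mul_exp_neg_le_one x)
  simpa using hmono ht

lemma binetKernel_eq {t : ℝ} (ht : 0 < t) :
    binetKernel t =
      (t - 2 + (t + 2) * Real.exp (-t)) / (2 * t ^ 2 * (1 - Real.exp (-t))) := by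
  have h : 1 - Real.exp (-t) ≠ 0 := (one_sub_exp_neg_pos ht).ne'
  unfold binetKernel
  field_simp
  ring

lemma binetKernel_nonneg {t : ℝ} (ht : 0 < t) : 0 ≤ binetKernel t := by
  rw [binetKernel_eq ht]
  have h : 0 < 1 - Real.exp (-t) := one_sub_exp_neg_pos ht
  exact div_nonneg (sub_two_add_mul_exp_neg_nonneg ht.le) (by positivity)

lemma binetKernel_le_one {t : ℝ} (ht : 0 < t) : binetKernel t ≤ 1 := by
  rw [binetKernel_eq ht]
  have h : 0 < 1 - Real.exp (-t) := one_sub_exp_neg_pos ht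
  rw [div_le_one (by positivity)]
  have hE : (1 + t + t ^ 2 / 2) * Real.exp (-t) ≤ 1 := by
    calc (1 + t + t ^ 2 / 2) * Real.exp (-t) ≤ Real.exp t * Real.exp (-t) := by
          gcongr
          exact Real.quadratic_le_exp_of_nonneg ht.le
      _ = 1 := by rw [← Real.exp_add]; simp
  have hq : 0 < 2 * t ^ 2 - t + 2 := by nlinarith [sq_nonneg (t - 1)]
  have h1 := mul_le_mul_of_nonneg_left hE hq.le
  have h2 : 0 ≤ (3 / 2 * t ^ 3 + t ^ 4) * Real.exp (-t) := by positivity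
  linear_combination h1 + h2

lemma measurable_binetKernel : Measurable binetKernel := by
  unfold binetKernel
  fun_prop

lemma integrableOn_exp_neg_mul_Ioi_zero {a : ℝ} (ha : 0 < a) :
    IntegrableOn (fun t : ℝ => Real.exp (-(a * t))) (Ioi 0) := by
  simpa using integrableOn_exp_mul_Ioi (neg_neg_of_pos ha) 0

lemma integral_exp_neg_mul_Ioi_zero {a : ℝ} (ha : 0 < a) :
    ∫ t in Ioi (0 : ℝ), Real.exp (-(a * t)) = 1 / a := by
  simpa using integral_exp_mul_Ioi (neg_neg_of_pos ha) 0

lemma integrableOn_binetKernel_mul_exp {a : ℝ} (ha : 0 < a) :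
    IntegrableOn (fun t : ℝ => binetKernel t * Real.exp (-(a * t))) (Ioi 0) := by
  refine (integrableOn_exp_neg_mul_Ioi_zero ha).mono'
    (measurable_binetKernel.mul (by fun_prop)).aestronglyMeasurable ?_
  filter_upwards [ae_restrict_mem measurableSet_Ioi] with t ht
  rw [Real.norm_of_nonneg (mul_nonneg (binetKernel_nonneg ht) (Real.exp_pos _).le)]
  exact mul_le_of_le_one_left (Real.exp_pos _).le (binetKernel_le_one ht)

lemma binetIntegral_nonneg (a : ℝ) : 0 ≤ binetIntegral a :=
  setIntegral_nonneg measurableSet_Ioi fun _ ht =>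
    mul_nonneg (binetKernel_nonneg ht) (Real.exp_pos _).le

lemma binetIntegral_le {a : ℝ} (ha : 0 < a) : binetIntegral a ≤ 1 / a := by
  rw [← integral_exp_neg_mul_Ioi_zero ha]
  exact setIntegral_mono_on (integrableOn_binetKernel_mul_exp ha)
    (integrableOn_exp_neg_mul_Ioi_zero ha) measurableSet_Ioi fun t ht =>
      mul_le_of_le_one_left (Real.exp_pos _).le (binetKernel_le_one ht)

lemma tendsto_binetIntegral_atTop : Tendsto binetIntegral atTop (𝓝 0) := by
  refine tendsto_of_tendsto_of_tendsto_of_le_of_le' tendsto_const_nhds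
    (tendsto_const_nhds.div_atTop tendsto_id : Tendsto (fun a : ℝ => 1 / a) atTop (𝓝 0))
    (Eventually.of_forall binetIntegral_nonneg) ?_
  filter_upwards [eventually_gt_atTop 0] with a ha using binetIntegral_le ha

/-- The derivative of `t ↦ (1 - e⁻ᵃᵗ) / t`. -/
noncomputable def expQuotientDeriv (a t : ℝ) : ℝ :=
  a * Real.exp (-(a * t)) / t - (1 - Real.exp (-(a * t))) / t ^ 2

lemma hasDerivAt_one_sub_exp_neg_mul (a t : ℝ) :
    HasDerivAt (fun t : ℝ => 1 - Real.exp (-(a * t))) (a * Real.exp (-(a * t))) t := by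
  refine ((((hasDerivAt_id' t).const_mul a).fun_neg.exp).const_sub 1).congr_deriv ?_
  ring

lemma integrableOn_expQuotientDeriv_and_integral_eq {a : ℝ} (ha : 0 < a) :
    IntegrableOn (expQuotientDeriv a) (Ioi 0) ∧
      ∫ t in Ioi (0 : ℝ), expQuotientDeriv a t = -a := by
  let f : ℝ → ℝ := fun t => 1 - Real.exp (-(a * t))
  have hf0 : HasDerivAt f a 0 := by simpa using hasDerivAt_one_sub_exp_neg_mul a 0
  have hds {t : ℝ} (ht : t ≠ 0) : dslope f 0 t = (1 - Real.exp (-(a * t))) / t := by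
    rw [dslope_of_ne _ ht, slope_def_field]
    simp [f]
  have hcont : ContinuousWithinAt (dslope f 0) (Ici 0) 0 :=
    (continuousAt_dslope_same.2 hf0.differentiableAt).continuousWithinAt
  have hderiv : ∀ t ∈ Ioi (0 : ℝ), HasDerivAt (dslope f 0) (expQuotientDeriv a t) t := by
    intro t ht
    have ht' : t ≠ 0 := ne_of_gt ht
    have h : HasDerivAt (fun t => (1 - Real.exp (-(a * t))) / t) (expQuotientDeriv a t) t := by
      refine ((hasDerivAt_one_sub_exp_neg_mul a t).div (hasDerivAt_id' t) ht').congr_deriv ?_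
      unfold expQuotientDeriv
      field_simp
    refine h.congr_of_eventuallyEq ?_
    filter_upwards [isOpen_ne.mem_nhds ht'] with s hs using hds hs
  have hneg : ∀ t ∈ Ioi (0 : ℝ), expQuotientDeriv a t ≤ 0 := by
    intro t ht
    have ht' : (0 : ℝ) < t := ht
    have h := one_add_mul_exp_neg_le_one (a * t)
    have : expQuotientDeriv a t = ((1 + a * t) * Real.exp (-(a * t)) - 1) / t ^ 2 := by
      unfold expQuotientDeriv
      field_simp
      ring
    rw [this]
    exact div_nonpos_of_nonpos_of_nonneg (by linarith) (by positivity)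
  have hlim : Tendsto (dslope f 0) atTop (𝓝 0) := by
    have hexp : Tendsto (fun t : ℝ => 1 - Real.exp (-(a * t))) atTop (𝓝 (1 - 0)) :=
      tendsto_const_nhds.sub (Real.tendsto_exp_neg_atTop_nhds_zero.comp
        (tendsto_id.const_mul_atTop ha))
    refine (hexp.div_atTop tendsto_id).congr' ?_
    filter_upwards [eventually_gt_atTop 0] with t ht using (hds ht.ne').symm
  refine ⟨integrableOn_Ioi_deriv_of_nonpos hcont hderiv hneg hlim, ?_⟩
  rw [integral_Ioi_of_hasDerivAt_of_nonpos hcont hderiv hneg hlim, dslope_same, hf0.deriv,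
    zero_sub]

lemma binetIntegral_sub_binetIntegral_add_one {a : ℝ} (ha : 0 < a) :
    binetIntegral a - binetIntegral (a + 1) = (a + 1 / 2) * Real.log ((a + 1) / a) - 1 := by
  have ha1 : 0 < a + 1 := by linarith
  obtain ⟨hK, hKint⟩ := integrableOn_expQuotientDeriv_and_integral_eq ha
  obtain ⟨hK1, hK1int⟩ := integrableOn_expQuotientDeriv_and_integral_eq ha1
  have hB := integrableOn_binetKernel_mul_exp ha
  have hB1 := integrableOn_binetKernel_mul_exp ha1
  have key : EqOn (fun t : ℝ => t⁻¹ • (Real.exp (-(a * t)) - Real.exp (-((a + 1) * t))))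
      (fun t => (a + 1 / 2)⁻¹ * ((binetKernel t * Real.exp (-(a * t)) -
        binetKernel t * Real.exp (-((a + 1) * t))) -
        (expQuotientDeriv (a + 1) t - expQuotientDeriv a t))) (Ioi 0) := by
    intro t ht
    have ht' : (0 : ℝ) < t := ht
    have h : 1 - Real.exp (-t) ≠ 0 := (one_sub_exp_neg_pos ht').ne'
    have hsplit : Real.exp (-((a + 1) * t)) = Real.exp (-(a * t)) * Real.exp (-t) := by
      rw [← Real.exp_add]
      ring_nf
    have h2 : a + 1 / 2 ≠ 0 := by positivity
    simp only [smul_eq_mul, binetKernel, expQuotientDeriv, hsplit]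
    rw [eq_inv_mul_iff_mul_eq₀ h2]
    field_simp
    ring
  have hBsub : IntegrableOn (fun t => binetKernel t * Real.exp (-(a * t)) -
      binetKernel t * Real.exp (-((a + 1) * t))) (Ioi 0) := hB.sub hB1
  have hKsub : IntegrableOn (fun t => expQuotientDeriv (a + 1) t - expQuotientDeriv a t)
      (Ioi 0) := hK1.sub hK
  have hint := (hBsub.sub hKsub).const_mul (a + 1 / 2)⁻¹
  have hF : IntegrableOn
      (fun t : ℝ => t⁻¹ • (Real.exp (-(a * t)) - Real.exp (-((a + 1) * t)))) (Ioi 0) :=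
    IntegrableOn.congr_fun hint key.symm measurableSet_Ioi
  have hlim0 : Tendsto (fun t : ℝ => Real.exp (-t)) (𝓝[>] 0) (𝓝 1) := by
    have : Continuous fun t : ℝ => Real.exp (-t) := by fun_prop
    simpa using (this.tendsto 0).mono_left nhdsWithin_le_nhds
  have hFr := Frullani.integral_Ioi_eq (f := fun t : ℝ => Real.exp (-t))
    ((by fun_prop : Continuous fun t : ℝ => Real.exp (-t)).locallyIntegrable.locallyIntegrableOn _)
    ha ha1 hlim0 Real.tendsto_exp_neg_atTop_nhds_zero hF
  rw [setIntegral_congr_fun measurableSet_Ioi key, integral_const_mul,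
    integral_sub hBsub hKsub, integral_sub hB hB1, integral_sub hK1 hK,
    hKint, hK1int, inv_mul_eq_iff_eq_mul₀ (by positivity)] at hFr
  change binetIntegral a - binetIntegral (a + 1) - _ = _ at hFr
  rw [smul_eq_mul] at hFr
  linarith

lemma tendsto_log_Gamma_add_nat_sub {a : ℝ} (ha : 0 < a) :
    Tendsto (fun n : ℕ => Real.log (Real.Gamma (a + (n + 1 : ℕ))) - a * Real.log n -
      Real.log n.factorial) atTop (𝓝 0) := by
  have h := (tendsto_const_nhds (x := Real.log (Real.Gamma a))).sub
    (Real.BohrMollerup.tendsto_log_gamma ha)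
  rw [sub_self] at h
  refine h.congr fun n => ?_
  have hrec := Real.BohrMollerup.f_add_nat_eq (f := Real.log ∘ Real.Gamma) (x := a)
    (fun {y} hy => by
      rw [Function.comp_apply, Real.Gamma_add_one hy.ne',
        Real.log_mul hy.ne' (Real.Gamma_pos_of_pos hy).ne', add_comm, Function.comp_apply])
    ha (n + 1)
  simp only [Function.comp_apply] at hrec
  rw [hrec, Real.BohrMollerup.logGammaSeq]
  ring

/-- **Binet's first formula** for `log Γ`. -/
theorem log_Gamma_eq_add_binetIntegral {a : ℝ} (ha : 0 < a) :
    Real.log (Real.Gamma a) =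
      (a - 1 / 2) * Real.log a - a + 1 / 2 * Real.log (2 * Real.pi) + binetIntegral a := by
  let D : ℝ → ℝ := fun a =>
    Real.log (Real.Gamma a) - (a - 1 / 2) * Real.log a + a - binetIntegral a
  have hstep {x : ℝ} (hx : 0 < x) : D (x + 1) = D x := by
    have h := binetIntegral_sub_binetIntegral_add_one hx
    rw [Real.log_div (by positivity) hx.ne'] at h
    simp only [D]
    rw [Real.Gamma_add_one hx.ne', Real.log_mul hx.ne' (Real.Gamma_pos_of_pos hx).ne']
    linear_combination h
  have hconst (n : ℕ) : D (a + n) = D a := by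
    induction n with
    | zero => simp
    | succ n ih => rw [Nat.cast_succ, ← add_assoc, hstep (by positivity), ih]
  have hlim : Tendsto (fun n : ℕ => D (a + (n + 1 : ℕ))) atTop
      (𝓝 (1 / 2 * Real.log (2 * Real.pi))) := by
    have hcast : Tendsto (fun n : ℕ => (n : ℝ)) atTop atTop := tendsto_natCast_atTop_atTop
    have h1 := tendsto_log_Gamma_add_nat_sub ha
    have h2 : Tendsto (fun n => Real.log (Stirling.stirlingSeq n)) atTop
        (𝓝 (Real.log √Real.pi)) :=
      Stirling.tendsto_stirlingSeq_sqrt_pi.log (by positivity)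
    have h3 := (Real.tendsto_mul_log_one_add_div_atTop (a + 1)).comp hcast
    have h4 : Tendsto (fun n : ℕ => Real.log (1 + (a + 1) / (n : ℝ))) atTop (𝓝 0) := by
      have h := (tendsto_const_nhds (x := (1 : ℝ))).add
        ((tendsto_const_nhds (x := a + 1)).div_atTop hcast)
      simpa using h.log (by simp)
    have h5 : Tendsto (fun n : ℕ => binetIntegral (a + (n + 1 : ℕ))) atTop (𝓝 0) :=
      tendsto_binetIntegral_atTop.comp (tendsto_atTop_add_const_left _ a
        (hcast.comp (tendsto_add_atTop_nat 1)))
    have h := ((((h1.add h2).sub h3).sub (h4.const_mul (a + 1 / 2))).sub h5).add_const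
      (1 / 2 * Real.log 2 + a + 1)
    have hval : 0 + Real.log √Real.pi - (a + 1) - (a + 1 / 2) * 0 - 0 +
        (1 / 2 * Real.log 2 + a + 1) = 1 / 2 * Real.log (2 * Real.pi) := by
      rw [Real.log_sqrt Real.pi_pos.le, Real.log_mul two_ne_zero Real.pi_ne_zero]
      ring
    rw [hval] at h
    refine h.congr' ?_
    filter_upwards [eventually_gt_atTop 0] with n hn
    have hn' : (0 : ℝ) < n := Nat.cast_pos.2 hn
    have hlog : Real.log (a + (n + 1 : ℕ)) = Real.log n + Real.log (1 + (a + 1) / n) := by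
      rw [← Real.log_mul hn'.ne' (by positivity)]
      congr 1
      push_cast
      field_simp
      ring
    simp only [D, Function.comp_apply]
    rw [hlog, Stirling.log_stirlingSeq_formula, Real.log_mul two_ne_zero hn'.ne',
      Real.log_div hn'.ne' (Real.exp_pos 1).ne', Real.log_exp]
    push_cast
    ring
  have hD : D a = 1 / 2 * Real.log (2 * Real.pi) :=
    tendsto_nhds_unique (tendsto_const_nhds.congr fun n => (hconst (n + 1)).symm) hlim
  simp only [D] at hD
  linarith

theorem stmt10 (N : ℝ) (hN : 0 < N) :
    IntegrableOn
      (fun x : ℝ => Real.exp (-x) / (x * (1 - Real.exp (-(N * x)))) - 1 / (N * x ^ 2)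
        + (1 / N - 1 / 2) * Real.exp (-x) / x) (Set.Ioi 0) ∧
    ∫ x in Set.Ioi (0 : ℝ),
        (Real.exp (-x) / (x * (1 - Real.exp (-(N * x)))) - 1 / (N * x ^ 2)
          + (1 / N - 1 / 2) * Real.exp (-x) / x) =
      Real.log (Real.Gamma (1 / N)) + (1 / 2 - 1 / N) * Real.log (1 / N)
        - (1 / 2) * Real.log (2 * Real.pi) := by
  have ha : 0 < 1 / N := by positivity
  obtain ⟨hK, hKint⟩ := integrableOn_expQuotientDeriv_and_integral_eq ha
  have hB := integrableOn_binetKernel_mul_exp ha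
  have hsum := hB.add hK
  let G : ℝ → ℝ := fun t =>
    binetKernel t * Real.exp (-(1 / N * t)) + expQuotientDeriv (1 / N) t
  have hG : IntegrableOn G (Ioi 0) := hsum
  have key : EqOn (fun x : ℝ => N * G (N * x))
      (fun x : ℝ => Real.exp (-x) / (x * (1 - Real.exp (-(N * x)))) - 1 / (N * x ^ 2)
        + (1 / N - 1 / 2) * Real.exp (-x) / x) (Ioi 0) := by
    intro x hx
    have hx' : (0 : ℝ) < x := hx
    have h : 1 - Real.exp (-(N * x)) ≠ 0 := (one_sub_exp_neg_pos (mul_pos hN hx')).ne'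
    have hNx : 1 / N * (N * x) = x := by field_simp
    simp only [G, binetKernel, expQuotientDeriv, hNx]
    field_simp
    ring
  have hscaled : IntegrableOn (fun x => G (N * x)) (Ioi 0) :=
    (integrableOn_Ioi_comp_mul_left_iff G 0 hN).2 (by rwa [mul_zero])
  refine ⟨IntegrableOn.congr_fun (hscaled.const_mul N) key measurableSet_Ioi, ?_⟩
  rw [← setIntegral_congr_fun measurableSet_Ioi key, integral_const_mul,
    integral_comp_mul_left_Ioi G 0 hN, mul_zero, smul_eq_mul, mul_inv_cancel_left₀ hN.ne']
  have hval : ∫ t in Ioi (0 : ℝ), G t = binetIntegral (1 / N) + -(1 / N) := by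
    rw [← hKint]
    exact integral_add hB hK
  rw [hval, log_Gamma_eq_add_binetIntegral ha]
  ring
end
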